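/- arXiv:2107.02796 — 3 statements merged into one kernel-verified Lean document; each statement's English description precedes it below -/
import Mathlib

section
/- Every maximal outerplanar graph on n ≥ 3 vertices has double domination number at most ⌊2n/3⌋. -/
open SimpleGraph

/-- `S` is a double dominating set of `G`: every vertex has at least two
vertices of its closed neighborhood in `S`. -/
def IsDoubleDomSet {V : Type*} [Fintype V] [DecidableEq V]
    (G : SimpleGraph V) [DecidableRel G.Adj] (S : Finset V) : Prop :=
  ∀ v : V, 2 ≤ (S ∩ insert v (G.neighborFinset v)).card

/-- The double domination number `γ×2(G)`. -/
noncomputable def doubleDomNum {V : Type*} [Fintype V] [DecidableEq V]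
    (G : SimpleGraph V) [DecidableRel G.Adj] : ℕ :=
  sInf {k | ∃ S : Finset V, IsDoubleDomSet G S ∧ S.card = k}

/-- `H` is a minor of `G`. -/
def HasMinor {V W : Type*} (G : SimpleGraph V) (H : SimpleGraph W) : Prop :=
  ∃ f : W → Set V,
    (∀ w, (f w).Nonempty) ∧
    (∀ w, (G.induce (f w)).Connected) ∧
    (Pairwise fun w₁ w₂ => Disjoint (f w₁) (f w₂)) ∧
    ∀ ⦃w₁ w₂⦄, H.Adj w₁ w₂ → ∃ a ∈ f w₁, ∃ b ∈ f w₂, G.Adj a b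

/-- A graph is outerplanar iff it has no `K₄` minor and no `K_{2,3}` minor. -/
def Outerplanar {V : Type*} (G : SimpleGraph V) : Prop :=
  ¬ HasMinor G (⊤ : SimpleGraph (Fin 4)) ∧
  ¬ HasMinor G (completeBipartiteGraph (Fin 2) (Fin 3))

/-- Maximal outerplanar: outerplanar, and adding any missing edge destroys
outerplanarity. -/
def MaximalOuterplanar {V : Type*} (G : SimpleGraph V) : Prop :=
  Outerplanar G ∧
  ∀ u v : V, u ≠ v → ¬ G.Adj u v →
    ¬ Outerplanar (G ⊔ SimpleGraph.fromEdgeSet {s(u, v)})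

/-- `T` is an internal triangle of `G`: a triangle none of whose edges lies
on any Hamiltonian cycle (for a maximal outerplanar graph on `≥ 4` vertices
the Hamiltonian cycle, i.e. the boundary of the outer face, is unique). -/
def IsInternalTriangle {V : Type*} [DecidableEq V] (G : SimpleGraph V) (T : Finset V) : Prop :=
  ∃ a b c : V, T = {a, b, c} ∧ a ≠ b ∧ a ≠ c ∧ b ≠ c ∧
    G.Adj a b ∧ G.Adj a c ∧ G.Adj b c ∧
    ∀ ⦃v : V⦄ (p : G.Walk v v), p.IsHamiltonianCycle →
      s(a, b) ∉ p.edges ∧ s(a, c) ∉ p.edges ∧ s(b, c) ∉ p.edges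

/-- `IsTwoTreeOn G s`: the induced subgraph of `G` on `s` is a 2-tree,
built from a triangle by repeatedly adding a vertex joined exactly to the
two endpoints of an existing edge. -/
inductive IsTwoTreeOn {V : Type*} [DecidableEq V] (G : SimpleGraph V) :
    Finset V → Prop
  | triangle {a b c : V} : a ≠ b → a ≠ c → b ≠ c →
      G.Adj a b → G.Adj a c → G.Adj b c → IsTwoTreeOn G {a, b, c}
  | grow {s : Finset V} {x y v : V} : IsTwoTreeOn G s → x ∈ s → y ∈ s →
      G.Adj x y → v ∉ s → (∀ u ∈ s, G.Adj v u ↔ u = x ∨ u = y) →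
      IsTwoTreeOn G (insert v s)

/-- `G` is a 2-tree (equivalently, a maximal `K₄`-minor-free graph). -/
def IsTwoTree {V : Type*} [Fintype V] [DecidableEq V] (G : SimpleGraph V) : Prop :=
  IsTwoTreeOn G Finset.univ


namespace DD

variable {V : Type*}

/-- Union of two connected sets joined by an edge. -/
lemma conn_union {G : SimpleGraph V} {A B : Set V} (hA : (G.induce A).Connected)
    (hB : (G.induce B).Connected) {a b : V} (ha : a ∈ A) (hb : b ∈ B) (hab : G.Adj a b) :
    (G.induce (A ∪ B)).Connected := by
  have h1 := G.induce_union_connected hA.preconnected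
    (G.induce_pair_connected_of_adj hab).preconnected ⟨a, ha, by simp⟩
  have h2 := G.induce_union_connected h1.preconnected hB.preconnected ⟨b, by simp, hb⟩
  have : A ∪ {a, b} ∪ B = A ∪ B := by
    ext x
    simp only [Set.mem_union, Set.mem_insert_iff, Set.mem_singleton_iff]
    grind
  rwa [this] at h2

lemma conn_singleton (G : SimpleGraph V) (a : V) : (G.induce ({a} : Set V)).Connected := by
  rw [SimpleGraph.connected_iff_exists_forall_reachable]
  refine ⟨⟨a, rfl⟩, ?_⟩
  rintro ⟨b, rfl⟩
  exact Reachable.refl _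

/-- In a connected set, a predicate which changes its value changes along an edge. -/
lemma conn_boundary {G : SimpleGraph V} {A : Set V} (hA : (G.induce A).Connected)
    (P : V → Prop) {a b : V} (ha : a ∈ A) (hb : b ∈ A) (hPa : P a) (hPb : ¬ P b) :
    ∃ p ∈ A, ∃ q ∈ A, G.Adj p q ∧ P p ∧ ¬ P q := by
  obtain ⟨w⟩ := hA.preconnected ⟨a, ha⟩ ⟨b, hb⟩
  obtain ⟨d, -, h1, h2⟩ := w.exists_boundary_dart {x | P x.1} hPa hPb
  exact ⟨d.fst, d.fst.2, d.snd, d.snd.2, d.adj, h1, h2⟩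

/-- `f` orders the vertices of `s` such that no two edges inside `s` cross. -/
def NonCross (G : SimpleGraph V) (s : Finset V) (f : V → ℕ) : Prop :=
  Set.InjOn f s ∧ ∀ a ∈ s, ∀ b ∈ s, ∀ c ∈ s, ∀ d ∈ s, f a < f b → f b < f c → f c < f d →
    G.Adj a c → G.Adj b d → False

/-- The same for all vertices. -/
def NonCrossAll (G : SimpleGraph V) (f : V → ℕ) : Prop :=
  Function.Injective f ∧ ∀ a b c d, f a < f b → f b < f c → f c < f d →
    G.Adj a c → G.Adj b d → False

/-- Disjoint connected sets do not cross. -/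
lemma no_cross_sets {G : SimpleGraph V} {f : V → ℕ} (hf : NonCrossAll G f) {A B : Set V}
    (hA : (G.induce A).Connected) (hB : (G.induce B).Connected)
    (hAB : Disjoint A B) {a b a' b' : V} (ha : a ∈ A) (ha' : a' ∈ A) (hb : b ∈ B) (hb' : b' ∈ B)
    (h1 : f a < f b) (h2 : f b < f a') (h3 : f a' < f b') : False := by
  obtain ⟨inj, nc⟩ := hf
  have hne : ∀ x ∈ A, ∀ y ∈ B, f x ≠ f y := by
    intro x hx y hy h
    exact Set.disjoint_left.1 hAB hx (inj h ▸ hy)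
  obtain ⟨p, hp, q, hq, hpq, hp1, hq1⟩ := conn_boundary hA (fun x => f b < f x ∧ f x < f b')
    ha' ha ⟨h2, h3⟩ (by omega)
  have e1 := hne p hp b hb
  have e2 := hne p hp b' hb'
  have e3 := hne q hq b hb
  have e4 := hne q hq b' hb'
  rcases lt_or_gt_of_ne e3 with h | h
  · obtain ⟨r, hr, t, ht, hrt, hr1, ht1⟩ := conn_boundary hB (fun x => f q < f x ∧ f x < f p)
      hb hb' (by omega) (by omega)
    have := hne p hp t ht
    have := hne q hq t ht
    rcases lt_or_ge (f t) (f q) with h' | h'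
    · exact nc t q r p (by omega) (by omega) (by omega) hrt.symm hpq.symm
    · exact nc q r p t (by omega) (by omega) (by omega) hpq.symm hrt
  · obtain ⟨r, hr, t, ht, hrt, hr1, ht1⟩ := conn_boundary hB (fun x => f p < f x ∧ f x < f q)
      hb' hb (by omega) (by omega)
    have := hne p hp t ht
    have := hne q hq t ht
    rcases lt_or_ge (f t) (f p) with h' | h'
    · exact nc t p r q (by omega) (by omega) (by omega) hrt.symm hpq
    · exact nc p r q t (by omega) (by omega) (by omega) hpq hrt

/-- A graph with a noncrossing order has no `K₄` minor. -/
lemma no_K4 {G : SimpleGraph V} {f : V → ℕ} (hf : NonCrossAll G f) :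
    ¬ HasMinor G (⊤ : SimpleGraph (Fin 4)) := by
  rintro ⟨F, hne, hc, hd, hadj⟩
  choose r hr using hne
  have hinj : Function.Injective (f ∘ r) := by
    intro i j h
    by_contra hij
    exact Set.disjoint_left.1 (hd hij) (hr i) (hf.1 h ▸ hr j)
  have hmono := (Tuple.monotone_sort (f ∘ r)).strictMono_of_injective
    (hinj.comp (Tuple.sort (f ∘ r)).injective)
  set σ := Tuple.sort (f ∘ r) with hσ
  have hun : ∀ i j : Fin 4, i ≠ j → (G.induce (F (σ i) ∪ F (σ j))).Connected := by
    intro i j hij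
    obtain ⟨a, ha, b, hb, hab⟩ := @hadj (σ i) (σ j) (by simpa using hij)
    exact conn_union (hc _) (hc _) ha hb hab
  have hdis : ∀ i j : Fin 4, i ≠ j → Disjoint (F (σ i)) (F (σ j)) :=
    fun i j hij => hd (fun h => hij (σ.injective h))
  refine no_cross_sets hf (hun 0 2 (by decide)) (hun 1 3 (by decide)) ?_
    (Or.inl (hr (σ 0))) (Or.inr (hr (σ 2))) (Or.inl (hr (σ 1))) (Or.inr (hr (σ 3)))
    (hmono (by decide : (0 : Fin 4) < 1)) (hmono (by decide : (1 : Fin 4) < 2))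
    (hmono (by decide : (2 : Fin 4) < 3))
  rw [Set.disjoint_union_left, Set.disjoint_union_right, Set.disjoint_union_right]
  exact ⟨⟨hdis _ _ (by decide), hdis _ _ (by decide)⟩, hdis _ _ (by decide), hdis _ _ (by decide)⟩

/-- A graph with a noncrossing order has no `K_{2,3}` minor. -/
lemma no_K23 {G : SimpleGraph V} {f : V → ℕ} (hf : NonCrossAll G f) :
    ¬ HasMinor G (completeBipartiteGraph (Fin 2) (Fin 3)) := by
  rintro ⟨F, hne, hc, hd, hadj⟩
  choose r hr using hne
  have hinj : ∀ i j, i ≠ j → f (r i) ≠ f (r j) := by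
    intro i j hij h
    exact Set.disjoint_left.1 (hd hij) (hr i) (hf.1 h ▸ hr j)
  have hun : ∀ i j, (G.induce (F (Sum.inl i) ∪ F (Sum.inr j))).Connected := by
    intro i j
    obtain ⟨a, ha, b, hb, hab⟩ := @hadj (Sum.inl i) (Sum.inr j) (by simp)
    exact conn_union (hc _) (hc _) ha hb hab
  have key : ∀ x y : Fin 2, ∀ i j : Fin 3, x ≠ y → i ≠ j → ∀ p ∈ F (Sum.inl x) ∪ F (Sum.inr i),
      ∀ p' ∈ F (Sum.inl x) ∪ F (Sum.inr i), ∀ q ∈ F (Sum.inl y) ∪ F (Sum.inr j),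
      ∀ q' ∈ F (Sum.inl y) ∪ F (Sum.inr j), ¬ (f p < f q ∧ f q < f p' ∧ f p' < f q') := by
    rintro x y i j hxy hij p hp p' hp' q hq q' hq' ⟨h1, h2, h3⟩
    refine no_cross_sets hf (hun x i) (hun y j) ?_ hp hp' hq hq' h1 h2 h3
    rw [Set.disjoint_union_left, Set.disjoint_union_right, Set.disjoint_union_right]
    exact ⟨⟨hd (by simpa using hxy), hd (by simp)⟩, hd (by simp), hd (by simpa using hij)⟩
  -- two points on the same arc
  have main : ∀ x y : Fin 2, ∀ i j : Fin 3, x ≠ y → i ≠ j → f (r (Sum.inl x)) < f (r (Sum.inl y)) →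
      f (r (Sum.inr i)) < f (r (Sum.inr j)) →
      ((f (r (Sum.inl x)) < f (r (Sum.inr i)) ∧ f (r (Sum.inr i)) < f (r (Sum.inl y))) ↔
       (f (r (Sum.inl x)) < f (r (Sum.inr j)) ∧ f (r (Sum.inr j)) < f (r (Sum.inl y)))) →
      False := by
    intro x y i j hxy hij h1 h2 h3
    have e1 := hinj (Sum.inl x) (Sum.inr i) (by simp)
    have e2 := hinj (Sum.inl x) (Sum.inr j) (by simp)
    have e3 := hinj (Sum.inl y) (Sum.inr i) (by simp)
    have e4 := hinj (Sum.inl y) (Sum.inr j) (by simp)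
    have mx : ∀ k, r (Sum.inl x) ∈ F (Sum.inl x) ∪ F (Sum.inr k) := fun k => Or.inl (hr _)
    have my : ∀ k, r (Sum.inl y) ∈ F (Sum.inl y) ∪ F (Sum.inr k) := fun k => Or.inl (hr _)
    have mi : ∀ k, r (Sum.inr i) ∈ F (Sum.inl k) ∪ F (Sum.inr i) := fun k => Or.inr (hr _)
    have mj : ∀ k, r (Sum.inr j) ∈ F (Sum.inl k) ∪ F (Sum.inr j) := fun k => Or.inr (hr _)
    have k1 := key x y i j hxy hij _ (mx i) _ (mi x) _ (my j) _ (mj y)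
    have k2 := key x y j i hxy hij.symm _ (mx j) _ (mj x) _ (mi y) _ (my i)
    have k3 := key x y i j hxy hij _ (mi x) _ (mx i) _ (mj y) _ (my j)
    have k4 := key y x i j hxy.symm hij _ (mi y) _ (my i) _ (mx j) _ (mj x)
    omega
  have hlt : ∃ x y : Fin 2, x ≠ y ∧ f (r (Sum.inl x)) < f (r (Sum.inl y)) := by
    rcases lt_or_gt_of_ne (hinj (Sum.inl 0) (Sum.inl 1) (by simp)) with h | h
    · exact ⟨0, 1, by decide, h⟩
    · exact ⟨1, 0, by decide, h⟩
  obtain ⟨x, y, hxy, hlt⟩ := hlt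
  have main' : ∀ i j : Fin 3, i ≠ j →
      ¬ ((f (r (Sum.inl x)) < f (r (Sum.inr i)) ∧ f (r (Sum.inr i)) < f (r (Sum.inl y))) ↔
       (f (r (Sum.inl x)) < f (r (Sum.inr j)) ∧ f (r (Sum.inr j)) < f (r (Sum.inl y)))) := by
    intro i j hij h
    rcases lt_or_gt_of_ne (hinj (Sum.inr i) (Sum.inr j) (by simpa using hij)) with h' | h'
    · exact main x y i j hxy hij hlt h' h
    · exact main x y j i hxy hij.symm hlt h' h.symm
  have a1 := main' 0 1 (by decide)
  have a2 := main' 0 2 (by decide)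
  have a3 := main' 1 2 (by decide)
  tauto

lemma outerplanar_of_nonCrossAll {G : SimpleGraph V} {f : V → ℕ} (hf : NonCrossAll G f) :
    Outerplanar G := ⟨no_K4 hf, no_K23 hf⟩

/-- In a maximal outerplanar graph with a noncrossing order, each non-edge is crossed. -/
lemma crossed_of_maximal {G : SimpleGraph V} (h : MaximalOuterplanar G) {f : V → ℕ}
    (hf : NonCrossAll G f) {u v : V} (huv : f u < f v) (hn : ¬ G.Adj u v) :
    ∃ p q, G.Adj p q ∧ f u < f p ∧ f p < f v ∧ (f q < f u ∨ f v < f q) := by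
  have hne : u ≠ v := by rintro rfl; omega
  by_contra hcon
  push Not at hcon
  refine h.2 u v hne hn (outerplanar_of_nonCrossAll (f := f) ⟨hf.1, ?_⟩)
  intro a b c d h1 h2 h3 hac hbd
  simp only [SimpleGraph.sup_adj, SimpleGraph.fromEdgeSet_adj, Set.mem_singleton_iff,
    Sym2.eq_iff] at hac hbd
  rcases hac with hac | ⟨hac, -⟩ <;> rcases hbd with hbd | ⟨hbd, -⟩
  · exact hf.2 a b c d h1 h2 h3 hac hbd
  · rcases hbd with ⟨rfl, rfl⟩ | ⟨rfl, rfl⟩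
    · have := hcon c a hac.symm (by omega) (by omega)
      omega
    · omega
  · rcases hac with ⟨rfl, rfl⟩ | ⟨rfl, rfl⟩
    · have := hcon b d hbd (by omega) (by omega)
      omega
    · omega
  · rcases hac with ⟨rfl, rfl⟩ | ⟨rfl, rfl⟩ <;> rcases hbd with ⟨rfl, rfl⟩ | ⟨rfl, rfl⟩ <;> omega

/-- Each edge spanning an interval is in a triangle inside the interval. -/
lemma exists_apex [Fintype V] {G : SimpleGraph V} (h : MaximalOuterplanar G) {f : V → ℕ}
    (hf : NonCrossAll G f) {u v w : V} (huv : G.Adj u v) (h1 : f u < f w) (h2 : f w < f v) :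
    ∃ k, f u < f k ∧ f k < f v ∧ G.Adj u k ∧ G.Adj k v := by
  classical
  have hex : ∃ m, f u < f m ∧ f m < f v ∧ G.Adj u m := by
    obtain ⟨m, hm, hmin⟩ := Finset.exists_min_image
      (Finset.univ.filter fun x => f u < f x ∧ f x < f v) f ⟨w, by simp [h1, h2]⟩
    simp only [Finset.mem_filter, Finset.mem_univ, true_and] at hm hmin
    refine ⟨m, hm.1, hm.2, ?_⟩
    by_contra hn
    obtain ⟨p, q, -, hp1, hp2, -⟩ := crossed_of_maximal h hf hm.1 hn
    have := hmin p (by omega)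
    omega
  obtain ⟨m, hm⟩ := hex
  obtain ⟨k, hk, hmax⟩ := Finset.exists_max_image
      (Finset.univ.filter fun x => f u < f x ∧ f x < f v ∧ G.Adj u x) f ⟨m, by simp [hm]⟩
  simp only [Finset.mem_filter, Finset.mem_univ, true_and] at hk hmax
  refine ⟨k, hk.1, hk.2.1, hk.2.2, ?_⟩
  by_contra hn
  obtain ⟨p, q, hpq, hp1, hp2, hq⟩ := crossed_of_maximal h hf hk.2.1 hn
  rcases hq with hq | hq
  · rcases lt_trichotomy (f q) (f u) with h' | h' | h'
    · exact hf.2 q u p v h' (by omega) hp2 hpq.symm huv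
    · have := hf.1 h'
      subst this
      have := hmax p ⟨by omega, hp2, hpq.symm⟩
      omega
    · exact hf.2 u q k p h' hq hp1 hk.2.2 hpq.symm
  · exact hf.2 u p v q (by omega) hp2 hq huv hpq

/-- Vertex `m` sees all three colors in its closed neighborhood. -/
def Sees (G : SimpleGraph V) (c : V → Fin 3) (m : V) : Prop :=
  ∀ γ : Fin 3, ∃ x, (x = m ∨ G.Adj m x) ∧ c x = γ

lemma third (α β : Fin 3) (h : α ≠ β) :
    ∃ γ, γ ≠ α ∧ γ ≠ β ∧ ∀ δ, δ = α ∨ δ = β ∨ δ = γ := by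
  revert α β; decide

lemma exists_coloring [Fintype V] {G : SimpleGraph V} (h : MaximalOuterplanar G) {f : V → ℕ}
    (hf : NonCrossAll G f) : ∀ n : ℕ, ∀ u v : V, ∀ α β : Fin 3, f v - f u ≤ n → f u < f v →
    G.Adj u v → α ≠ β → ∃ c : V → Fin 3, c u = α ∧ c v = β ∧
      ∀ m w, f u ≤ f m → f m ≤ f v → f u < f w → f w < f v →
        ∀ γ : Fin 3, ∃ x, (x = m ∨ G.Adj m x) ∧ c x = γ ∧ f u ≤ f x ∧ f x ≤ f v := by
  intro n
  induction n with
  | zero => intro u v α β h1 h2; omega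
  | succ n ih =>
    intro u v α β hn huv hadj hαβ
    by_cases hw : ∃ w, f u < f w ∧ f w < f v
    · obtain ⟨w, hw1, hw2⟩ := hw
      obtain ⟨k, hk1, hk2, huk, hkv⟩ := exists_apex h hf hadj hw1 hw2
      obtain ⟨γ, hγα, hγβ, hγ⟩ := third α β hαβ
      obtain ⟨c1, c1u, c1k, hc1⟩ := ih u k α γ (by omega) hk1 huk hγα.symm
      obtain ⟨c2, c2k, c2v, hc2⟩ := ih k v γ β (by omega) hk2 hkv hγβ
      have hcu : (if f u ≤ f k then c1 u else c2 u) = α := by rw [if_pos hk1.le, c1u]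
      have hck : (if f k ≤ f k then c1 k else c2 k) = γ := by rw [if_pos le_rfl, c1k]
      have hcv : (if f v ≤ f k then c1 v else c2 v) = β := by rw [if_neg (by omega), c2v]
      refine ⟨fun x => if f x ≤ f k then c1 x else c2 x, hcu, hcv, ?_⟩
      intro m w' hm1 hm2 _ _ δ
      by_cases hm : m = u ∨ m = k ∨ m = v
      · have : (u = m ∨ G.Adj m u) ∧ (k = m ∨ G.Adj m k) ∧ (v = m ∨ G.Adj m v) := by
          have := hadj.symm
          have := huk.symm
          have := hkv.symm
          rcases hm with rfl | rfl | rfl <;> simp_all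
        rcases hγ δ with rfl | rfl | rfl
        · exact ⟨u, this.1, hcu, le_rfl, huv.le⟩
        · exact ⟨v, this.2.2, hcv, huv.le, le_rfl⟩
        · exact ⟨k, this.2.1, hck, hk1.le, hk2.le⟩
      · push Not at hm
        have n1 : f m ≠ f u := fun e => hm.1 (hf.1 e)
        have n2 : f m ≠ f k := fun e => hm.2.1 (hf.1 e)
        have n3 : f m ≠ f v := fun e => hm.2.2 (hf.1 e)
        rcases lt_or_gt_of_ne n2 with hlt | hlt
        · obtain ⟨x, hx, hxc, hx1, hx2⟩ := hc1 m m hm1 hlt.le (by omega) (by omega) δ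
          exact ⟨x, hx, by simp only [if_pos hx2, hxc], hx1, by omega⟩
        · obtain ⟨x, hx, hxc, hx1, hx2⟩ := hc2 m m hlt.le hm2 (by omega) (by omega) δ
          refine ⟨x, hx, ?_, by omega, hx2⟩
          show (if f x ≤ f k then c1 x else c2 x) = δ
          split_ifs with hh
          · have : x = k := hf.1 (by omega)
            subst this
            rw [c1k, ← hxc, c2k]
          · exact hxc
    · classical
      refine ⟨fun x => if x = u then α else β, by simp, ?_, ?_⟩
      · have : v ≠ u := by rintro rfl; omega
        simp [this]
      · intro m w _ _ h1 h2
        exact absurd ⟨w, h1, h2⟩ hw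

lemma exists_sees [Fintype V] {G : SimpleGraph V} (h : MaximalOuterplanar G) {f : V → ℕ}
    (hf : NonCrossAll G f) (hn : 3 ≤ Fintype.card V) : ∃ c : V → Fin 3, ∀ m, Sees G c m := by
  classical
  have hne : (Finset.univ : Finset V).Nonempty := by
    rw [← Finset.card_pos, Finset.card_univ]; omega
  obtain ⟨u, -, hu⟩ := Finset.exists_min_image Finset.univ f hne
  obtain ⟨v, -, hv⟩ := Finset.exists_max_image Finset.univ f hne
  simp only [Finset.mem_univ, true_implies] at hu hv
  obtain ⟨w, hw⟩ : ∃ w, w ∉ ({u, v} : Finset V) := by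
    by_contra hcon
    push Not at hcon
    have h1 : (Finset.univ : Finset V) ⊆ {u, v} := fun x _ => hcon x
    have h2 := Finset.card_le_card h1
    have h3 : ({u, v} : Finset V).card ≤ 2 := Finset.card_le_two
    rw [Finset.card_univ] at h2
    omega
  simp only [Finset.mem_insert, Finset.mem_singleton, not_or] at hw
  have e1 : f w ≠ f u := fun e => hw.1 (hf.1 e)
  have e2 : f w ≠ f v := fun e => hw.2 (hf.1 e)
  have l1 := hu w
  have l2 := hv w
  have hadj : G.Adj u v := by
    by_contra hcon
    obtain ⟨p, q, -, -, -, hq⟩ := crossed_of_maximal h hf (by omega) hcon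
    have := hu q
    have := hv q
    omega
  obtain ⟨c, -, -, hc⟩ := exists_coloring h hf _ u v 0 1 le_rfl (by omega) hadj (by decide)
  refine ⟨c, fun m γ => ?_⟩
  obtain ⟨x, hx, hxc, -⟩ := hc m w (hu m) (hv m) (by omega) (by omega) γ
  exact ⟨x, hx, hxc⟩

/-- A coloring with every vertex seeing all three colors gives the bound. -/
lemma bound_of_sees [Fintype V] [DecidableEq V] (G : SimpleGraph V) [DecidableRel G.Adj]
    (c : V → Fin 3) (hc : ∀ m, Sees G c m) : doubleDomNum G ≤ 2 * Fintype.card V / 3 := by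
  have hdom : ∀ γ : Fin 3, doubleDomNum G ≤ (Finset.univ.filter fun x => c x ≠ γ).card := by
    intro γ
    refine Nat.sInf_le ⟨_, ?_, rfl⟩
    intro v
    obtain ⟨x, hx, hxc⟩ := hc v (γ + 1)
    obtain ⟨y, hy, hyc⟩ := hc v (γ + 2)
    have t1 : ∀ γ : Fin 3, γ + 1 ≠ γ + 2 ∧ γ + 1 ≠ γ ∧ γ + 2 ≠ γ := by decide
    have hxy : x ≠ y := by
      rintro rfl
      exact (t1 γ).1 (hxc.symm.trans hyc)
    rw [← Finset.card_pair hxy]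
    apply Finset.card_le_card
    intro z hz
    simp only [Finset.mem_insert, Finset.mem_singleton] at hz
    simp only [Finset.mem_inter, Finset.mem_filter, Finset.mem_univ, true_and, Finset.mem_insert,
      mem_neighborFinset]
    rcases hz with rfl | rfl
    · exact ⟨by rw [hxc]; exact (t1 γ).2.1, hx⟩
    · exact ⟨by rw [hyc]; exact (t1 γ).2.2, hy⟩
  have hs : ∀ γ : Fin 3, (Finset.univ.filter fun x => c x = γ).card +
      (Finset.univ.filter fun x => c x ≠ γ).card = Fintype.card V := by
    intro γ
    rw [Finset.card_filter_add_card_filter_not, Finset.card_univ]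
  have htot : Fintype.card V = ∑ γ : Fin 3, (Finset.univ.filter fun x => c x = γ).card := by
    rw [← Finset.card_univ]
    exact Finset.card_eq_sum_card_fiberwise (fun _ _ => Finset.mem_coe.2 (Finset.mem_univ _))
  rw [Fin.sum_univ_three] at htot
  have a0 := hdom 0
  have a1 := hdom 1
  have a2 := hdom 2
  have b0 := hs 0
  have b1 := hs 1
  have b2 := hs 2
  omega

lemma rotate {G : SimpleGraph V} {s : Finset V} {f : V → ℕ} (hf : NonCross G s f) (v : V) :
    ∃ g, NonCross G s g ∧ (v ∈ s → ∀ u ∈ s, g v ≤ g u) := by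
  obtain ⟨inj, nc⟩ := hf
  have hM : ∀ u ∈ s, f u < s.sup f + 1 := fun u hu => Nat.lt_succ_of_le (Finset.le_sup hu)
  set M := s.sup f + 1
  refine ⟨fun u => if f u < f v then f u + M else f u, ⟨?_, ?_⟩, ?_⟩
  · intro a ha b hb hab
    have h1 := hM a ha
    have h2 := hM b hb
    apply inj ha hb
    simp only at hab
    split_ifs at hab <;> omega
  · intro a ha b hb c hc d hd h1 h2 h3 hac hbd
    have l1 := hM a ha
    have l2 := hM b hb
    have l3 := hM c hc
    have l4 := hM d hd
    have k1 := fun x y z => nc a ha b hb c hc d hd x y z hac hbd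
    have k2 := fun x y z => nc b hb c hc d hd a ha x y z hbd hac.symm
    have k3 := fun x y z => nc c hc d hd a ha b hb x y z hac.symm hbd.symm
    have k4 := fun x y z => nc d hd a ha b hb c hc x y z hbd.symm hac
    simp only at h1 h2 h3
    grind
  · intro hv u hu
    have := hM v hv
    simp only [lt_irrefl, if_false]
    split_ifs <;> omega

lemma glue [DecidableEq V] {G : SimpleGraph V} {A B : Finset V} {v : V}
    (hv : ∀ x ∈ A, x ∈ B → x = v)
    (hAB : ∀ a ∈ A, a ∉ B → ∀ b ∈ B, b ∉ A → ¬ G.Adj a b) {f g : V → ℕ}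
    (hf : NonCross G A f) (hg : NonCross G B g) : ∃ h, NonCross G (A ∪ B) h := by
  obtain ⟨f, ⟨finj, fnc⟩, fv⟩ := rotate hf v
  obtain ⟨g, ⟨ginj, gnc⟩, gv⟩ := rotate hg v
  have hM : ∀ u ∈ A, f u < A.sup f + 1 := fun u hu => Nat.lt_succ_of_le (Finset.le_sup hu)
  set M := A.sup f + 1
  refine ⟨fun u => if u ∈ A then f u else g u + M, ?_, ?_⟩
  · intro a ha b hb hab
    simp only [Finset.coe_union, Set.mem_union, Finset.mem_coe] at ha hb
    simp only at hab
    split_ifs at hab with h1 h2 h2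
    · exact finj h1 h2 hab
    · have := hM a h1; omega
    · have := hM b h2; omega
    · exact ginj (ha.resolve_left h1) (hb.resolve_left h2) (by omega)
  · intro a ha b hb c hc d hd h1 h2 h3 hac hbd
    rw [Finset.mem_union] at ha hb hc hd
    simp only at h1 h2 h3
    have key : ∀ x y, (x ∈ A ∨ x ∈ B) → (y ∈ A ∨ y ∈ B) → G.Adj x y → x ∈ A → y ∉ A → x = v := by
      intro x y hx hy hxy hxA hyA
      by_contra hne
      exact hAB x hxA (fun hxB => hne (hv x hxA hxB)) y (hy.resolve_left hyA) hyA hxy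
    by_cases hdA : d ∈ A
    · have := hM d hdA
      rw [if_pos hdA] at h3
      have hcA : c ∈ A := by by_contra hh; rw [if_neg hh] at h3; omega
      rw [if_pos hcA] at h2 h3
      have := hM c hcA
      have hbA : b ∈ A := by by_contra hh; rw [if_neg hh] at h2; omega
      rw [if_pos hbA] at h1 h2
      have := hM b hbA
      have haA : a ∈ A := by by_contra hh; rw [if_neg hh] at h1; omega
      rw [if_pos haA] at h1
      exact fnc a haA b hbA c hcA d hdA h1 h2 h3 hac hbd
    · have hdB := hd.resolve_left hdA
      rw [if_neg hdA] at h3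
      by_cases hbA : b ∈ A
      · rw [if_pos hbA] at h1 h2
        have hbv := key b d hb hd hbd hbA hdA
        have := hM b hbA
        have haA : a ∈ A := by by_contra hh; rw [if_neg hh] at h1; omega
        rw [if_pos haA] at h1
        have := fv (hbv ▸ hbA) a haA
        rw [hbv] at h1
        omega
      · have hbB := hb.resolve_left hbA
        rw [if_neg hbA] at h1 h2
        have hcA : c ∉ A := by
          intro hh
          rw [if_pos hh] at h2
          have := hM c hh
          omega
        have hcB := hc.resolve_left hcA
        rw [if_neg hcA] at h2 h3
        by_cases haA : a ∈ A
        · have hav := key a c ha hc hac haA hcA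
          have haB : a ∈ B := by
            by_contra hh
            exact hAB a haA hh c hcB hcA hac
          have hle := gv (hav ▸ haB) b hbB
          have hne : g v ≠ g b := by
            intro e
            have := ginj (hav ▸ haB : v ∈ B) hbB e
            rw [← this, ← hav] at hbA
            exact hbA haA
          rw [← hav] at hle hne
          exact gnc a haB b hbB c hcB d hdB (by omega) (by omega) (by omega) hac hbd
        · rw [if_neg haA] at h1
          exact gnc a (ha.resolve_left haA) b hbB c hcB d hdB (by omega) (by omega) (by omega) hac hbd

/-- Disjoint sets with an edge between them. -/
def Touch (G : SimpleGraph V) (A B : Set V) : Prop :=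
  Disjoint A B ∧ ∃ a ∈ A, ∃ b ∈ B, G.Adj a b

lemma Touch.symm {G : SimpleGraph V} {A B : Set V} (h : Touch G A B) : Touch G B A := by
  obtain ⟨hd, a, ha, b, hb, hab⟩ := h
  exact ⟨hd.symm, b, hb, a, ha, hab.symm⟩

lemma conn_nonempty {G : SimpleGraph V} {A : Set V} (h : (G.induce A).Connected) : A.Nonempty := by
  obtain ⟨⟨x, hx⟩⟩ := h.nonempty
  exact ⟨x, hx⟩

lemma minor_K4 {G : SimpleGraph V} {A B C D : Set V}
    (hA : (G.induce A).Connected) (hB : (G.induce B).Connected) (hC : (G.induce C).Connected)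
    (hD : (G.induce D).Connected) (hAB : Touch G A B) (hAC : Touch G A C) (hAD : Touch G A D)
    (hBC : Touch G B C) (hBD : Touch G B D) (hCD : Touch G C D) :
    HasMinor G (⊤ : SimpleGraph (Fin 4)) := by
  have hc : ∀ w, (G.induce ((![A, B, C, D] : Fin 4 → Set V) w)).Connected := by
    intro w
    fin_cases w
    exacts [hA, hB, hC, hD]
  have ht : ∀ w₁ w₂ : Fin 4, w₁ ≠ w₂ → Touch G ((![A, B, C, D] : Fin 4 → Set V) w₁)
      ((![A, B, C, D] : Fin 4 → Set V) w₂) := by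
    have hlt : ∀ w₁ w₂ : Fin 4, w₁ < w₂ → Touch G ((![A, B, C, D] : Fin 4 → Set V) w₁)
        ((![A, B, C, D] : Fin 4 → Set V) w₂) := by
      intro w₁ w₂ h
      fin_cases w₁ <;> fin_cases w₂ <;> first | exact absurd h (by decide) | assumption
    intro w₁ w₂ h
    rcases lt_or_gt_of_ne h with h | h
    · exact hlt _ _ h
    · exact (hlt _ _ h).symm
  exact ⟨![A, B, C, D], fun w => conn_nonempty (hc w), hc, fun _ _ h => (ht _ _ h).1,
    fun w₁ w₂ h => (ht _ _ (by simpa using h)).2⟩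

lemma minor_K23 {G : SimpleGraph V} {X Y A B C : Set V}
    (hX : (G.induce X).Connected) (hY : (G.induce Y).Connected)
    (hA : (G.induce A).Connected) (hB : (G.induce B).Connected) (hC : (G.induce C).Connected)
    (hXY : Disjoint X Y) (hAB : Disjoint A B) (hAC : Disjoint A C) (hBC : Disjoint B C)
    (hXA : Touch G X A) (hXB : Touch G X B) (hXC : Touch G X C)
    (hYA : Touch G Y A) (hYB : Touch G Y B) (hYC : Touch G Y C) :
    HasMinor G (completeBipartiteGraph (Fin 2) (Fin 3)) := by
  have hc : ∀ w, (G.induce ((Sum.elim ![X, Y] ![A, B, C] : Fin 2 ⊕ Fin 3 → Set V) w)).Connected := by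
    intro w
    rcases w with w | w <;> fin_cases w
    exacts [hX, hY, hA, hB, hC]
  have ht : ∀ (i : Fin 2) (j : Fin 3), Touch G ((![X, Y] : Fin 2 → Set V) i)
      ((![A, B, C] : Fin 3 → Set V) j) := by
    intro i j
    fin_cases i <;> fin_cases j
    exacts [hXA, hXB, hXC, hYA, hYB, hYC]
  refine ⟨Sum.elim ![X, Y] ![A, B, C], fun w => conn_nonempty (hc w), hc, ?_, ?_⟩
  · rintro (i | i) (j | j) h
    · fin_cases i <;> fin_cases j <;> first | exact absurd rfl h | exact hXY | exact hXY.symm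
    · exact (ht i j).1
    · exact (ht j i).1.symm
    · fin_cases i <;> fin_cases j <;> first | exact absurd rfl h | assumption |
        exact Disjoint.symm (by assumption)
  · rintro (i | i) (j | j) h
    · simp at h
    · exact (ht i j).2
    · exact (ht j i).symm.2
    · simp at h

/-- A cycle of length `k` inside `s`, with a single edge allowed for `k = 2`. -/
structure IsCyc (G : SimpleGraph V) (s : Finset V) (k : ℕ) (c : ℕ → V) : Prop where
  two_le : 2 ≤ k
  mem : ∀ i < k, c i ∈ s
  inj : ∀ i < k, ∀ j < k, c i = c j → i = j
  adj : ∀ i, i + 1 < k → G.Adj (c i) (c (i + 1))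
  close : G.Adj (c (k - 1)) (c 0)

lemma IsCyc.conn {G : SimpleGraph V} {s : Finset V} {k : ℕ} {c : ℕ → V} (h : IsCyc G s k c)
    {i j : ℕ} (hij : i < j) (hj : j ≤ k) : (G.induce (c '' Set.Ico i j)).Connected := by
  induction j, hij using Nat.le_induction with
  | base =>
    have : c '' Set.Ico i (i + 1) = {c i} := by
      rw [show Set.Ico i (i + 1) = {i} by ext x; simp only [Set.mem_Ico, Set.mem_singleton_iff]; omega,
        Set.image_singleton]
    rw [Nat.succ_eq_add_one, this]
    exact conn_singleton G _
  | succ j hij ih =>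
    have hij' : i < j := hij
    have : c '' Set.Ico i (j + 1) = c '' Set.Ico i j ∪ {c j} := by
      rw [Set.image_eq_iUnion, Set.image_eq_iUnion]
      ext x
      simp only [Set.mem_iUnion, Set.mem_Ico, Set.mem_singleton_iff, Set.mem_union, exists_prop]
      constructor
      · rintro ⟨t, ht, rfl⟩
        rcases Nat.lt_or_ge t j with h' | h'
        · exact Or.inl ⟨t, by omega, rfl⟩
        · exact Or.inr (by rw [show t = j by omega])
      · rintro (⟨t, ht, rfl⟩ | rfl)
        · exact ⟨t, by omega, rfl⟩
        · exact ⟨j, by omega, rfl⟩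
    rw [this]
    have hadj := h.adj (j - 1) (by omega)
    rw [show j - 1 + 1 = j by omega] at hadj
    exact conn_union (ih (by omega)) (conn_singleton G _) ⟨j - 1, by simp; omega, rfl⟩ rfl hadj

lemma IsCyc.disj {G : SimpleGraph V} {s : Finset V} {k : ℕ} {c : ℕ → V} (h : IsCyc G s k c)
    {i j l m : ℕ} (hjl : j ≤ l) (_ : j ≤ k) (hm : m ≤ k) :
    Disjoint (c '' Set.Ico i j) (c '' Set.Ico l m) := by
  rw [Set.disjoint_left]
  rintro _ ⟨a, ha, rfl⟩ ⟨b, hb, hab⟩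
  simp only [Set.mem_Ico] at ha hb
  have := h.inj b (by omega) a (by omega) hab
  omega

lemma IsCyc.no_cross {G : SimpleGraph V} {s : Finset V} {k : ℕ} {c : ℕ → V} (h : IsCyc G s k c)
    (hG : Outerplanar G) {i j l m : ℕ} (hij : i < j) (hjl : j < l) (hlm : l < m) (hm : m < k)
    (h1 : G.Adj (c i) (c l)) (h2 : G.Adj (c j) (c m)) : False := by
  have mem : ∀ a b t, a ≤ t → t < b → c t ∈ c '' Set.Ico a b :=
    fun a b t h1 h2 => ⟨t, ⟨h1, h2⟩, rfl⟩
  have nxt : ∀ t, 0 < t → t < k → G.Adj (c (t - 1)) (c t) := by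
    intro t h0 ht
    have := h.adj (t - 1) (by omega)
    rwa [show t - 1 + 1 = t by omega] at this
  refine hG.1 (minor_K4 (h.conn (i := 0) (j := j) (by omega) (by omega))
    (h.conn hjl (by omega)) (h.conn hlm (by omega)) (h.conn hm le_rfl) ?_ ?_ ?_ ?_ ?_ ?_)
  · exact ⟨h.disj le_rfl (by omega) (by omega), _, mem _ _ (j - 1) (by omega) (by omega), _,
      mem _ _ j (by omega) (by omega), nxt j (by omega) (by omega)⟩
  · exact ⟨h.disj (by omega) (by omega) (by omega), _, mem _ _ i (by omega) (by omega), _,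
      mem _ _ l (by omega) (by omega), h1⟩
  · exact ⟨h.disj (by omega) (by omega) (by omega), _, mem _ _ 0 (by omega) (by omega), _,
      mem _ _ (k - 1) (by omega) (by omega), h.close.symm⟩
  · exact ⟨h.disj le_rfl (by omega) (by omega), _, mem _ _ (l - 1) (by omega) (by omega), _,
      mem _ _ l (by omega) (by omega), nxt l (by omega) (by omega)⟩
  · exact ⟨h.disj (by omega) (by omega) (by omega), _, mem _ _ j (by omega) (by omega), _,
      mem _ _ m (by omega) (by omega), h2⟩
  · exact ⟨h.disj le_rfl (by omega) (by omega), _, mem _ _ (m - 1) (by omega) (by omega), _,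
      mem _ _ m (by omega) (by omega), nxt m (by omega) (by omega)⟩

/-- A Hamiltonian cycle gives a noncrossing order. -/
lemma IsCyc.nonCross {G : SimpleGraph V} {s : Finset V} {k : ℕ} {c : ℕ → V} (h : IsCyc G s k c)
    (hG : Outerplanar G) (hs : ∀ v ∈ s, ∃ i < k, c i = v) : ∃ f, NonCross G s f := by
  classical
  choose! f hf hcf using hs
  refine ⟨f, ?_, ?_⟩
  · intro a ha b hb hab
    rw [← hcf a ha, ← hcf b hb, hab]
  · intro a ha b hb x hx d hd h1 h2 h3 hac hbd
    refine h.no_cross hG h1 h2 h3 (hf d hd) ?_ ?_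
    · rwa [hcf a ha, hcf x hx]
    · rwa [hcf b hb, hcf d hd]

lemma IsCyc.rotate {G : SimpleGraph V} {s : Finset V} {k : ℕ} {c : ℕ → V} (h : IsCyc G s k c)
    {i : ℕ} (hi : i < k) :
    IsCyc G s k (fun t => if t + i < k then c (t + i) else c (t + i - k)) := by
  have h2 := h.two_le
  refine ⟨h2, ?_, ?_, ?_, ?_⟩
  · intro t ht
    try simp only
    split_ifs
    · exact h.mem _ (by omega)
    · exact h.mem _ (by omega)
  · intro t ht t' ht' e
    try simp only at e
    split_ifs at e <;> have := h.inj _ (by omega) _ (by omega) e <;> omega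
  · intro t ht
    try simp only
    rcases Nat.lt_or_ge (t + 1 + i) k with h' | h'
    · rw [if_pos (by omega), if_pos h', show t + 1 + i = t + i + 1 by omega]
      exact h.adj _ (by omega)
    · rw [if_neg (by omega : ¬ t + 1 + i < k)]
      split_ifs with h''
      · rw [show t + i = k - 1 by omega, show t + 1 + i - k = 0 by omega]
        exact h.close
      · rw [show t + 1 + i - k = t + i - k + 1 by omega]
        exact h.adj _ (by omega)
  · try simp only
    rw [if_pos (by omega : 0 + i < k)]
    by_cases h0 : i = 0
    · subst h0
      rw [if_pos (by omega)]
      exact h.close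
    · rw [if_neg (by omega), show k - 1 + i - k = i - 1 by omega]
      have := h.adj (i - 1) (by omega)
      rwa [show i - 1 + 1 = 0 + i by omega] at this

/-- A connected set outside the cycle which is attached to both ends gives a longer cycle. -/
lemma IsCyc.extend {G : SimpleGraph V} {s : Finset V} {k : ℕ} {c : ℕ → V} (h : IsCyc G s k c)
    {D : Set V} (hD : (G.induce D).Connected) (hDs : ∀ d ∈ D, d ∈ s)
    (hDc : ∀ d ∈ D, ∀ i < k, c i ≠ d) {p q : V} (hp : p ∈ D) (hq : q ∈ D)
    (h1 : G.Adj (c (k - 1)) p) (h2 : G.Adj (c 0) q) : ∃ k' c', k < k' ∧ IsCyc G s k' c' := by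
  obtain ⟨w, hw⟩ := hD.preconnected.exists_isPath ⟨p, hp⟩ ⟨q, hq⟩
  have h2k := h.two_le
  refine ⟨k + (w.length + 1), fun t => if t < k then c t else (w.getVert (t - k)).1, by omega,
    by omega, ?_, ?_, ?_, ?_⟩
  · intro t ht
    try simp only
    split_ifs with h'
    · exact h.mem t h'
    · exact hDs _ (w.getVert (t - k)).2
  · intro t ht t' ht' e
    try simp only at e
    split_ifs at e with a b b
    · exact h.inj _ a _ b e
    · exact absurd e (hDc _ (w.getVert (t' - k)).2 t a)
    · exact absurd e.symm (hDc _ (w.getVert (t - k)).2 t' b)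
    · have := hw.getVert_injOn (by simp; omega) (by simp; omega) (Subtype.ext e)
      omega
  · intro t ht
    try simp only
    rcases Nat.lt_or_ge (t + 1) k with h' | h'
    · rw [if_pos (by omega), if_pos h']
      exact h.adj t h'
    · rw [if_neg (by omega : ¬ t + 1 < k)]
      split_ifs with h''
      · rw [show t = k - 1 by omega, show k - 1 + 1 - k = 0 by omega, w.getVert_zero]
        exact h1
      · have := w.adj_getVert_succ (i := t - k) (by omega)
        rw [show t + 1 - k = t - k + 1 by omega]
        exact this
  · try simp only
    rw [if_neg (by omega), if_pos (by omega), show k + (w.length + 1) - 1 - k = w.length by omega,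
      w.getVert_length]
    exact h2.symm

/-- A longest cycle has no outer connected set attached twice. -/
lemma IsCyc.attach {G : SimpleGraph V} {s : Finset V} {k : ℕ} {c : ℕ → V} (h : IsCyc G s k c)
    (hG : Outerplanar G) (hmax : ∀ k' c', IsCyc G s k' c' → k' ≤ k)
    {D : Set V} (hD : (G.induce D).Connected) (hDs : ∀ d ∈ D, d ∈ s)
    (hDc : ∀ d ∈ D, ∀ i < k, c i ≠ d) {p q : V} (hp : p ∈ D) (hq : q ∈ D) {j : ℕ} (hj0 : 0 < j)
    (hj : j < k) (h1 : G.Adj (c 0) p) (h2 : G.Adj (c j) q) : False := by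
  by_cases hjk : j = k - 1
  · subst hjk
    obtain ⟨k', c', hk, hc'⟩ := h.extend hD hDs hDc hq hp h2 h1
    have := hmax _ _ hc'
    omega
  by_cases hj1 : j = 1
  · subst hj1
    have hr := h.rotate hj
    obtain ⟨k', c', hk, hc'⟩ := hr.extend hD hDs (by
      intro d hd i hi
      try simp only
      split_ifs
      · exact hDc d hd _ (by omega)
      · exact hDc d hd _ (by omega)) hp hq
      (by
        try simp only
        rw [if_neg (by omega), show k - 1 + 1 - k = 0 by omega]
        exact h1)
      (by
        try simp only
        rw [if_pos (by omega)]
        exact h2)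
    have := hmax _ _ hc'
    omega
  have mem : ∀ a b t, a ≤ t → t < b → c t ∈ c '' Set.Ico a b :=
    fun a b t h1 h2 => ⟨t, ⟨h1, h2⟩, rfl⟩
  have dD : ∀ a b, b ≤ k → Disjoint (c '' Set.Ico a b) D := by
    intro a b hb
    rw [Set.disjoint_left]
    rintro _ ⟨t, ht, rfl⟩ htD
    exact hDc _ htD t (by have := ht.2; omega) rfl
  have a1 := h.adj 0 (by omega)
  have a2 := h.adj (j - 1) (by omega)
  rw [show j - 1 + 1 = j by omega] at a2
  have a3 := h.adj j (by omega)
  refine hG.2 (minor_K23 (X := c '' Set.Ico 0 1) (Y := c '' Set.Ico j (j + 1))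
    (A := c '' Set.Ico 1 j) (B := c '' Set.Ico (j + 1) k) (C := D)
    (h.conn (by omega) (by omega)) (h.conn (by omega) (by omega)) (h.conn (by omega) (by omega))
    (h.conn (by omega) (by omega)) hD (h.disj (by omega) (by omega) (by omega))
    (h.disj (by omega) (by omega) (by omega)) (dD _ _ (by omega)) (dD _ _ (by omega))
    ?_ ?_ ?_ ?_ ?_ ?_)
  · exact ⟨h.disj (by omega) (by omega) (by omega), _, mem _ _ 0 (by omega) (by omega), _,
      mem _ _ 1 (by omega) (by omega), a1⟩
  · exact ⟨h.disj (by omega) (by omega) (by omega), _, mem _ _ 0 (by omega) (by omega), _,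
      mem _ _ (k - 1) (by omega) (by omega), h.close.symm⟩
  · exact ⟨dD _ _ (by omega), _, mem _ _ 0 (by omega) (by omega), p, hp, h1⟩
  · exact ⟨(h.disj (by omega) (by omega) (by omega)).symm, _, mem _ _ j (by omega) (by omega), _,
      mem _ _ (j - 1) (by omega) (by omega), a2.symm⟩
  · exact ⟨h.disj (by omega) (by omega) (by omega), _, mem _ _ j (by omega) (by omega), _,
      mem _ _ (j + 1) (by omega) (by omega), a3⟩
  · exact ⟨dD _ _ (by omega), _, mem _ _ j (by omega) (by omega), q, hq, h2⟩

/-- The same with arbitrary attachment positions. -/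
lemma IsCyc.attach' {G : SimpleGraph V} {s : Finset V} {k : ℕ} {c : ℕ → V} (h : IsCyc G s k c)
    (hG : Outerplanar G) (hmax : ∀ k' c', IsCyc G s k' c' → k' ≤ k)
    {D : Set V} (hD : (G.induce D).Connected) (hDs : ∀ d ∈ D, d ∈ s)
    (hDc : ∀ d ∈ D, ∀ i < k, c i ≠ d) {p q : V} (hp : p ∈ D) (hq : q ∈ D) {i j : ℕ} (hij : i < j)
    (hj : j < k) (h1 : G.Adj (c i) p) (h2 : G.Adj (c j) q) : False := by
  have hr := h.rotate (i := i) (by omega)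
  refine hr.attach hG hmax hD hDs ?_ hp hq (j := j - i) (by omega) (by omega) ?_ ?_
  · intro d hd i hi
    try simp only
    split_ifs
    · exact hDc d hd _ (by omega)
    · exact hDc d hd _ (by omega)
  · try simp only
    rw [if_pos (by omega), show 0 + i = i by omega]
    exact h1
  · try simp only
    rw [if_pos (by omega), show j - i + i = j by omega]
    exact h2

/-- Every set without separation of order at most one is ordered by a Hamiltonian cycle. -/
lemma exists_order_of_two_conn [DecidableEq V] {G : SimpleGraph V} (hG : Outerplanar G)
    (s : Finset V) (hs2 : 2 ≤ s.card)
    (hs : ∀ (A B : Finset V) (v : V), A ∪ B = s → (∀ x ∈ A, x ∈ B → x = v) →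
      (∀ a ∈ A, a ∉ B → ∀ b ∈ B, b ∉ A → ¬ G.Adj a b) → A = s ∨ B = s) :
    ∃ f, NonCross G s f := by
  -- an edge
  have hedge : ∃ k c, IsCyc G s k c := by
    obtain ⟨v, hv, w, hw, hvw⟩ := Finset.one_lt_card.1 hs2
    have : ∃ u ∈ s, G.Adj v u := by
      by_contra hcon
      push Not at hcon
      rcases hs {v} (s.erase v) v (by ext x; simp; grind) (by simp) (by
        intro a ha _ b hb _
        rw [Finset.mem_singleton] at ha
        subst ha
        exact hcon b (Finset.mem_of_mem_erase hb)) with h | h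
      · rw [← h, Finset.mem_singleton] at hw
        exact hvw hw.symm
      · exact Finset.notMem_erase v s (h.symm ▸ hv)
    obtain ⟨u, hu, hvu⟩ := this
    refine ⟨2, fun t => if t = 0 then v else u, le_rfl, ?_, ?_, ?_, ?_⟩
    · intro i _
      try simp only
      split_ifs
      exacts [hv, hu]
    · intro i hi j hj e
      try simp only at e
      split_ifs at e
      · omega
      · exact absurd e hvu.ne
      · exact absurd e.symm hvu.ne
      · omega
    · intro i hi
      obtain rfl : i = 0 := by omega
      simpa using hvu
    · simpa using hvu.symm
  have hbd : ∀ k c, IsCyc G s k c → k ≤ s.card := by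
    intro k c h
    have := Finset.card_le_card_of_injOn (s := Finset.range k) (t := s) c
      (fun i hi => h.mem i (by simpa using hi))
      (fun i hi j hj e => h.inj i (by simpa using hi) j (by simpa using hj) e)
    simpa using this
  obtain ⟨k, ⟨c, hc⟩, hmax⟩ : ∃ k, (∃ c, IsCyc G s k c) ∧ ∀ k', (∃ c, IsCyc G s k' c) → k' ≤ k := by
    classical
    obtain ⟨k, c, hkc⟩ := hedge
    refine ⟨Nat.findGreatest (fun k => ∃ c, IsCyc G s k c) s.card, ?_, ?_⟩
    · exact Nat.findGreatest_spec (P := fun k => ∃ c, IsCyc G s k c) (hbd k c hkc) ⟨c, hkc⟩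
    · rintro k' ⟨c', h'⟩
      exact Nat.le_findGreatest (hbd k' c' h') ⟨c', h'⟩
  by_cases hham : ∀ v ∈ s, ∃ i < k, c i = v
  · exact hc.nonCross hG hham
  exfalso
  push Not at hham
  obtain ⟨d, hds, hdc⟩ := hham
  classical
  -- a maximal connected subset outside of the cycle
  obtain ⟨D, hD, hDmax⟩ := Finset.exists_max_image
    (s.powerset.filter fun D : Finset V => (∀ x ∈ D, ∀ i < k, c i ≠ x) ∧ (G.induce (D : Set V)).Connected)
    Finset.card ⟨{d}, by
      simp only [Finset.mem_filter, Finset.mem_powerset, Finset.singleton_subset_iff,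
        Finset.mem_singleton, forall_eq]
      refine ⟨hds, hdc, ?_⟩
      rw [Finset.coe_singleton]
      exact conn_singleton G d⟩
  simp only [Finset.mem_filter, Finset.mem_powerset] at hD hDmax
  obtain ⟨hDs, hDc, hDconn⟩ := hD
  have hclosed : ∀ x ∈ D, ∀ y ∈ s, y ∉ D → G.Adj x y → ∃ i < k, c i = y := by
    intro x hx y hy hyD hxy
    by_contra hcon
    push Not at hcon
    have := hDmax (insert y D) ⟨Finset.insert_subset hy hDs, by
      intro z hz
      rcases Finset.mem_insert.1 hz with rfl | hz
      · exact hcon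
      · exact hDc z hz, by
      have := conn_union hDconn (conn_singleton G y) (Finset.mem_coe.2 hx) rfl hxy
      rwa [show (D : Set V) ∪ {y} = ((insert y D : Finset V) : Set V) by
        simp [Set.union_singleton]] at this⟩
    rw [Finset.card_insert_of_notMem hyD] at this
    omega
  have hatt : ∀ x ∈ D, ∀ y ∈ D, ∀ i < k, ∀ j < k, G.Adj x (c i) → G.Adj y (c j) → i = j := by
    have : ∀ x ∈ D, ∀ y ∈ D, ∀ i < k, ∀ j < k, G.Adj x (c i) → G.Adj y (c j) → ¬ i < j := by
      intro x hx y hy i hi j hj h1 h2 hij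
      exact hc.attach' hG (fun k' c' h' => hmax k' ⟨c', h'⟩) hDconn
        (fun d hd => hDs hd) (fun d hd => hDc d hd) (Finset.mem_coe.2 hx) (Finset.mem_coe.2 hy)
        hij hj h1.symm h2.symm
    intro x hx y hy i hi j hj h1 h2
    have e1 := this x hx y hy i hi j hj h1 h2
    have e2 := this y hy x hx j hj i hi h2 h1
    omega
  -- the unique attachment vertex
  obtain ⟨i, hi, hatt'⟩ : ∃ i < k, ∀ x ∈ D, ∀ j < k, G.Adj x (c j) → j = i := by
    by_cases hex : ∃ x ∈ D, ∃ i < k, G.Adj x (c i)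
    · obtain ⟨x, hx, i, hi, hxi⟩ := hex
      exact ⟨i, hi, fun y hy j hj hyj => hatt y hy x hx j hj i hi hyj hxi⟩
    · push Not at hex
      exact ⟨0, by have := hc.two_le; omega, fun x hx j hj h => absurd h (hex x hx j hj)⟩
  obtain ⟨z, hz⟩ := conn_nonempty hDconn
  rw [Finset.mem_coe] at hz
  have h2 := hc.two_le
  rcases hs (insert (c i) D) (s \ D) (c i) (by
      ext x
      have := hc.mem i hi
      simp only [Finset.mem_union, Finset.mem_insert, Finset.mem_sdiff]
      constructor
      · rintro ((rfl | h) | h)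
        exacts [this, hDs h, h.1]
      · intro h
        by_cases hx : x ∈ D
        · exact Or.inl (Or.inr hx)
        · exact Or.inr ⟨h, hx⟩) (by
      intro x hx hx'
      rcases Finset.mem_insert.1 hx with h | h
      · exact h
      · exact absurd h (Finset.mem_sdiff.1 hx').2) (by
      intro a ha ha' b hb hb' hab
      have haD : a ∈ D := by
        rcases Finset.mem_insert.1 ha with rfl | h
        · by_contra hh
          exact ha' (Finset.mem_sdiff.2 ⟨hc.mem i hi, hh⟩)
        · exact h
      obtain ⟨j, hj, rfl⟩ := hclosed a haD b (Finset.mem_sdiff.1 hb).1 (Finset.mem_sdiff.1 hb).2 hab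
      have := hatt' a haD j hj hab
      subst this
      exact hb' (Finset.mem_insert_self _ _)) with h | h
  · -- another cycle vertex is missing
    obtain ⟨j, hj, hji⟩ : ∃ j < k, j ≠ i := by
      by_cases h0 : i = 0
      · exact ⟨1, by omega, by omega⟩
      · exact ⟨0, by omega, by omega⟩
    have hm := hc.mem j hj
    rw [← h] at hm
    rcases Finset.mem_insert.1 hm with e | e
    · exact hji (hc.inj j hj i hi e)
    · exact hDc _ e j hj rfl
  · have := hDs hz
    rw [← h] at this
    exact (Finset.mem_sdiff.1 this).2 hz

lemma exists_order [DecidableEq V] {G : SimpleGraph V} (hG : Outerplanar G) (s : Finset V) :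
    ∃ f, NonCross G s f := by
  induction s using Finset.strongInduction with
  | H s ih =>
    by_cases hcard : s.card ≤ 1
    · have hsub := Finset.card_le_one.1 hcard
      refine ⟨fun _ => 0, fun a ha b hb _ => hsub a ha b hb, ?_⟩
      intro a _ b _ _ _ _ _ h
      exact absurd h (lt_irrefl _)
    by_cases hs : ∀ (A B : Finset V) (v : V), A ∪ B = s → (∀ x ∈ A, x ∈ B → x = v) →
      (∀ a ∈ A, a ∉ B → ∀ b ∈ B, b ∉ A → ¬ G.Adj a b) → A = s ∨ B = s
    · exact exists_order_of_two_conn hG s (by omega) hs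
    · push Not at hs
      obtain ⟨A, B, v, hAB, hv, hadj, hA, hB⟩ := hs
      obtain ⟨f, hf⟩ := ih A (Finset.ssubset_iff_subset_ne.2
        ⟨hAB ▸ Finset.subset_union_left, hA⟩)
      obtain ⟨g, hg⟩ := ih B (Finset.ssubset_iff_subset_ne.2
        ⟨hAB ▸ Finset.subset_union_right, hB⟩)
      rw [← hAB]
      exact glue hv hadj hf hg

end DD

/-- Every maximal outerplanar graph on `n ≥ 3` vertices has
double domination number at most `⌊2n/3⌋`. -/
theorem doubleDomNum_le_of_maximalOuterplanar {V : Type*} [Fintype V] [DecidableEq V]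
    (G : SimpleGraph V) [DecidableRel G.Adj] (h : MaximalOuterplanar G)
    (hn : 3 ≤ Fintype.card V) :
    doubleDomNum G ≤ 2 * Fintype.card V / 3 := by
  obtain ⟨f, hf⟩ := DD.exists_order h.1 Finset.univ
  have hall : DD.NonCrossAll G f :=
    ⟨fun a b hab => hf.1 (by simp) (by simp) hab, fun a b c d =>
      hf.2 a (Finset.mem_univ _) b (Finset.mem_univ _) c (Finset.mem_univ _) d (Finset.mem_univ _)⟩
  obtain ⟨c, hc⟩ := DD.exists_sees h hall hn
  exact DD.bound_of_sees G c hc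
end

section
/- If G is a maximal outerplanar graph on n ≥ 4 vertices with exactly k internal triangles, then G has exactly k + 2 vertices of degree 2. -/
open SimpleGraph

/-- A set is connected, phrased via invariant predicates. -/
def CC {V : Type*} (G : SimpleGraph V) (S : Set V) : Prop :=
  S.Nonempty ∧ ∀ P : V → Prop, (∀ a ∈ S, ∀ b ∈ S, G.Adj a b → P a → P b) →
    ∀ a ∈ S, ∀ b ∈ S, P a → P b

lemma cc_iff {V : Type*} (G : SimpleGraph V) (S : Set V) :
    (G.induce S).Connected ↔ CC G S := by
  constructor
  · intro h
    refine ⟨Set.nonempty_coe_sort.1 h.nonempty, ?_⟩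
    intro P hP a ha b hb hPa
    obtain ⟨p⟩ := h.preconnected ⟨a, ha⟩ ⟨b, hb⟩
    have key : ∀ (u w : S) (p : (G.induce S).Walk u w), P u → P w := by
      intro u w p
      induction p with
      | nil => exact id
      | cons hadj _ ih => exact fun hu => ih (hP _ (Subtype.prop _) _ (Subtype.prop _) hadj hu)
    exact key _ _ p hPa
  · rintro ⟨hne, h⟩
    have : Nonempty S := hne.to_subtype
    refine SimpleGraph.Connected.mk ?_
    rintro ⟨a, ha⟩ ⟨b, hb⟩
    obtain ⟨_, hr⟩ := h (fun w => ∃ hw : w ∈ S, (G.induce S).Reachable ⟨a, ha⟩ ⟨w, hw⟩)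
      (by
        rintro c hc d hd hcd ⟨_, hr⟩
        refine ⟨hd, hr.trans ?_⟩
        exact SimpleGraph.Adj.reachable (by simpa using hcd)) a ha b hb ⟨ha, SimpleGraph.Reachable.refl _⟩
    exact hr

lemma hasMinor_iff {V W : Type*} (G : SimpleGraph V) (H : SimpleGraph W) :
    HasMinor G H ↔ ∃ f : W → Set V, (∀ w, CC G (f w)) ∧
      (∀ w₁ w₂ v, v ∈ f w₁ → v ∈ f w₂ → w₁ = w₂) ∧
      ∀ w₁ w₂, H.Adj w₁ w₂ → ∃ a ∈ f w₁, ∃ b ∈ f w₂, G.Adj a b := by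
  constructor
  · rintro ⟨f, _, h2, h3, h4⟩
    refine ⟨f, fun w => (cc_iff _ _).1 (h2 w), ?_, fun _ _ h => h4 h⟩
    intro w₁ w₂ v hv1 hv2
    by_contra hne
    exact Set.disjoint_left.1 (h3 hne) hv1 hv2
  · rintro ⟨f, h2, h3, h4⟩
    refine ⟨f, fun w => (h2 w).1, fun w => (cc_iff _ _).2 (h2 w), ?_, fun _ _ h => h4 _ _ h⟩
    intro w₁ w₂ hne
    exact Set.disjoint_left.2 fun v hv1 hv2 => hne (h3 _ _ v hv1 hv2)

lemma cc_singleton {V : Type*} (G : SimpleGraph V) (v : V) : CC G {v} := by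
  refine ⟨⟨v, rfl⟩, ?_⟩
  rintro P - a rfl b rfl h
  exact h

lemma cc_pair {V : Type*} (G : SimpleGraph V) {u v : V} (h : G.Adj u v) : CC G {u, v} := by
  refine ⟨⟨v, by simp⟩, ?_⟩
  intro P hP
  have h1 := hP u (by simp) v (by simp) h
  have h2 := hP v (by simp) u (by simp) h.symm
  rintro a (rfl | rfl) b (rfl | rfl) hh <;> tauto

lemma cc_union {V : Type*} (G : SimpleGraph V) {S T : Set V} (hS : CC G S) (hT : CC G T)
    {s t : V} (hs : s ∈ S) (ht : t ∈ T) (h : G.Adj s t) : CC G (S ∪ T) := by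
  refine ⟨⟨s, Or.inl hs⟩, ?_⟩
  intro P hP
  have kS := hS.2 P (fun a ha b hb => hP a (Or.inl ha) b (Or.inl hb))
  have kT := hT.2 P (fun a ha b hb => hP a (Or.inr ha) b (Or.inr hb))
  have h1 := hP s (Or.inl hs) t (Or.inr ht) h
  have h2 := hP t (Or.inr ht) s (Or.inl hs) h.symm
  rintro a (ha | ha) b (hb | hb) hh
  · exact kS a ha b hb hh
  · exact kT t ht b hb (h1 (kS a ha s hs hh))
  · exact kS s hs b hb (h2 (kT a ha t ht hh))
  · exact kT a ha b hb hh

lemma hasMinor_trans {U V W : Type*} {G : SimpleGraph V} {G' : SimpleGraph U} {H : SimpleGraph W}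
    (h1 : HasMinor G G') (h2 : HasMinor G' H) : HasMinor G H := by
  rw [hasMinor_iff] at *
  obtain ⟨g, g1, g2, g3⟩ := h1
  obtain ⟨f, f1, f2, f3⟩ := h2
  refine ⟨fun w => {v | ∃ u ∈ f w, v ∈ g u}, ?_, ?_, ?_⟩
  · intro w
    obtain ⟨u, hu⟩ := (f1 w).1
    obtain ⟨v, hv⟩ := (g1 u).1
    refine ⟨⟨v, u, hu, hv⟩, ?_⟩
    rintro P hP a ⟨s, hs, has⟩ b ⟨t, ht, hbt⟩ hPa
    have key : ∀ u ∈ f w, ∀ c ∈ g u, ∀ d ∈ g u, P c → P d := fun u hu =>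
      (g1 u).2 P (fun c hc d hd => hP c ⟨u, hu, hc⟩ d ⟨u, hu, hd⟩)
    refine (f1 w).2 (fun u => ∀ c ∈ g u, P c) ?_ s hs t ht (fun c hc => key s hs a has c hc hPa) b hbt
    intro p hp q hq hpq hall c hc
    obtain ⟨x, hx, y, hy, hxy⟩ := g3 p q hpq
    exact key q hq y hy c hc (hP x ⟨p, hp, hx⟩ y ⟨q, hq, hy⟩ hxy (hall x hx))
  · rintro w₁ w₂ v ⟨u, hu, hv⟩ ⟨u', hu', hv'⟩
    obtain rfl := g2 _ _ _ hv hv'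
    exact f2 _ _ _ hu hu'
  · intro w₁ w₂ hw
    obtain ⟨a, ha, b, hb, hab⟩ := f3 _ _ hw
    obtain ⟨x, hx, y, hy, hxy⟩ := g3 _ _ hab
    exact ⟨x, ⟨a, ha, hx⟩, y, ⟨b, hb, hy⟩, hxy⟩

lemma outerplanar_of_minor {U V : Type*} {G : SimpleGraph V} {G' : SimpleGraph U}
    (h : HasMinor G G') (ho : Outerplanar G) : Outerplanar G' :=
  ⟨fun h' => ho.1 (hasMinor_trans h h'), fun h' => ho.2 (hasMinor_trans h h')⟩

lemma hasMinor_comap {U V : Type*} (G : SimpleGraph V) (i : U → V) (hi : Function.Injective i) :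
    HasMinor G (G.comap i) := by
  rw [hasMinor_iff]
  refine ⟨fun u => {i u}, fun u => cc_singleton _ _, ?_, ?_⟩
  · rintro a b v rfl h
    exact hi h
  · intro a b h
    exact ⟨i a, rfl, i b, rfl, h⟩

lemma mk_K4 {V : Type*} (G : SimpleGraph V) (A B C D : Set V)
    (hA : CC G A) (hB : CC G B) (hC : CC G C) (hD : CC G D)
    (hAB : Disjoint A B) (hAC : Disjoint A C) (hAD : Disjoint A D)
    (hBC : Disjoint B C) (hBD : Disjoint B D) (hCD : Disjoint C D)
    (eAB : ∃ a ∈ A, ∃ b ∈ B, G.Adj a b) (eAC : ∃ a ∈ A, ∃ b ∈ C, G.Adj a b)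
    (eAD : ∃ a ∈ A, ∃ b ∈ D, G.Adj a b) (eBC : ∃ a ∈ B, ∃ b ∈ C, G.Adj a b)
    (eBD : ∃ a ∈ B, ∃ b ∈ D, G.Adj a b) (eCD : ∃ a ∈ C, ∃ b ∈ D, G.Adj a b) :
    HasMinor G (⊤ : SimpleGraph (Fin 4)) := by
  have sy : ∀ {S T : Set V}, (∃ a ∈ S, ∃ b ∈ T, G.Adj a b) → ∃ a ∈ T, ∃ b ∈ S, G.Adj a b := by
    rintro S T ⟨a, ha, b, hb, h⟩
    exact ⟨b, hb, a, ha, h.symm⟩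
  refine ⟨![A, B, C, D], ?_, ?_, ?_, ?_⟩
  · intro w; fin_cases w
    exacts [hA.1, hB.1, hC.1, hD.1]
  · intro w; rw [cc_iff]; fin_cases w
    exacts [hA, hB, hC, hD]
  · intro i j hij
    fin_cases i <;> fin_cases j <;> first | exact absurd rfl hij | assumption | (apply Disjoint.symm; assumption)
  · intro i j hij
    fin_cases i <;> fin_cases j <;>
      first | exact absurd rfl hij.ne | assumption | (apply sy; assumption)

lemma mk_K23 {V : Type*} (G : SimpleGraph V) (x y : V) (A B C : Set V) (hxy : x ≠ y)
    (hA : CC G A) (hB : CC G B) (hC : CC G C)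
    (hAB : Disjoint A B) (hAC : Disjoint A C) (hBC : Disjoint B C)
    (xA : x ∉ A) (xB : x ∉ B) (xC : x ∉ C) (yA : y ∉ A) (yB : y ∉ B) (yC : y ∉ C)
    (exA : ∃ a ∈ A, G.Adj a x) (exB : ∃ a ∈ B, G.Adj a x) (exC : ∃ a ∈ C, G.Adj a x)
    (eyA : ∃ a ∈ A, G.Adj a y) (eyB : ∃ a ∈ B, G.Adj a y) (eyC : ∃ a ∈ C, G.Adj a y) :
    HasMinor G (completeBipartiteGraph (Fin 2) (Fin 3)) := by
  have k : ∀ i j, (∃ a ∈ (![A, B, C] j), G.Adj a ((![x, y] : Fin 2 → V) i)) := by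
    intro i j
    fin_cases i <;> fin_cases j <;> assumption
  have n : ∀ i j, (![x, y] : Fin 2 → V) i ∉ (![A, B, C] j) := by
    intro i j
    fin_cases i <;> fin_cases j <;> assumption
  rw [hasMinor_iff]
  refine ⟨Sum.elim (fun i => {(![x, y] : Fin 2 → V) i}) ![A, B, C], ?_, ?_, ?_⟩
  · rintro (w | w)
    · exact cc_singleton _ _
    · fin_cases w <;> assumption
  · rintro (i | i) (j | j) v hi hj
    · have : (![x, y] : Fin 2 → V) i = ![x, y] j := hi.symm.trans hj
      fin_cases i <;> fin_cases j <;> simp_all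
    · obtain rfl : v = _ := hi
      exact absurd hj (n _ _)
    · obtain rfl : v = _ := hj
      exact absurd hi (n _ _)
    · rw [Set.disjoint_left] at hAB hAC hBC
      fin_cases i <;> fin_cases j <;> simp_all
  · rintro (i | i) (j | j) hij
    · simp at hij
    · obtain ⟨a, ha, h⟩ := k i j
      exact ⟨_, rfl, a, ha, h.symm⟩
    · obtain ⟨a, ha, h⟩ := k j i
      exact ⟨a, ha, _, rfl, h⟩
    · simp at hij

/-- No two edges cross with respect to the positions. -/
def NC {V : Type*} (G : SimpleGraph V) (pos : V → ℕ) : Prop :=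
  ∀ a b c d, G.Adj a b → G.Adj c d → ¬ (pos a < pos c ∧ pos c < pos b ∧ pos b < pos d)

lemma nc_conn_iff {V : Type*} {G : SimpleGraph V} {pos : V → ℕ} (hi : Function.Injective pos)
    (h : NC G pos) {S T : Set V} (hS : CC G S) (hT : CC G T) (hd : ∀ v ∈ S, v ∉ T)
    {a b c d : V} (ha : a ∈ S) (hb : b ∈ S) (hc : c ∈ T) (hd' : d ∈ T)
    : (pos a < pos c ↔ pos a < pos d) ↔ (pos b < pos c ↔ pos b < pos d) := by
  have hne : ∀ s ∈ S, ∀ t ∈ T, pos s ≠ pos t := by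
    intro s hs t ht e
    exact hd s hs (hi e ▸ ht)
  have key : ∀ u ∈ S, ∀ v ∈ S, G.Adj u v → ∀ s ∈ T, ∀ t ∈ T,
      (pos u < pos s ↔ pos v < pos s) → (pos u < pos t ↔ pos v < pos t) := by
    intro u hu v hv huv
    apply hT.2
    intro s hs t ht hst
    have e1 := hne u hu s hs
    have e2 := hne u hu t ht
    have e3 := hne v hv s hs
    have e4 := hne v hv t ht
    have n1 := h u v s t huv hst
    have n2 := h u v t s huv hst.symm
    have n3 := h v u s t huv.symm hst
    have n4 := h v u t s huv.symm hst.symm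
    have n5 := h s t u v hst huv
    have n6 := h t s u v hst.symm huv
    have n7 := h s t v u hst huv.symm
    have n8 := h t s v u hst.symm huv.symm
    omega
  have := hS.2 (fun u => pos u < pos c ↔ pos u < pos d) ?_
  · exact ⟨this a ha b hb, this b hb a ha⟩
  · intro u hu v hv huv hh
    have k1 := key u hu v hv huv c hc d hd'
    have k2 := key u hu v hv huv d hd' c hc
    tauto

lemma nc_conn {V : Type*} {G : SimpleGraph V} {pos : V → ℕ} (hi : Function.Injective pos)
    (h : NC G pos) {S T : Set V} (hS : CC G S) (hT : CC G T) (hd : ∀ v ∈ S, v ∉ T)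
    {a b c d : V} (ha : a ∈ S) (hb : b ∈ S) (hc : c ∈ T) (hd' : d ∈ T)
    : ¬ (pos a < pos c ∧ pos c < pos b ∧ pos b < pos d) := by
  have := nc_conn_iff hi h hS hT hd ha hb hc hd'
  omega

lemma nc_outerplanar {V : Type*} {G : SimpleGraph V} {pos : V → ℕ} (hi : Function.Injective pos)
    (h : NC G pos) : Outerplanar G := by
  constructor
  · intro hm
    rw [hasMinor_iff] at hm
    obtain ⟨f, f1, f2, f3⟩ := hm
    choose r hr using fun w => (f1 w).1
    have cr : ∀ i j k l : Fin 4, i ≠ j → i ≠ k → i ≠ l → j ≠ k → j ≠ l → k ≠ l →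
        pos (r i) < pos (r j) → pos (r j) < pos (r k) → pos (r k) < pos (r l) → False := by
      intro i j k l h1 h2 h3 h4 h5 h6 g1 g2 g3
      obtain ⟨s, hs, t, ht, hst⟩ := f3 i k h2
      obtain ⟨s', hs', t', ht', hst'⟩ := f3 j l h5
      refine nc_conn hi h (cc_union G (f1 i) (f1 k) hs ht hst)
        (cc_union G (f1 j) (f1 l) hs' ht' hst') ?_ (Or.inl (hr i)) (Or.inr (hr k)) (Or.inl (hr j))
        (Or.inr (hr l)) ⟨g1, g2, g3⟩
      rintro v (hv | hv) (hv' | hv')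
      · exact h1 (f2 _ _ _ hv hv')
      · exact h3 (f2 _ _ _ hv hv')
      · exact h4 (f2 _ _ _ hv hv').symm
      · exact h6 (f2 _ _ _ hv hv')
    have ne : ∀ i j : Fin 4, i ≠ j → pos (r i) ≠ pos (r j) := by
      intro i j hij e
      exact hij (f2 _ _ _ (hr i) (hi e ▸ hr j))
    let σ := Tuple.sort (fun i => pos (r i))
    have hm : Monotone ((fun i => pos (r i)) ∘ σ) := Tuple.monotone_sort _
    have hσ : ∀ i j : Fin 4, i < j → pos (r (σ i)) < pos (r (σ j)) := by
      intro i j hij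
      exact lt_of_le_of_ne (hm hij.le) (ne _ _ (fun e => hij.ne (σ.injective e)))
    have hn : ∀ i j : Fin 4, i ≠ j → σ i ≠ σ j := fun i j hij e => hij (σ.injective e)
    exact cr (σ 0) (σ 1) (σ 2) (σ 3) (hn _ _ (by decide)) (hn _ _ (by decide)) (hn _ _ (by decide))
      (hn _ _ (by decide)) (hn _ _ (by decide)) (hn _ _ (by decide)) (hσ _ _ (by decide))
      (hσ _ _ (by decide)) (hσ _ _ (by decide))
  · intro hm
    rw [hasMinor_iff] at hm
    obtain ⟨f, f1, f2, f3⟩ := hm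
    choose r hr using fun w => (f1 w).1
    have ne : ∀ i j, i ≠ j → pos (r i) ≠ pos (r j) := by
      intro i j hij e
      exact hij (f2 _ _ _ (hr i) (hi e ▸ hr j))
    -- hub `p`, other hub `q`, leaves `a`, `b`
    have cr : ∀ (p q : Fin 2) (a b : Fin 3), p ≠ q → a ≠ b → ∃ S T : Set V, CC G S ∧ CC G T ∧
        (∀ v ∈ S, v ∉ T) ∧ r (Sum.inl p) ∈ S ∧ r (Sum.inr a) ∈ S ∧ r (Sum.inl q) ∈ T ∧
          r (Sum.inr b) ∈ T := by
      intro p q a b hpq hab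
      obtain ⟨s, hs, t, ht, hst⟩ := f3 (Sum.inl p) (Sum.inr a) (by simp)
      obtain ⟨s', hs', t', ht', hst'⟩ := f3 (Sum.inl q) (Sum.inr b) (by simp)
      refine ⟨_, _, cc_union G (f1 _) (f1 _) hs ht hst, cc_union G (f1 _) (f1 _) hs' ht' hst', ?_,
        Or.inl (hr _), Or.inr (hr _), Or.inl (hr _), Or.inr (hr _)⟩
      rintro v (hv | hv) (hv' | hv')
      · exact hpq (by simpa using (f2 _ _ _ hv hv'))
      · simpa using (f2 _ _ _ hv hv')
      · simpa using (f2 _ _ _ hv hv')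
      · exact hab (by simpa using (f2 _ _ _ hv hv'))
    have cr2 : ∀ (a b : Fin 3), a ≠ b →
        ((pos (r (Sum.inl 0)) < pos (r (Sum.inr a)) ↔ pos (r (Sum.inl 1)) < pos (r (Sum.inr a)))
         ↔ (pos (r (Sum.inl 0)) < pos (r (Sum.inr b)) ↔ pos (r (Sum.inl 1)) < pos (r (Sum.inr b))))
        → False := by
      intro a b hab hh
      obtain ⟨S, T, c1, c2, c3, m1, m2, m3, m4⟩ := cr 0 1 a b (by decide) hab
      obtain ⟨S', T', c1', c2', c3', m1', m2', m3', m4'⟩ := cr 0 1 b a (by decide) hab.symm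
      have z1 := nc_conn_iff hi h c1 c2 c3 m1 m2 m3 m4
      have z2 := nc_conn_iff hi h c1' c2' c3' m1' m2' m3' m4'
      have e1 := ne (Sum.inl 0) (Sum.inr a) (by simp)
      have e2 := ne (Sum.inl 0) (Sum.inr b) (by simp)
      have e3 := ne (Sum.inl 1) (Sum.inr a) (by simp)
      have e4 := ne (Sum.inl 1) (Sum.inr b) (by simp)
      have e5 := ne (Sum.inl 0) (Sum.inl 1) (by simp)
      have e6 := ne (Sum.inr a) (Sum.inr b) (by simpa using hab)
      have g1 : pos (r (Sum.inl 1)) < pos (r (Sum.inr a)) ↔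
        ¬ pos (r (Sum.inr a)) < pos (r (Sum.inl 1)) := by omega
      have g2 : pos (r (Sum.inl 1)) < pos (r (Sum.inr b)) ↔
        ¬ pos (r (Sum.inr b)) < pos (r (Sum.inl 1)) := by omega
      have g3 : pos (r (Sum.inr b)) < pos (r (Sum.inr a)) ↔
        ¬ pos (r (Sum.inr a)) < pos (r (Sum.inr b)) := by omega
      rw [g1, g2] at hh
      rw [g3] at z2
      clear g1 g2 g3 e1 e2 e3 e4 e5 e6
      grind
    have w1 := cr2 0 1 (by decide)
    have w2 := cr2 0 2 (by decide)
    have w3 := cr2 1 2 (by decide)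
    tauto

/-- `p 0, …, p k` is a path. -/
def IsP {V : Type*} (G : SimpleGraph V) (p : ℕ → V) (k : ℕ) : Prop :=
  (∀ i, i < k → G.Adj (p i) (p (i + 1))) ∧ (∀ i j, i ≤ k → j ≤ k → p i = p j → i = j)

lemma cc_interval {V : Type*} {G : SimpleGraph V} {p : ℕ → V} {k : ℕ} (hp : IsP G p k)
    {a b : ℕ} (hab : a ≤ b) (hb : b ≤ k) : CC G {v | ∃ t, a ≤ t ∧ t ≤ b ∧ v = p t} := by
  refine ⟨⟨p a, a, le_rfl, hab, rfl⟩, ?_⟩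
  intro P hP
  have key : ∀ t, a ≤ t → t ≤ b → (P (p a) ↔ P (p t)) := by
    intro t hat
    induction t, hat using Nat.le_induction with
    | base => intro _; rfl
    | succ t ht ih =>
      intro htb
      rw [ih (by omega)]
      have hadj := hp.1 t (by omega)
      have m1 : p t ∈ {v | ∃ t, a ≤ t ∧ t ≤ b ∧ v = p t} := ⟨t, ht, by omega, rfl⟩
      have m2 : p (t + 1) ∈ {v | ∃ t, a ≤ t ∧ t ≤ b ∧ v = p t} := ⟨t + 1, by omega, htb, rfl⟩
      exact ⟨hP _ m1 _ m2 hadj, hP _ m2 _ m1 hadj.symm⟩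
  rintro _ ⟨s, hs1, hs2, rfl⟩ _ ⟨t, ht1, ht2, rfl⟩ hh
  exact (key t ht1 ht2).1 ((key s hs1 hs2).2 hh)

lemma exists_small_degree {V : Type*} [Fintype V] [Nonempty V] (G : SimpleGraph V)
    (h : ∀ v x y, ∃ z, G.Adj v z ∧ z ≠ x ∧ z ≠ y) : HasMinor G (⊤ : SimpleGraph (Fin 4)) := by
  classical
  have hbound : ∀ p k, IsP G p k → k ≤ Fintype.card V := by
    intro p k hp
    have : Function.Injective (fun i : Fin (k + 1) => p i) := by
      intro i j hij
      exact Fin.ext (hp.2 i j (by omega) (by omega) hij)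
    have := Fintype.card_le_of_injective _ this
    simp at this
    omega
  obtain ⟨k, ⟨p0, hp0⟩, hmax⟩ : ∃ k, (∃ p, IsP G p k) ∧ ¬ ∃ p, IsP G p (k + 1) := by
    by_contra hcon
    push Not at hcon
    have : ∀ k, ∃ p, IsP G p k := by
      intro k
      induction k with
      | zero =>
        refine ⟨fun _ => Classical.arbitrary V, fun i hi => by omega, fun i j hi hj _ => by omega⟩
      | succ k ih => exact hcon k ih
    obtain ⟨p, hp⟩ := this (Fintype.card V + 1)
    have := hbound p _ hp
    omega
  -- neighbours of the first vertex lie on the path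
  have hnb : ∀ p, IsP G p k → ∀ z, G.Adj (p 0) z → ∃ j, 1 ≤ j ∧ j ≤ k ∧ z = p j := by
    intro p hp z hz
    by_contra hcon
    push Not at hcon
    have hz0 : ∀ j, j ≤ k → z ≠ p j := by
      intro j hj
      rcases Nat.eq_zero_or_pos j with rfl | hj0
      · exact hz.ne.symm
      · exact hcon j hj0 hj
    refine hmax ⟨fun t => if t = 0 then z else p (t - 1), ?_, ?_⟩
    · intro i hi
      rcases Nat.eq_zero_or_pos i with rfl | hi0
      · simpa using hz.symm
      · have := hp.1 (i - 1) (by omega)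
        rw [Nat.sub_add_cancel hi0] at this
        simpa [hi0.ne'] using this
    · intro i j hi hj hij
      dsimp only at hij
      split_ifs at hij with h1 h2 h2
      · omega
      · exact absurd hij (hz0 _ (by omega))
      · exact absurd hij.symm (hz0 _ (by omega))
      · have := hp.2 _ _ (by omega) (by omega) hij
        omega
  have hex : ∃ i, ∃ p, IsP G p k ∧ 2 ≤ i ∧ i ≤ k ∧ G.Adj (p 0) (p i) := by
    obtain ⟨z, hz, hz1, -⟩ := h (p0 0) (p0 1) (p0 1)
    obtain ⟨j, hj1, hjk, rfl⟩ := hnb p0 hp0 z hz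
    refine ⟨j, p0, hp0, ?_, hjk, hz⟩
    rcases Nat.lt_or_ge j 2 with h2 | h2
    · obtain rfl : j = 1 := by omega
      exact absurd rfl hz1
    · exact h2
  obtain ⟨p, hp, hi2, hik, hadj⟩ := Nat.find_spec hex
  have hmin := fun m (hm : m < Nat.find hex) => Nat.find_min hex hm
  generalize Nat.find hex = i at *
  -- third neighbour of the first vertex
  obtain ⟨z, hz, hz1, hzi⟩ := h (p 0) (p 1) (p i)
  obtain ⟨l, hl1, hlk, rfl⟩ := hnb p hp z hz
  have hl : i < l := by
    by_contra hcon
    have n1 : l ≠ 1 := by rintro rfl; exact hz1 rfl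
    have n2 : l ≠ i := by rintro rfl; exact hzi rfl
    exact hmin l (by omega) ⟨p, hp, by omega, hlk, hz⟩
  -- rotation
  have hrot : IsP G (fun t => if t < i then p (i - 1 - t) else p t) k := by
    constructor
    · intro t ht
      dsimp only
      by_cases h1 : t + 1 < i
      · rw [if_pos (by omega), if_pos h1]
        have := hp.1 (i - 1 - (t + 1)) (by omega)
        rw [show i - 1 - (t + 1) + 1 = i - 1 - t by omega] at this
        exact this.symm
      · by_cases h2 : t < i
        · rw [if_pos h2, if_neg h1, show i - 1 - t = 0 by omega, show t + 1 = i by omega]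
          exact hadj
        · rw [if_neg h2, if_neg h1]
          exact hp.1 t ht
    · intro s t hs ht hst
      dsimp only at hst
      split_ifs at hst with h1 h2 h2 <;>
      · have := hp.2 _ _ (by omega) (by omega) hst
        omega
  obtain ⟨w, hw, hw1, hwi⟩ := h (p (i - 1)) (p (i - 2)) (p i)
  obtain ⟨m', hm1, hmk, hwm⟩ := hnb _ hrot w (by simpa [show 0 < i by omega] using hw)
  have hm : ∃ m, i < m ∧ m ≤ k ∧ G.Adj (p (i - 1)) (p m) := by
    split_ifs at hwm with h1
    · exfalso
      have n1 : m' ≠ 1 := by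
        rintro rfl
        exact hw1 (by rw [hwm]; congr 1)
      refine hmin m' h1 ⟨_, hrot, by omega, hmk, ?_⟩
      simp only [show 0 < i by omega, h1, if_true]
      rw [← hwm]
      exact hw
    · refine ⟨m', ?_, hmk, hwm ▸ hw⟩
      have : m' ≠ i := by rintro rfl; exact hwi hwm
      omega
  obtain ⟨m, hmi, hmk, hmadj⟩ := hm
  have dj : ∀ a b c d : ℕ, b < c → d ≤ k →
      Disjoint {v | ∃ t, a ≤ t ∧ t ≤ b ∧ v = p t} {v | ∃ t, c ≤ t ∧ t ≤ d ∧ v = p t} := by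
    intro a b c d hbc hd
    rw [Set.disjoint_left]
    rintro _ ⟨s, hs1, hs2, rfl⟩ ⟨t, ht1, ht2, hst⟩
    have := hp.2 _ _ (by omega) (by omega) hst
    omega
  refine mk_K4 G _ _ _ _ (cc_interval hp (le_refl 0) (by omega))
    (cc_interval hp (a := 1) (b := i - 1) (by omega) (by omega))
    (cc_interval hp (le_refl i) hik) (cc_interval hp (a := i + 1) (b := k) (by omega) le_rfl)
    (dj _ _ _ _ (by omega) (by omega)) (dj _ _ _ _ (by omega) (by omega))
    (dj _ _ _ _ (by omega) (by omega)) (dj _ _ _ _ (by omega) (by omega))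
    (dj _ _ _ _ (by omega) (by omega)) (dj _ _ _ _ (by omega) (by omega)) ?_ ?_ ?_ ?_ ?_ ?_
  · exact ⟨p 0, ⟨0, by omega, by omega, rfl⟩, p 1, ⟨1, by omega, by omega, rfl⟩, hp.1 0 (by omega)⟩
  · exact ⟨p 0, ⟨0, by omega, by omega, rfl⟩, p i, ⟨i, by omega, by omega, rfl⟩, hadj⟩
  · exact ⟨p 0, ⟨0, by omega, by omega, rfl⟩, p l, ⟨l, by omega, by omega, rfl⟩, hz⟩
  · refine ⟨p (i - 1), ⟨i - 1, by omega, by omega, rfl⟩, p i, ⟨i, by omega, by omega, rfl⟩, ?_⟩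
    have := hp.1 (i - 1) (by omega)
    rwa [Nat.sub_add_cancel (by omega)] at this
  · exact ⟨p (i - 1), ⟨i - 1, by omega, by omega, rfl⟩, p m, ⟨m, by omega, by omega, rfl⟩, hmadj⟩
  · exact ⟨p i, ⟨i, by omega, by omega, rfl⟩, p (i + 1), ⟨i + 1, by omega, by omega, rfl⟩,
      hp.1 i (by omega)⟩

/-- Rotate a layout so that a given vertex comes first. -/
lemma rotate_layout {V : Type*} [Fintype V] {G : SimpleGraph V} {pos : V → ℕ}
    (hi : Function.Injective pos) (h : NC G pos) (z : V) :
    ∃ pos' : V → ℕ, Function.Injective pos' ∧ NC G pos' ∧ pos' z = 0 := by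
  obtain ⟨M, hM⟩ : ∃ M, ∀ v, pos v < M := by
    refine ⟨Finset.univ.sup pos + 1, fun v => Nat.lt_succ_of_le (Finset.le_sup (Finset.mem_univ v))⟩
  refine ⟨fun v => if pos z ≤ pos v then pos v - pos z else pos v + M - pos z, ?_, ?_, by simp⟩
  · intro u v huv
    apply hi
    have := hM u
    have := hM v
    have := hM z
    dsimp only at huv
    split_ifs at huv <;> omega
  · intro a b c d hab hcd
    have ma := hM a
    have mb := hM b
    have mc := hM c
    have md := hM d
    have mz := hM z
    have n1 := h a b c d hab hcd
    have n2 := h c d b a hcd hab.symm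
    have n3 := h b a d c hab.symm hcd.symm
    have n4 := h d c a b hcd.symm hab
    dsimp only
    split_ifs <;> omega

lemma glue_layout {V : Type*} [Fintype V] {G : SimpleGraph V} (K : Set V) (z : V) (hz : z ∉ K)
    (hK : ∀ a ∈ K, ∀ b, b ∉ K → G.Adj a b → b = z)
    (h1 : ∃ pos : {x // x ∈ K ∨ x = z} → ℕ, Function.Injective pos ∧
      NC (G.comap (Subtype.val : {x // x ∈ K ∨ x = z} → V)) pos)
    (h2 : ∃ pos : {x // x ∉ K} → ℕ, Function.Injective pos ∧
      NC (G.comap (Subtype.val : {x // x ∉ K} → V)) pos) :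
    ∃ pos : V → ℕ, Function.Injective pos ∧ NC G pos := by
  classical
  obtain ⟨p', hp1', hp2'⟩ := h1
  obtain ⟨q', hq1', hq2'⟩ := h2
  obtain ⟨p, hp1, hp2, hp3⟩ := rotate_layout hp1' hp2' ⟨z, Or.inr rfl⟩
  obtain ⟨q, hq1, hq2, hq3⟩ := rotate_layout hq1' hq2' ⟨z, hz⟩
  obtain ⟨M, hM⟩ : ∃ M, ∀ v, p v < M := by
    refine ⟨Finset.univ.sup p + 1, fun v => Nat.lt_succ_of_le (Finset.le_sup (Finset.mem_univ v))⟩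
  -- extend the two layouts to all of `V`
  obtain ⟨P, hP⟩ : ∃ P : V → ℕ, ∀ x (hx : x ∈ K ∨ x = z), P x = p ⟨x, hx⟩ :=
    ⟨fun x => if hx : x ∈ K ∨ x = z then p ⟨x, hx⟩ else 0, fun x hx => by simp [hx]⟩
  obtain ⟨Q, hQ⟩ : ∃ Q : V → ℕ, ∀ x (hx : x ∉ K), Q x = q ⟨x, hx⟩ :=
    ⟨fun x => if hx : x ∉ K then q ⟨x, hx⟩ else 0, fun x hx => by simp [hx]⟩
  have Pz : P z = 0 := by rw [hP z (Or.inr rfl)]; exact hp3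
  have Qz : Q z = 0 := by rw [hQ z hz]; exact hq3
  have PM : ∀ x, x ∈ K ∨ x = z → P x < M := fun x hx => by rw [hP x hx]; exact hM _
  have Pinj : ∀ x y, (x ∈ K ∨ x = z) → (y ∈ K ∨ y = z) → P x = P y → x = y := by
    intro x y hx hy hxy
    rw [hP x hx, hP y hy] at hxy
    exact congrArg Subtype.val (hp1 hxy)
  have Qinj : ∀ x y, x ∉ K → y ∉ K → Q x = Q y → x = y := by
    intro x y hx hy hxy
    rw [hQ x hx, hQ y hy] at hxy
    exact congrArg Subtype.val (hq1 hxy)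
  have Ppos : ∀ x ∈ K, 0 < P x := by
    intro x hx
    rcases Nat.eq_zero_or_pos (P x) with h0 | h0
    · have := Pinj x z (Or.inl hx) (Or.inr rfl) (by omega)
      exact absurd (this ▸ hx) hz
    · exact h0
  have Qpos : ∀ x, x ∉ K → x ≠ z → 0 < Q x := by
    intro x hx hxz
    rcases Nat.eq_zero_or_pos (Q x) with h0 | h0
    · exact absurd (Qinj x z hx hz (by omega)) hxz
    · exact h0
  have PNC : ∀ a b c d, (a ∈ K ∨ a = z) → (b ∈ K ∨ b = z) → (c ∈ K ∨ c = z) → (d ∈ K ∨ d = z) →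
      G.Adj a b → G.Adj c d → ¬ (P a < P c ∧ P c < P b ∧ P b < P d) := by
    intro a b c d ha hb hc hd hab hcd
    rw [hP a ha, hP b hb, hP c hc, hP d hd]
    exact hp2 ⟨a, ha⟩ ⟨b, hb⟩ ⟨c, hc⟩ ⟨d, hd⟩ hab hcd
  have QNC : ∀ a b c d, a ∉ K → b ∉ K → c ∉ K → d ∉ K →
      G.Adj a b → G.Adj c d → ¬ (Q a < Q c ∧ Q c < Q b ∧ Q b < Q d) := by
    intro a b c d ha hb hc hd hab hcd
    rw [hQ a ha, hQ b hb, hQ c hc, hQ d hd]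
    exact hq2 ⟨a, ha⟩ ⟨b, hb⟩ ⟨c, hc⟩ ⟨d, hd⟩ hab hcd
  obtain ⟨R, R1, R2, R3⟩ : ∃ R : V → ℕ, (∀ x, x ∈ K → R x = P x) ∧ R z = 0 ∧
      ∀ x, x ∉ K → x ≠ z → R x = Q x + M := by
    refine ⟨fun x => if x ∈ K then P x else if x = z then 0 else Q x + M, ?_, ?_, ?_⟩
    · intro x hx; simp [hx]
    · simp [hz]
    · intro x hx hxz; simp [hx, hxz]
  have PR : ∀ x, (x ∈ K ∨ x = z) → R x = P x := by
    rintro x (hx | rfl)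
    · exact R1 x hx
    · rw [R2, Pz]
  have tri : ∀ x, (x ∈ K ∧ 0 < R x ∧ R x < M ∧ R x = P x) ∨
      (x = z ∧ R x = 0 ∧ P x = 0 ∧ Q x = 0) ∨
      (x ∉ K ∧ x ≠ z ∧ M < R x ∧ R x = Q x + M ∧ 0 < Q x) := by
    intro x
    by_cases hx : x ∈ K
    · left
      have := R1 x hx
      have := Ppos x hx
      have := PM x (Or.inl hx)
      exact ⟨hx, by omega, by omega, by omega⟩
    · right
      by_cases hxz : x = z
      · left; subst hxz; exact ⟨rfl, R2, Pz, Qz⟩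
      · right
        have := R3 x hx hxz
        have := Qpos x hx hxz
        exact ⟨hx, hxz, by omega, by omega, by omega⟩
  refine ⟨R, ?_, ?_⟩
  · intro x y hxy
    rcases tri x with ⟨x1, x2, x3, x4⟩ | ⟨rfl, x2, x3, x4⟩ | ⟨x1, x2, x3, x4, x5⟩ <;>
    rcases tri y with ⟨y1, y2, y3, y4⟩ | ⟨rfl, y2, y3, y4⟩ | ⟨y1, y2, y3, y4, y5⟩ <;>
    first
      | rfl
      | omega
      | exact Pinj x y (Or.inl x1) (Or.inl y1) (by omega)
      | exact Qinj x y x1 y1 (by omega)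
  · -- every edge lies on one side
    have side : ∀ a b, G.Adj a b → ((a ∈ K ∨ a = z) ∧ (b ∈ K ∨ b = z)) ∨ (a ∉ K ∧ b ∉ K) := by
      intro a b hab
      by_cases ha : a ∈ K
      · by_cases hb : b ∈ K
        · exact Or.inl ⟨Or.inl ha, Or.inl hb⟩
        · exact Or.inl ⟨Or.inl ha, Or.inr (hK a ha b hb hab)⟩
      · by_cases hb : b ∈ K
        · exact Or.inl ⟨Or.inr (hK b hb a ha hab.symm), Or.inl hb⟩
        · exact Or.inr ⟨ha, hb⟩
    have small : ∀ x, (x ∈ K ∨ x = z) → R x < M := by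
      intro x hx
      rw [PR x hx]; exact PM x hx
    have big : ∀ x, x ∉ K → (R x = 0 ∧ Q x = 0) ∨ (M < R x ∧ R x = Q x + M ∧ 0 < Q x) := by
      intro x hx
      rcases tri x with h | h | h
      · exact absurd h.1 hx
      · exact Or.inl ⟨h.2.1, h.2.2.2⟩
      · exact Or.inr h.2.2
    intro a b c d hab hcd
    rcases side a b hab with ⟨ha, hb⟩ | ⟨ha, hb⟩ <;> rcases side c d hcd with ⟨hc, hd⟩ | ⟨hc, hd⟩
    · rw [PR a ha, PR b hb, PR c hc, PR d hd]
      exact PNC a b c d ha hb hc hd hab hcd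
    · have := small b hb
      have := big c hc
      omega
    · have := small c hc
      have := small d hd
      have := big b hb
      omega
    · have n1 := QNC a b c d ha hb hc hd hab hcd
      have := big a ha
      have := big b hb
      have := big c hc
      have := big d hd
      omega

/-- Connected piece inside a set `S` whose outside neighbours are among `x`, `y`. -/
lemma exists_piece {V : Type*} {G : SimpleGraph V} (S : Set V) (s x y : V) (hs : s ∈ S)
    (hx : x ∉ S) (hy : y ∉ S) (hxy : x ≠ y)
    (hS : ∀ a ∈ S, ∀ b, b ∉ S → G.Adj a b → b = x ∨ b = y)
    (hsep : ∀ (K : Set V) (z : V), z ∉ K → K.Nonempty → (∃ w, w ∉ K ∧ w ≠ z) →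
      ∃ a ∈ K, ∃ b, b ∉ K ∧ G.Adj a b ∧ b ≠ z) :
    ∃ K : Set V, K ⊆ S ∧ CC G K ∧ (∃ a ∈ K, G.Adj a x) ∧ (∃ a ∈ K, G.Adj a y) := by
  let r : V → V → Prop := fun a b => G.Adj a b ∧ b ∈ S
  let K : Set V := {w | Relation.ReflTransGen r s w}
  have hKS : K ⊆ S := by
    intro w hw
    rcases Relation.ReflTransGen.cases_tail hw with h | ⟨c, _, h⟩
    · exact h ▸ hs
    · exact h.2
  have hout : ∀ a ∈ K, ∀ b, b ∉ K → G.Adj a b → b = x ∨ b = y := by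
    intro a ha b hb hab
    refine hS a (hKS ha) b (fun hbS => hb ?_) hab
    exact Relation.ReflTransGen.tail ha ⟨hab, hbS⟩
  have hsK : s ∈ K := Relation.ReflTransGen.refl
  refine ⟨K, hKS, ⟨⟨s, hsK⟩, ?_⟩, ?_, ?_⟩
  · intro P hP
    have key : ∀ w, Relation.ReflTransGen r s w → (P s ↔ P w) := by
      intro w hw
      induction hw with
      | refl => rfl
      | @tail b c hb hbc ih =>
        have hc : c ∈ K := Relation.ReflTransGen.tail hb hbc
        rw [ih]
        exact ⟨hP b hb c hc hbc.1, hP c hc b hb hbc.1.symm⟩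
    intro a ha b hb hPa
    exact (key b hb).1 ((key a ha).2 hPa)
  · obtain ⟨a, ha, b, hb, hab, hne⟩ := hsep K y (fun h => hy (hKS h)) ⟨s, hsK⟩
      ⟨x, fun h => hx (hKS h), hxy⟩
    rcases hout a ha b hb hab with rfl | rfl
    · exact ⟨a, ha, hab⟩
    · exact absurd rfl hne
  · obtain ⟨a, ha, b, hb, hab, hne⟩ := hsep K x (fun h => hx (hKS h)) ⟨s, hsK⟩
      ⟨y, fun h => hy (hKS h), hxy.symm⟩
    rcases hout a ha b hb hab with rfl | rfl
    · exact absurd rfl hne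
    · exact ⟨a, ha, hab⟩

theorem exists_layout.{u} (n : ℕ) : ∀ (V : Type u) [Fintype V], Fintype.card V = n →
    ∀ G : SimpleGraph V, Outerplanar G → ∃ pos : V → ℕ, Function.Injective pos ∧ NC G pos := by
  classical
  induction n using Nat.strong_induction_on with
  | _ n ih =>
  intro V _ hcard G hG
  by_cases hn : n ≤ 3
  · let e := Fintype.equivFin V
    refine ⟨fun v => (e v : ℕ), fun a b hab => e.injective (Fin.ext hab), ?_⟩
    intro a b c d _ _
    have := (e d).isLt
    dsimp only
    omega
  by_cases hsep : ∃ (K : Set V) (z : V), z ∉ K ∧ K.Nonempty ∧ (∃ w, w ∉ K ∧ w ≠ z) ∧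
      ∀ a ∈ K, ∀ b, b ∉ K → G.Adj a b → b = z
  · obtain ⟨K, z, hz, ⟨k, hk⟩, ⟨w, hw, hwz⟩, hK⟩ := hsep
    refine glue_layout K z hz hK ?_ ?_
    · refine ih _ ?_ _ rfl _ (outerplanar_of_minor (hasMinor_comap G _ Subtype.val_injective) hG)
      rw [← hcard]
      exact Fintype.card_subtype_lt (x := w) (by tauto)
    · refine ih _ ?_ _ rfl _ (outerplanar_of_minor (hasMinor_comap G _ Subtype.val_injective) hG)
      rw [← hcard]
      exact Fintype.card_subtype_lt (x := k) (by tauto)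
  have hsep' : ∀ (K : Set V) (z : V), z ∉ K → K.Nonempty → (∃ w, w ∉ K ∧ w ≠ z) →
      ∃ a ∈ K, ∃ b, b ∉ K ∧ G.Adj a b ∧ b ≠ z := by
    intro K z h1 h2 h3
    by_contra hcon
    push Not at hcon
    exact hsep ⟨K, z, h1, h2, h3, hcon⟩
  have : Nonempty V := by
    rw [← Fintype.card_pos_iff]; omega
  obtain ⟨v, x, y, hv⟩ : ∃ v x y, ∀ z, G.Adj v z → z = x ∨ z = y := by
    by_contra hcon
    push Not at hcon
    exact hG.1 (exists_small_degree G hcon)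
  have third : ∀ a b : V, ∃ w, w ≠ a ∧ w ≠ b := by
    intro a b
    have : ∃ w, w ∉ ({a, b} : Finset V) := by
      by_contra hcon
      push Not at hcon
      have h1 : (Finset.univ : Finset V) ⊆ {a, b} := fun w _ => hcon w
      have h2 := Finset.card_le_card h1
      have h3 := Finset.card_le_two (a := a) (b := b)
      rw [Finset.card_univ] at h2
      omega
    obtain ⟨w, hw⟩ := this
    simp at hw
    exact ⟨w, hw⟩
  have hnb : ∀ z, ∃ u, G.Adj v u ∧ u ≠ z := by
    have aux : ∀ z, z ≠ v → ∃ u, G.Adj v u ∧ u ≠ z := by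
      intro z hz
      obtain ⟨w, hw1, hw2⟩ := third v z
      obtain ⟨a, ha, b, _, hab, hbz⟩ := hsep' {v} z (by simpa using hz) ⟨v, rfl⟩
        ⟨w, by simpa using hw1, hw2⟩
      obtain rfl : a = v := ha
      exact ⟨b, hab, hbz⟩
    intro z
    by_cases hz : z = v
    · obtain ⟨w, hw, _⟩ := third v v
      obtain ⟨u, hu, _⟩ := aux w hw
      exact ⟨u, hu, fun h => G.loopless.irrefl v (by rw [h, hz] at hu; exact hu)⟩
    · exact aux z hz
  have hvy : G.Adj v y ∧ y ≠ x := by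
    obtain ⟨u, hu, hux⟩ := hnb x
    rcases hv u hu with rfl | rfl
    · exact absurd rfl hux
    · exact ⟨hu, hux⟩
  have hvx : G.Adj v x := by
    obtain ⟨u, hu, hux⟩ := hnb y
    rcases hv u hu with rfl | rfl
    · exact hu
    · exact absurd rfl hux
  obtain ⟨hvy, hyx⟩ := hvy
  have hxv : x ≠ v := hvx.ne.symm
  have hyv : y ≠ v := hvy.ne.symm
  -- contract `v` into `x`
  let G' : SimpleGraph {w // w ≠ v} := G.comap Subtype.val ⊔ SimpleGraph.fromEdgeSet {s(⟨x, hxv⟩, ⟨y, hyv⟩)}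
  have hmin : HasMinor G G' := by
    rw [hasMinor_iff]
    refine ⟨fun u => if (u : V) = x then {x, v} else {(u : V)}, ?_, ?_, ?_⟩
    · intro u
      dsimp only
      split_ifs
      · exact cc_pair G hvx.symm
      · exact cc_singleton G _
    · rintro ⟨a, ha⟩ ⟨b, hb⟩ w hwa hwb
      apply Subtype.ext
      dsimp only at *
      split_ifs at hwa hwb <;> simp at hwa hwb <;> grind
    · have mem : ∀ u : {w // w ≠ v}, (u : V) ∈ (if (u : V) = x then ({x, v} : Set V) else {(u : V)}) := by
        intro u
        split_ifs with h <;> simp [h]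
      intro a b hab
      rcases hab with hab | hab
      · exact ⟨a, mem a, b, mem b, hab⟩
      · rw [SimpleGraph.fromEdgeSet_adj] at hab
        rcases Sym2.eq_iff.1 hab.1 with ⟨rfl, rfl⟩ | ⟨rfl, rfl⟩
        · exact ⟨v, by simp, y, mem ⟨y, hyv⟩, hvy⟩
        · exact ⟨y, mem ⟨y, hyv⟩, v, by simp, hvy.symm⟩
  obtain ⟨p', hp1', hp2'⟩ := ih _ (by rw [← hcard]; exact Fintype.card_subtype_lt (x := v) (by simp)) _ rfl
    G' (outerplanar_of_minor hmin hG)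
  obtain ⟨p, hp1, hp2, hp3⟩ := rotate_layout hp1' hp2' ⟨x, hxv⟩
  obtain ⟨P, hP⟩ : ∃ P : V → ℕ, ∀ w (hw : w ≠ v), P w = p ⟨w, hw⟩ :=
    ⟨fun w => if hw : w ≠ v then p ⟨w, hw⟩ else 0, fun w hw => by simp [hw]⟩
  obtain ⟨M, hM⟩ : ∃ M, ∀ w, P w < M := by
    refine ⟨Finset.univ.sup P + 1, fun v => Nat.lt_succ_of_le (Finset.le_sup (Finset.mem_univ v))⟩
  have Px : P x = 0 := by rw [hP x hxv]; exact hp3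
  have Pinj : ∀ a b, a ≠ v → b ≠ v → P a = P b → a = b := by
    intro a b ha hb hab
    rw [hP a ha, hP b hb] at hab
    exact congrArg Subtype.val (hp1 hab)
  have Ppos : ∀ a, a ≠ v → a ≠ x → 0 < P a := by
    intro a ha hax
    rcases Nat.eq_zero_or_pos (P a) with h0 | h0
    · exact absurd (Pinj a x ha hxv (by omega)) hax
    · exact h0
  have PNC : ∀ a b c d, a ≠ v → b ≠ v → c ≠ v → d ≠ v →
      G.Adj a b → G.Adj c d → ¬ (P a < P c ∧ P c < P b ∧ P b < P d) := by
    intro a b c d ha hb hc hd hab hcd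
    rw [hP a ha, hP b hb, hP c hc, hP d hd]
    exact hp2 ⟨a, ha⟩ ⟨b, hb⟩ ⟨c, hc⟩ ⟨d, hd⟩ (Or.inl hab) (Or.inl hcd)
  have Pxy : ∀ c d, c ≠ v → d ≠ v → G.Adj c d → ¬ (0 < P c ∧ P c < P y ∧ P y < P d) := by
    intro c d hc hd hcd
    rw [← Px, hP x hxv, hP y hyv, hP c hc, hP d hd]
    refine hp2 ⟨x, hxv⟩ ⟨y, hyv⟩ ⟨c, hc⟩ ⟨d, hd⟩ (Or.inr ?_) (Or.inl hcd)
    rw [SimpleGraph.fromEdgeSet_adj]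
    exact ⟨rfl, by simpa using hyx.symm⟩
  have Py := Ppos y hyv hyx
  by_cases hL : ∀ w, w ≠ v → ¬ (0 < P w ∧ P w < P y)
  · -- insert `v` between `x` and `y`
    obtain ⟨R, R1, R2⟩ : ∃ R : V → ℕ, R v = 1 ∧ ∀ w, w ≠ v → R w = 2 * P w :=
      ⟨fun w => if w = v then 1 else 2 * P w, by simp, fun w hw => by simp [hw]⟩
    refine ⟨R, ?_, ?_⟩
    · intro a b hab
      by_cases ha : a = v <;> by_cases hb : b = v
      · rw [ha, hb]
      · rw [ha, R1, R2 b hb] at hab; omega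
      · rw [hb, R1, R2 a ha] at hab; omega
      · rw [R2 a ha, R2 b hb] at hab
        exact Pinj a b ha hb (by omega)
    · have Rz : ∀ w, R w = 0 ∨ R w = 1 ∨ 2 * P y ≤ R w := by
        intro w
        by_cases hw : w = v
        · rw [hw]; omega
        · have := hL w hw
          rw [R2 w hw]; omega
      have Rv : ∀ w, G.Adj v w → R w = 0 ∨ R w = 2 * P y := by
        intro w hw
        rcases hv w hw with rfl | rfl
        · rw [R2 _ hxv]; omega
        · rw [R2 _ hyv]; omega
      intro a b c d hab hcd
      have za := Rz a
      have zb := Rz b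
      have zc := Rz c
      have zd := Rz d
      by_cases ha : a = v
      · have := Rv b (ha ▸ hab)
        rw [ha]; omega
      by_cases hb : b = v
      · have := Rv a (hb ▸ hab.symm)
        rw [hb]; omega
      by_cases hc : c = v
      · have := Rv d (hc ▸ hcd)
        rw [hc]; omega
      by_cases hd : d = v
      · rw [hd]; omega
      have := PNC a b c d ha hb hc hd hab hcd
      rw [R2 a ha, R2 b hb, R2 c hc, R2 d hd]
      omega
  by_cases hR : ∀ w, w ≠ v → ¬ (P y < P w)
  · obtain ⟨R, R1, R2⟩ : ∃ R : V → ℕ, R v = M ∧ ∀ w, w ≠ v → R w = P w :=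
      ⟨fun w => if w = v then M else P w, by simp, fun w hw => by simp [hw]⟩
    refine ⟨R, ?_, ?_⟩
    · intro a b hab
      by_cases ha : a = v <;> by_cases hb : b = v
      · rw [ha, hb]
      · have := hM b
        rw [ha, R1, R2 b hb] at hab; omega
      · have := hM a
        rw [hb, R1, R2 a ha] at hab; omega
      · rw [R2 a ha, R2 b hb] at hab
        exact Pinj a b ha hb (by omega)
    · have My := hM y
      have Rz : ∀ w, R w = M ∨ R w ≤ P y := by
        intro w
        by_cases hw : w = v
        · rw [hw]; omega
        · have := hR w hw
          rw [R2 w hw]; omega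
      have Rv : ∀ w, G.Adj v w → R w = 0 ∨ R w = P y := by
        intro w hw
        rcases hv w hw with rfl | rfl
        · rw [R2 _ hxv]; omega
        · rw [R2 _ hyv]; omega
      intro a b c d hab hcd
      have za := Rz a
      have zb := Rz b
      have zc := Rz c
      have zd := Rz d
      by_cases ha : a = v
      · rw [ha]; omega
      by_cases hb : b = v
      · rw [hb]; omega
      by_cases hc : c = v
      · rw [hc]; omega
      by_cases hd : d = v
      · have := Rv c (hd ▸ hcd.symm)
        rw [hd]; omega
      have := PNC a b c d ha hb hc hd hab hcd
      rw [R2 a ha, R2 b hb, R2 c hc, R2 d hd]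
      omega
  -- both sides nonempty: a `K_{2,3}` minor
  exfalso
  push Not at hL hR
  obtain ⟨l, hlv, hl0, hly⟩ := hL
  obtain ⟨r, hrv, hry⟩ := hR
  obtain ⟨A, hAS, hA, hAx, hAy⟩ := exists_piece (G := G) {w | w ≠ v ∧ 0 < P w ∧ P w < P y} l x y
    ⟨hlv, hl0, hly⟩ (by simp [Px]) (by simp) hyx.symm (by
      rintro a ⟨ha1, ha2, ha3⟩ b hb hab
      by_contra hcon
      push Not at hcon
      by_cases hbv : b = v
      · subst hbv
        rcases hv a hab.symm with rfl | rfl <;> omega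
      · have b0 := Ppos b hbv hcon.1
        have := Pxy a b ha1 hbv hab
        have : P b ≠ P y := fun e => hcon.2 (Pinj b y hbv hyv e)
        exact hb ⟨hbv, b0, by omega⟩) hsep'
  obtain ⟨B, hBS, hB, hBx, hBy⟩ := exists_piece (G := G) {w | w ≠ v ∧ P y < P w} r x y
    ⟨hrv, hry⟩ (by simp [Px]) (by simp) hyx.symm (by
      rintro a ⟨ha1, ha2⟩ b hb hab
      by_contra hcon
      push Not at hcon
      by_cases hbv : b = v
      · subst hbv
        rcases hv a hab.symm with rfl | rfl <;> omega
      · have b0 := Ppos b hbv hcon.1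
        have := Pxy b a hbv ha1 hab.symm
        have : P b ≠ P y := fun e => hcon.2 (Pinj b y hbv hyv e)
        exact hb ⟨hbv, by omega⟩) hsep'
  refine hG.2 (mk_K23 G x y {v} A B hyx.symm (cc_singleton G v) hA hB ?_ ?_ ?_ (by simpa using hxv)
    ?_ ?_ (by simpa using hyv) ?_ ?_ ⟨v, rfl, hvx⟩ hAx hBx ⟨v, rfl, hvy⟩ hAy hBy)
  · exact Set.disjoint_singleton_left.2 fun h => (hAS h).1 rfl
  · exact Set.disjoint_singleton_left.2 fun h => (hBS h).1 rfl
  · exact Set.disjoint_left.2 fun w h1 h2 => by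
      have := (hAS h1).2.2
      have := (hBS h2).2
      omega
  · intro h; have := (hAS h).2.1; omega
  · intro h; have := (hBS h).2; omega
  · intro h; have := (hAS h).2.2; omega
  · intro h; have := (hBS h).2; omega

/-- A maximal noncrossing graph on the points `0, …, n-1` of a circle. -/
structure MaxNC (n : ℕ) (A : ℕ → ℕ → Prop) : Prop where
  hn : 4 ≤ n
  symm : ∀ i j, A i j → A j i
  lt : ∀ i j, A i j → i < n ∧ j < n ∧ i ≠ j
  succ : ∀ i, i + 1 < n → A i (i + 1)
  last : A 0 (n - 1)
  nc : ∀ a b c d, A a b → A c d → ¬ (a < c ∧ c < b ∧ b < d)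
  max : ∀ u v, u < v → v < n → ¬ A u v →
    ∃ p q, A p q ∧ u < p ∧ p < v ∧ (q < u ∨ v < q)

/-- Degree two. -/
def Deg2 (A : ℕ → ℕ → Prop) (i : ℕ) : Prop := ∃ x y, x ≠ y ∧ ∀ z, A i z ↔ z = x ∨ z = y

lemma MaxNC.exists_lohi {n : ℕ} {A : ℕ → ℕ → Prop} (h : MaxNC n A) :
    ∃ lo hi : ℕ → ℕ, ∀ b, 0 < b → b + 1 < n → lo b < b ∧ b < hi b ∧ hi b < n ∧ A b (lo b) ∧
      A b (hi b) ∧ A (lo b) (hi b) ∧ (∀ z, A b z → lo b ≤ z ∧ z ≤ hi b) := by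
  classical
  have : ∀ b, ∃ l m, 0 < b → b + 1 < n → l < b ∧ b < m ∧ m < n ∧ A b l ∧
      A b m ∧ A l m ∧ (∀ z, A b z → l ≤ z ∧ z ≤ m) := by
    intro b
    by_cases hb : 0 < b ∧ b + 1 < n
    · obtain ⟨h0, h1⟩ := hb
      let S := (Finset.range n).filter (A b)
      have mem : ∀ z, z ∈ S ↔ A b z := by
        intro z
        simp only [S, Finset.mem_filter, Finset.mem_range]
        exact ⟨fun h => h.2, fun hz => ⟨(h.lt _ _ hz).2.1, hz⟩⟩
      have a1 : A b (b + 1) := h.succ b h1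
      have a2 : A b (b - 1) := by
        have := h.succ (b - 1) (by omega)
        rw [Nat.sub_add_cancel h0] at this
        exact h.symm _ _ this
      have hne : S.Nonempty := ⟨b + 1, (mem _).2 a1⟩
      have l1 : A b (S.min' hne) := (mem _).1 (S.min'_mem hne)
      have l2 : A b (S.max' hne) := (mem _).1 (S.max'_mem hne)
      have l3 : ∀ z, A b z → S.min' hne ≤ z ∧ z ≤ S.max' hne := fun z hz =>
        ⟨S.min'_le _ ((mem z).2 hz), S.le_max' _ ((mem z).2 hz)⟩
      generalize S.min' hne = l at *
      generalize S.max' hne = m at *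
      have e1 := l3 _ a1
      have e2 := l3 _ a2
      have e3 := h.lt _ _ l2
      refine ⟨l, m, fun _ _ => ⟨by omega, by omega, by omega, l1, l2, ?_, l3⟩⟩
      by_contra hcon
      obtain ⟨p, q, hpq, g1, g2, g3⟩ := h.max l m (by omega) (by omega) hcon
      by_cases hpb : p = b
      · subst hpb
        have := l3 q hpq
        omega
      have n1 := h.nc l b p q (h.symm _ _ l1) hpq
      have n2 := h.nc q p l b (h.symm _ _ hpq) (h.symm _ _ l1)
      have n3 := h.nc b m p q l2 hpq
      have n4 := h.nc q p b m (h.symm _ _ hpq) l2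
      omega
    · exact ⟨0, 0, fun h1 h2 => absurd ⟨h1, h2⟩ hb⟩
  choose lo hi hh using this
  exact ⟨lo, hi, hh⟩

lemma MaxNC.tri {n : ℕ} {A : ℕ → ℕ → Prop} (h : MaxNC n A) {lo hi : ℕ → ℕ}
    (H : ∀ b, 0 < b → b + 1 < n → lo b < b ∧ b < hi b ∧ hi b < n ∧ A b (lo b) ∧
      A b (hi b) ∧ A (lo b) (hi b) ∧ (∀ z, A b z → lo b ≤ z ∧ z ≤ hi b))
    {a b c : ℕ} (h1 : a < b) (h2 : b < c) (hab : A a b) (hbc : A b c) (hac : A a c) :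
    0 < b ∧ b + 1 < n ∧ a = lo b ∧ c = hi b := by
  have := h.lt _ _ hbc
  obtain ⟨k1, k2, k3, k4, k5, k6, k7⟩ := H b (by omega) (by omega)
  have := k7 a (h.symm _ _ hab)
  have := k7 c hbc
  have n1 := h.nc (lo b) b a c (h.symm _ _ k4) hac
  have n2 := h.nc a c b (hi b) hac k5
  omega

lemma MaxNC.count {n : ℕ} {A : ℕ → ℕ → Prop} (h : MaxNC n A) {lo hi : ℕ → ℕ}
    (H : ∀ b, 0 < b → b + 1 < n → lo b < b ∧ b < hi b ∧ hi b < n ∧ A b (lo b) ∧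
      A b (hi b) ∧ A (lo b) (hi b) ∧ (∀ z, A b z → lo b ≤ z ∧ z ≤ hi b))
    (D I : Finset ℕ) (hD : ∀ i, i ∈ D ↔ i < n ∧ Deg2 A i)
    (hI : ∀ b, b ∈ I ↔ 0 < b ∧ b + 1 < n ∧ lo b + 1 ≠ b ∧ b + 1 ≠ hi b ∧
      ¬ (lo b = 0 ∧ hi b + 1 = n)) : D.card = I.card + 2 := by
  classical
  have hn := h.hn
  -- apex of the edge `0, n-1`
  obtain ⟨b0, hb1, hb2, hb3, hb4⟩ : ∃ b0, 0 < b0 ∧ b0 + 1 < n ∧ A 0 b0 ∧ A b0 (n - 1) := by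
    let S := (Finset.range (n - 1)).filter (A 0)
    have mem : ∀ z, z ∈ S ↔ z < n - 1 ∧ A 0 z := by
      intro z
      simp only [S, Finset.mem_filter, Finset.mem_range]
    have hne : S.Nonempty := ⟨1, (mem _).2 ⟨by omega, h.succ 0 (by omega)⟩⟩
    have l2 := (mem _).1 (S.max'_mem hne)
    have l3 : ∀ z, z < n - 1 → A 0 z → z ≤ S.max' hne := fun z hz hz' =>
      S.le_max' _ ((mem z).2 ⟨hz, hz'⟩)
    generalize S.max' hne = m at *
    have := h.lt _ _ l2.2
    refine ⟨m, by omega, by omega, l2.2, ?_⟩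
    by_contra hcon
    obtain ⟨p, q, hpq, g1, g2, g3⟩ := h.max m (n - 1) (by omega) (by omega) hcon
    have := h.lt _ _ hpq
    by_cases hq : q = 0
    · subst hq
      have := l3 p g2 (h.symm _ _ hpq)
      omega
    have := h.nc 0 m q p l2.2 (h.symm _ _ hpq)
    omega
  obtain ⟨_, _, hlo0, hhi0⟩ := h.tri H hb1 (by omega) hb3 hb4 h.last
  have huniq : ∀ b, 0 < b → b + 1 < n → lo b = 0 → hi b + 1 = n → b = b0 := by
    intro b g1 g2 g3 g4
    obtain ⟨k1, k2, k3, k4, k5, k6, k7⟩ := H b g1 g2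
    rw [g3] at k4
    rw [show hi b = n - 1 by omega] at k5
    have n1 := h.nc 0 b b0 (n - 1) (h.symm _ _ k4) hb4
    have n2 := h.nc 0 b0 b (n - 1) hb3 k5
    omega
  let X := (Finset.Ioo 0 (n - 1)).filter (fun b => lo b + 1 = b)
  let Y := (Finset.Ioo 0 (n - 1)).filter (fun b => b + 1 = hi b)
  have hX : ∀ b, b ∈ X ↔ 0 < b ∧ b + 1 < n ∧ lo b + 1 = b := by
    intro b
    simp only [X, Finset.mem_filter, Finset.mem_Ioo]
    omega
  have hY : ∀ b, b ∈ Y ↔ 0 < b ∧ b + 1 < n ∧ b + 1 = hi b := by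
    intro b
    simp only [Y, Finset.mem_filter, Finset.mem_Ioo]
    omega
  have hXY : X.card + Y.card = n - 1 := by
    have e := Finset.card_filter_add_card_filter_not (s := Finset.range (n - 1))
      (fun i => i + 1 ∈ X)
    rw [Finset.card_range] at e
    rw [← e]
    congr 1
    · have : X = ((Finset.range (n - 1)).filter (fun i => i + 1 ∈ X)).image (· + 1) := by
        ext b
        simp only [Finset.mem_image, Finset.mem_filter, Finset.mem_range]
        constructor
        · intro hb
          have := (hX b).1 hb
          exact ⟨b - 1, ⟨by omega, by rwa [Nat.sub_add_cancel this.1]⟩, by omega⟩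
        · rintro ⟨i, ⟨_, hi⟩, rfl⟩
          exact hi
      conv_lhs => rw [this]
      exact Finset.card_image_of_injective _ (add_left_injective 1)
    · congr 1
      ext i
      simp only [Finset.mem_filter, Finset.mem_range]
      rw [hX, hY]
      constructor
      · rintro ⟨g1, g2, g3⟩
        refine ⟨by omega, ?_⟩
        rintro ⟨_, g4, g5⟩
        obtain ⟨k1, k2, k3, k4, k5, k6, k7⟩ := H i g1 g2
        obtain ⟨k1', k2', k3', k4', k5', k6', k7'⟩ := H (i + 1) (by omega) g4
        have := k7' (lo i) (by rw [g3]; exact h.symm _ _ k6)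
        omega
      · rintro ⟨g1, g2⟩
        by_cases h0 : i = 0
        · subst h0
          have := H 1 (by omega) (by omega)
          exact absurd ⟨by omega, by omega, by simp; omega⟩ g2
        obtain ⟨k1, k2, k3, k4, k5, k6, k7⟩ := H i (by omega) (by omega)
        refine ⟨by omega, by omega, ?_⟩
        by_cases hl : i + 2 = n
        · omega
        obtain ⟨k1', k2', k3', k4', k5', k6', k7'⟩ := H (i + 1) (by omega) (by omega)
        have := h.nc (lo (i + 1)) (i + 1) i (hi i) (h.symm _ _ k4') k5
        have := k7 (i + 1) (h.succ i (by omega))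
        have : ¬ (lo (i + 1) + 1 = i + 1) := fun e => g2 ⟨by omega, by omega, e⟩
        omega
  have hun := Finset.card_union_add_card_inter X Y
  let N := (Finset.Ioo 0 (n - 1)) \ (X ∪ Y)
  have hN : ∀ b, b ∈ N ↔ 0 < b ∧ b + 1 < n ∧ lo b + 1 ≠ b ∧ b + 1 ≠ hi b := by
    intro b
    simp only [N, Finset.mem_sdiff, Finset.mem_union, Finset.mem_Ioo, hX, hY]
    omega
  have hNc : N.card + (X ∪ Y).card = n - 2 := by
    have hsub : X ∪ Y ⊆ Finset.Ioo 0 (n - 1) :=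
      Finset.union_subset (Finset.filter_subset _ _) (Finset.filter_subset _ _)
    have := Finset.card_sdiff_add_card_eq_card hsub
    rw [Nat.card_Ioo] at this
    simp only [N]
    omega
  -- interior vertices of degree two
  have hIntDeg : ∀ b, 0 < b → b + 1 < n → (Deg2 A b ↔ lo b + 1 = b ∧ b + 1 = hi b) := by
    intro b g1 g2
    obtain ⟨k1, k2, k3, k4, k5, k6, k7⟩ := H b g1 g2
    have a1 := h.succ b g2
    have a2 := h.succ (b - 1) (by omega)
    rw [Nat.sub_add_cancel g1] at a2
    replace a2 := h.symm _ _ a2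
    constructor
    · rintro ⟨x, y, hxy, hz⟩
      have z1 := (hz _).1 a1
      have z2 := (hz _).1 a2
      have z3 := (hz _).1 k4
      have z4 := (hz _).1 k5
      omega
    · rintro ⟨e1, e2⟩
      refine ⟨b - 1, b + 1, by omega, fun z => ⟨fun hz => ?_, ?_⟩⟩
      · have := k7 z hz
        have := h.lt _ _ hz
        omega
      · rintro (rfl | rfl) <;> assumption
  have h0 : Deg2 A 0 ↔ b0 = 1 := by
    have a1 := h.succ 0 (by omega)
    have a2 := h.last
    constructor
    · rintro ⟨x, y, hxy, hz⟩
      have z1 := (hz _).1 a1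
      have z2 := (hz _).1 a2
      have z3 := (hz _).1 hb3
      omega
    · rintro rfl
      refine ⟨1, n - 1, by omega, fun z => ⟨fun hz => ?_, ?_⟩⟩
      · have := h.lt _ _ hz
        have := h.nc 0 z 1 (n - 1) hz hb4
        omega
      · rintro (rfl | rfl) <;> assumption
  have hl : Deg2 A (n - 1) ↔ b0 + 2 = n := by
    have a1 := h.succ (n - 2) (by omega)
    rw [show n - 2 + 1 = n - 1 by omega] at a1
    replace a1 := h.symm _ _ a1
    have a2 := h.symm _ _ h.last
    constructor
    · rintro ⟨x, y, hxy, hz⟩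
      have z1 := (hz _).1 a1
      have z2 := (hz _).1 a2
      have z3 := (hz _).1 (h.symm _ _ hb4)
      omega
    · intro e
      refine ⟨n - 2, 0, by omega, fun z => ⟨fun hz => ?_, ?_⟩⟩
      · have := h.lt _ _ hz
        have := h.nc 0 b0 z (n - 1) hb3 (h.symm _ _ hz)
        omega
      · rintro (rfl | rfl) <;> assumption
  have hD' : ∀ i, i ∈ D ↔ (i ∈ X ∩ Y) ∨ (i = 0 ∧ b0 = 1) ∨ (i = n - 1 ∧ b0 + 2 = n) := by
    intro i
    rw [hD, Finset.mem_inter, hX, hY]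
    rcases Nat.eq_zero_or_pos i with rfl | hi0
    · rw [h0]; omega
    by_cases hil : i = n - 1
    · rw [hil, hl]; omega
    by_cases hin : i < n
    · rw [hIntDeg i hi0 (by omega)]; omega
    · omega
  have h0n : 0 ∉ X ∩ Y := by
    rw [Finset.mem_inter, hX]; omega
  have hln : n - 1 ∉ X ∩ Y := by
    rw [Finset.mem_inter, hX]; omega
  by_cases c1 : b0 = 1
  · have e1 : D = insert 0 (X ∩ Y) := by
      ext i; rw [hD', Finset.mem_insert]
      have : b0 + 2 ≠ n := by omega
      tauto
    have e2 : I = N := by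
      ext i; rw [hI, hN]
      constructor
      · tauto
      · rintro ⟨g1, g2, g3, g4⟩
        refine ⟨g1, g2, g3, g4, ?_⟩
        rintro ⟨g5, g6⟩
        have := huniq i g1 g2 g5 g6
        omega
    rw [e1, e2, Finset.card_insert_of_notMem h0n]
    omega
  by_cases c2 : b0 + 2 = n
  · have e1 : D = insert (n - 1) (X ∩ Y) := by
      ext i; rw [hD', Finset.mem_insert]
      tauto
    have e2 : I = N := by
      ext i; rw [hI, hN]
      constructor
      · tauto
      · rintro ⟨g1, g2, g3, g4⟩
        refine ⟨g1, g2, g3, g4, ?_⟩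
        rintro ⟨g5, g6⟩
        have := huniq i g1 g2 g5 g6
        omega
    rw [e1, e2, Finset.card_insert_of_notMem hln]
    omega
  have e1 : D = X ∩ Y := by
    ext i; rw [hD']
    tauto
  have e2 : N = insert b0 I := by
    ext i; rw [hN, Finset.mem_insert, hI]
    constructor
    · rintro ⟨g1, g2, g3, g4⟩
      by_cases g : lo i = 0 ∧ hi i + 1 = n
      · exact Or.inl (huniq i g1 g2 g.1 g.2)
      · exact Or.inr ⟨g1, g2, g3, g4, g⟩
    · rintro (rfl | ⟨g1, g2, g3, g4, _⟩)
      · omega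
      · exact ⟨g1, g2, g3, g4⟩
  have hb0 : b0 ∉ I := by
    rw [hI]; omega
  rw [e2, Finset.card_insert_of_notMem hb0] at hNc
  rw [e1]
  omega

/-- A Hamiltonian cycle does not use an edge whose ends separate the graph. -/
lemma chord_not_mem {V : Type*} [Fintype V] [DecidableEq V] {G : SimpleGraph V} {x u v : V}
    (p : G.Walk x x) (hp : p.IsHamiltonianCycle) (S : Set V) (s t : V) (hs : s ∈ S) (hsu : s ≠ u)
    (hsv : s ≠ v) (ht : t ∉ S)
    (htu : t ≠ u) (htv : t ≠ v) (hS : ∀ a ∈ S, ∀ b, b ∉ S → G.Adj a b →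
      (a = u ∨ a = v) ∨ (b = u ∨ b = v)) : s(u, v) ∉ p.edges := by
  intro hmem
  have hu : u ∈ p.support := hp.mem_support u
  let q := p.rotate u hu
  have hq : q.IsHamiltonianCycle := (SimpleGraph.Walk.isHamiltonianCycle_rotate hu).2 hp
  have hmq : s(u, v) ∈ q.edges := ((p.rotate_edges u hu).mem_iff).2 hmem
  rw [← SimpleGraph.Walk.adj_toSubgraph_iff_mem_edges, SimpleGraph.Walk.toSubgraph_adj_iff] at hmq
  obtain ⟨i, hi, hil⟩ := hmq
  have hinj := hq.isCycle.getVert_injOn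
  have h0 : q.getVert 0 = u := q.getVert_zero
  have hl : q.getVert q.length = u := q.getVert_length
  have h3 := hq.isCycle.three_le_length
  have hvis : ∀ w, ∃ j, 1 ≤ j ∧ j ≤ q.length ∧ q.getVert j = w := by
    intro w
    obtain ⟨j, hj, hjl⟩ := SimpleGraph.Walk.mem_support_iff_exists_getVert.1 (hq.mem_support w)
    rcases Nat.eq_zero_or_pos j with rfl | hj0
    · exact ⟨q.length, by omega, le_rfl, by rw [hl, ← hj, h0]⟩
    · exact ⟨j, hj0, hjl, hj⟩
  have huniq : ∀ j k, 1 ≤ j → j ≤ q.length → 1 ≤ k → k ≤ q.length → q.getVert j = q.getVert k → j = k :=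
    fun j k h1 h2 h3 h4 e => hinj ⟨h1, h2⟩ ⟨h3, h4⟩ e
  obtain ⟨m, hm1, hml, hmv, hcase⟩ : ∃ m, 1 ≤ m ∧ m < q.length ∧ q.getVert m = v ∧
      (m = 1 ∨ m + 1 = q.length) := by
    rcases Sym2.eq_iff.1 hi with ⟨e1, e2⟩ | ⟨e1, e2⟩
    · rcases Nat.eq_zero_or_pos i with rfl | hi0
      · exact ⟨1, le_rfl, by omega, e2, Or.inl rfl⟩
      · have := huniq i q.length hi0 (by omega) (by omega) le_rfl (by rw [e1, hl])
        omega
    · have := huniq (i + 1) q.length (by omega) (by omega) (by omega) le_rfl (by rw [e2, hl])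
      exact ⟨i, by omega, hil, e1, Or.inr this⟩
  obtain ⟨js, js1, js2, rfl⟩ := hvis s
  obtain ⟨jt, jt1, jt2, rfl⟩ := hvis t
  -- membership in `S` is constant away from `u`, `v`
  have hne : ∀ j, 1 ≤ j → j < q.length → j ≠ m → q.getVert j ≠ u ∧ q.getVert j ≠ v := by
    intro j g1 g2 g3
    constructor
    · intro e
      have := huniq j q.length g1 (by omega) (by omega) le_rfl (by rw [e, hl])
      omega
    · intro e
      exact g3 (huniq j m g1 (by omega) hm1 (by omega) (by rw [e, hmv]))
  have step : ∀ j, 1 ≤ j → j + 1 < q.length → j ≠ m → j + 1 ≠ m →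
      (q.getVert j ∈ S ↔ q.getVert (j + 1) ∈ S) := by
    intro j g1 g2 g3 g4
    have a := q.adj_getVert_succ (i := j) (by omega)
    have n1 := hne j g1 (by omega) g3
    have n2 := hne (j + 1) (by omega) g2 g4
    constructor
    · intro h
      by_contra hc
      have := hS _ h _ hc a
      tauto
    · intro h
      by_contra hc
      have := hS _ h _ hc a.symm
      tauto
  have const : ∀ j k, j ≤ k → 1 ≤ j → k < q.length → j ≠ m → k ≠ m →
      (q.getVert j ∈ S ↔ q.getVert k ∈ S) := by
    intro j k hjk
    induction k, hjk using Nat.le_induction with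
    | base => intros; rfl
    | succ k hk ih =>
      intro g1 g2 g3 g4
      rw [ih g1 (by omega) g3 (by omega)]
      exact step k (by omega) g2 (by omega) g4
  have b1 : js ≠ q.length := by rintro rfl; exact hsu hl
  have b2 : jt ≠ q.length := by rintro rfl; exact htu hl
  have b3 : js ≠ m := by rintro rfl; exact hsv hmv
  have b4 : jt ≠ m := by rintro rfl; exact htv hmv
  rcases le_total js jt with hle | hle
  · exact ht ((const js jt hle js1 (by omega) b3 b4).1 hs)
  · exact ht ((const jt js hle jt1 (by omega) b4 b3).2 hs)

lemma exists_ham {V : Type*} [Fintype V] [DecidableEq V] {G : SimpleGraph V} (n : ℕ) (hn : 3 ≤ n)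
    (f : ℕ → V) (hf : ∀ i j, i < n → j < n → f i = f j → i = j) (hs : ∀ v, ∃ i, i < n ∧ f i = v)
    (h1 : ∀ i, i + 1 < n → G.Adj (f i) (f (i + 1))) (h2 : G.Adj (f (n - 1)) (f 0)) :
    ∃ (x : V) (p : G.Walk x x), p.IsHamiltonianCycle ∧ s(f (n - 1), f 0) ∈ p.edges ∧
      ∀ i, i + 1 < n → s(f i, f (i + 1)) ∈ p.edges := by
  have key : ∀ k, k < n → ∃ w : G.Walk (f 0) (f k), w.support = (List.range (k + 1)).map f ∧
      w.edges = (List.range k).map (fun i => s(f i, f (i + 1))) := by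
    intro k
    induction k with
    | zero => intro _; exact ⟨SimpleGraph.Walk.nil, by simp, by simp⟩
    | succ k ih =>
      intro hk
      obtain ⟨w, w1, w2⟩ := ih (by omega)
      refine ⟨w.concat (h1 k hk), ?_, ?_⟩
      · rw [SimpleGraph.Walk.support_concat, w1, List.range_succ (n := k + 1)]
        simp
      · rw [SimpleGraph.Walk.edges_concat, w2, List.range_succ (n := k)]
        simp
  obtain ⟨w, w1, w2⟩ := key (n - 1) (by omega)
  rw [Nat.sub_add_cancel (by omega)] at w1
  have hpath : w.IsPath := by
    apply SimpleGraph.Walk.IsPath.mk'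
    rw [w1]
    apply List.Nodup.map_on _ List.nodup_range
    intro i hi j hj e
    exact hf i j (List.mem_range.1 hi) (List.mem_range.1 hj) e
  have hham : w.IsHamiltonian := by
    apply hpath.isHamiltonian_of_mem
    intro v
    obtain ⟨i, hi, rfl⟩ := hs v
    rw [w1]
    exact List.mem_map.2 ⟨i, List.mem_range.2 hi, rfl⟩
  refine ⟨_, SimpleGraph.Walk.cons h2 w, ?_, by simp, ?_⟩
  · refine ⟨?_, ?_⟩
    · rw [SimpleGraph.Walk.cons_isCycle_iff]
      refine ⟨hpath, ?_⟩
      rw [w2]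
      intro hmem
      obtain ⟨i, hi, e⟩ := List.mem_map.1 hmem
      rw [List.mem_range] at hi
      rcases Sym2.eq_iff.1 e with ⟨e1, e2⟩ | ⟨e1, e2⟩
      · have := hf _ _ (by omega) (by omega) e1
        omega
      · have := hf _ _ (by omega) (by omega) e1
        have := hf _ _ (by omega) (by omega) e2
        omega
    · simpa [SimpleGraph.Walk.IsHamiltonian] using hham
  · intro i hi
    rw [SimpleGraph.Walk.edges_cons, w2]
    exact List.mem_cons_of_mem _ (List.mem_map.2 ⟨i, List.mem_range.2 (by omega), rfl⟩)

lemma rank_layout {V : Type*} [Fintype V] {G : SimpleGraph V} {pos : V → ℕ}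
    (hi : Function.Injective pos) (h : NC G pos) :
    ∃ rk : V → ℕ, Function.Injective rk ∧ NC G rk ∧ ∀ v, rk v < Fintype.card V := by
  classical
  let rk : V → ℕ := fun v => (Finset.univ.filter (fun w => pos w < pos v)).card
  have hlt : ∀ a b, pos a < pos b → rk a < rk b := by
    intro a b hab
    apply Finset.card_lt_card
    rw [Finset.ssubset_iff_of_subset]
    · exact ⟨a, by simpa using hab, by simp⟩
    · intro w hw
      simp only [Finset.mem_filter, Finset.mem_univ, true_and] at hw ⊢
      omega
  have hlt' : ∀ a b, rk a < rk b → pos a < pos b := by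
    intro a b hab
    by_contra hc
    rcases Nat.lt_or_ge (pos b) (pos a) with h1 | h1
    · have := hlt b a h1
      omega
    · have : a = b := hi (by omega)
      subst this
      omega
  refine ⟨rk, ?_, ?_, ?_⟩
  · intro a b hab
    by_contra hne
    rcases Nat.lt_or_gt_of_ne (fun e => hne (hi e)) with h1 | h1
    · have := hlt a b h1
      omega
    · have := hlt b a h1
      omega
  · rintro a b c d hab hcd ⟨h1, h2, h3⟩
    exact h a b c d hab hcd ⟨hlt' _ _ h1, hlt' _ _ h2, hlt' _ _ h3⟩
  · intro v
    rw [← Finset.card_univ]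
    apply Finset.card_lt_card
    rw [Finset.ssubset_iff_of_subset (Finset.subset_univ _)]
    exact ⟨v, by simp, by simp⟩

lemma crossing_of_maximal {V : Type*} {G : SimpleGraph V} (h : MaximalOuterplanar G) {pos : V → ℕ}
    (hi : Function.Injective pos) (hnc : NC G pos) {u v : V} (huv : pos u < pos v)
    (hna : ¬ G.Adj u v) : ∃ p q, G.Adj p q ∧ pos u < pos p ∧ pos p < pos v ∧
      (pos q < pos u ∨ pos v < pos q) := by
  by_contra hcon
  push Not at hcon
  refine h.2 u v (by rintro rfl; omega) hna (nc_outerplanar hi ?_)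
  have new : ∀ a b, (G ⊔ SimpleGraph.fromEdgeSet {s(u, v)}).Adj a b → G.Adj a b ∨
      (pos a = pos u ∧ pos b = pos v) ∨ (pos a = pos v ∧ pos b = pos u) := by
    intro a b hab
    rcases hab with hab | hab
    · exact Or.inl hab
    · right
      rw [SimpleGraph.fromEdgeSet_adj] at hab
      rcases Sym2.eq_iff.1 hab.1 with ⟨rfl, rfl⟩ | ⟨rfl, rfl⟩
      · exact Or.inl ⟨rfl, rfl⟩
      · exact Or.inr ⟨rfl, rfl⟩
  intro a b c d hab hcd
  rcases new a b hab with hab | hab <;> rcases new c d hcd with hcd | hcd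
  · exact hnc a b c d hab hcd
  · have := hcon b a hab.symm
    omega
  · have := hcon c d hcd
    omega
  · omega

/-- Boundary edges versus chords, for an edge `u v` with `pos u < pos v`. -/
lemma notHam_iff {V : Type*} [Fintype V] [DecidableEq V] (G : SimpleGraph V)
    (pos : V → ℕ) (f : ℕ → V) (hi : Function.Injective pos) (hnc : NC G pos)
    (hlt : ∀ v, pos v < Fintype.card V)
    (hpf : ∀ i, i < Fintype.card V → pos (f i) = i) (hfp : ∀ v, f (pos v) = v)
    (hn : 4 ≤ Fintype.card V)
    (h1 : ∀ i, i + 1 < Fintype.card V → G.Adj (f i) (f (i + 1)))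
    (h2 : G.Adj (f 0) (f (Fintype.card V - 1)))
    (u v : V) (huv : pos u < pos v) (ha : G.Adj u v) :
    (∀ (x : V) (p : G.Walk x x), p.IsHamiltonianCycle → s(u, v) ∉ p.edges) ↔
      ¬ (pos u + 1 = pos v ∨ (pos u = 0 ∧ pos v + 1 = Fintype.card V)) := by
  have hlu := hlt u
  have hlv := hlt v
  constructor
  · intro hh hb
    obtain ⟨x, p, hp, e1, e2⟩ := exists_ham (G := G) (Fintype.card V) (by omega) f
      (fun i j hi' hj' e => by rw [← hpf i hi', ← hpf j hj', e])
      (fun w => ⟨pos w, hlt w, hfp w⟩) h1 h2.symm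
    rcases hb with hb | ⟨hb1, hb2⟩
    · have := e2 (pos u) (by omega)
      rw [hb, hfp, hfp] at this
      exact hh x p hp this
    · have e3 : Fintype.card V - 1 = pos v := by omega
      rw [e3, hfp, ← hb1, hfp, Sym2.eq_swap] at e1
      exact hh x p hp e1
  · intro hb x p hp
    push Not at hb
    obtain ⟨hb1, hb2⟩ := hb
    have hs : pos (f (pos u + 1)) = pos u + 1 := hpf _ (by omega)
    obtain ⟨t, ht⟩ : ∃ t, pos t < pos u ∨ pos v < pos t := by
      by_cases h0 : pos u = 0
      · refine ⟨f (Fintype.card V - 1), Or.inr ?_⟩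
        rw [hpf _ (by omega)]
        have := hb2 h0
        omega
      · refine ⟨f 0, Or.inl ?_⟩
        rw [hpf _ (by omega)]
        omega
    refine chord_not_mem p hp {w | pos u < pos w ∧ pos w < pos v} (f (pos u + 1)) t
      ?_ ?_ ?_ ?_ ?_ ?_ ?_
    · simp only [Set.mem_setOf_eq, hs]; omega
    · intro e; rw [e] at hs; omega
    · intro e; rw [e] at hs; omega
    · simp only [Set.mem_setOf_eq]; omega
    · rintro rfl; omega
    · rintro rfl; omega
    · intro a has b hbs hab
      simp only [Set.mem_setOf_eq] at has hbs
      by_contra hcon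
      push Not at hcon
      have q1 : pos b ≠ pos u := fun e => hcon.2.1 (hi e)
      have q2 : pos b ≠ pos v := fun e => hcon.2.2 (hi e)
      have r1 := hnc u v a b ha hab
      have r2 := hnc b a u v hab.symm ha
      omega

/-- A maximal outerplanar graph on `n ≥ 4` vertices with exactly
`k` internal triangles has exactly `k + 2` vertices of degree 2. -/
theorem card_degree_two_of_internalTriangles {V : Type*} [Fintype V] [DecidableEq V]
    (G : SimpleGraph V) [DecidableRel G.Adj] (h : MaximalOuterplanar G)
    (hn : 4 ≤ Fintype.card V) (k : ℕ)
    (hk : {T : Finset V | IsInternalTriangle G T}.ncard = k) :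
    (Finset.univ.filter fun v => G.degree v = 2).card = k + 2 := by
  classical
  obtain ⟨pos0, hi0, hnc0⟩ := exists_layout (Fintype.card V) V rfl G h.1
  obtain ⟨pos, hi, hnc, hlt⟩ := rank_layout hi0 hnc0
  have hbij : Function.Bijective (fun v : V => (⟨pos v, hlt v⟩ : Fin (Fintype.card V))) := by
    rw [Fintype.bijective_iff_injective_and_card]
    refine ⟨fun a b e => hi (by simpa using e), by simp⟩
  have hex : ∀ i, ∃ v : V, i < Fintype.card V → pos v = i := by
    intro i
    by_cases hin : i < Fintype.card V
    · obtain ⟨v, hv⟩ := hbij.2 ⟨i, hin⟩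
      exact ⟨v, fun _ => by simpa using hv⟩
    · obtain ⟨v, -⟩ := hbij.2 ⟨0, by omega⟩
      exact ⟨v, fun hc => absurd hc hin⟩
  choose f hpf using hex
  have hfp : ∀ v, f (pos v) = v := fun v => hi (hpf _ (hlt v))
  obtain ⟨A, hA⟩ : ∃ A : ℕ → ℕ → Prop, ∀ i j, A i j ↔
      i < Fintype.card V ∧ j < Fintype.card V ∧ G.Adj (f i) (f j) := ⟨_, fun _ _ => Iff.rfl⟩
  have hAp : ∀ u v, A (pos u) (pos v) ↔ G.Adj u v := by
    intro u v
    rw [hA, hfp, hfp]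
    exact ⟨fun q => q.2.2, fun q => ⟨hlt u, hlt v, q⟩⟩
  have hmax : ∀ u v, u < v → v < Fintype.card V → ¬ A u v →
      ∃ p q, A p q ∧ u < p ∧ p < v ∧ (q < u ∨ v < q) := by
    intro u v huv hv hna
    have e1 := hpf u (by omega)
    have e2 := hpf v hv
    obtain ⟨p, q, hpq, x1, x2, x3⟩ := crossing_of_maximal (u := f u) (v := f v) h hi hnc
      (by omega) (fun q => hna ((hA u v).2 ⟨by omega, hv, q⟩))
    rw [e1] at x1 x3
    rw [e2] at x2 x3
    exact ⟨pos p, pos q, (hAp p q).2 hpq, x1, x2, x3⟩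
  have hM : MaxNC (Fintype.card V) A := by
    refine ⟨hn, ?_, ?_, ?_, ?_, ?_, hmax⟩
    · intro i j q
      rw [hA] at q ⊢
      exact ⟨q.2.1, q.1, q.2.2.symm⟩
    · intro i j q
      rw [hA] at q
      refine ⟨q.1, q.2.1, ?_⟩
      rintro rfl
      exact G.loopless.irrefl _ q.2.2
    · intro i hi'
      by_contra hc
      obtain ⟨p, q, -, x1, x2, -⟩ := hmax i (i + 1) (by omega) hi' hc
      omega
    · by_contra hc
      obtain ⟨p, q, x0, x1, x2, x3⟩ := hmax 0 _ (by omega) (by omega) hc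
      have := ((hA p q).1 x0).2.1
      omega
    · intro a b c d q1 q2
      rw [hA] at q1 q2
      have := hnc (f a) (f b) (f c) (f d) q1.2.2 q2.2.2
      rwa [hpf a q1.1, hpf b q1.2.1, hpf c q2.1, hpf d q2.2.1] at this
  obtain ⟨lo, hgh, H⟩ := hM.exists_lohi
  have hcount := hM.count H ((Finset.univ.filter fun v => G.degree v = 2).image pos)
    ((Finset.range (Fintype.card V)).filter fun b => 0 < b ∧ b + 1 < Fintype.card V ∧
      lo b + 1 ≠ b ∧ b + 1 ≠ hgh b ∧ ¬ (lo b = 0 ∧ hgh b + 1 = Fintype.card V))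
    (by
      have hdeg : ∀ v, G.degree v = 2 ↔ Deg2 A (pos v) := by
        intro v
        rw [← G.card_neighborFinset_eq_degree, Finset.card_eq_two]
        constructor
        · rintro ⟨x, y, hxy, e⟩
          refine ⟨pos x, pos y, fun q => hxy (hi q), fun z => ?_⟩
          have key : ∀ w, G.Adj v w ↔ w = x ∨ w = y := by
            intro w
            rw [← G.mem_neighborFinset, e]; simp
          constructor
          · intro q
            have hz := ((hA _ _).1 q).2.1
            rw [← hpf z hz, hAp, key] at q
            rcases q with q | q
            · left; rw [← q, hpf z hz]
            · right; rw [← q, hpf z hz]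
          · rintro (rfl | rfl)
            · exact (hAp _ _).2 ((key _).2 (Or.inl rfl))
            · exact (hAp _ _).2 ((key _).2 (Or.inr rfl))
        · rintro ⟨x, y, hxy, e⟩
          have hx := ((hA _ _).1 ((e x).2 (Or.inl rfl))).2.1
          have hy := ((hA _ _).1 ((e y).2 (Or.inr rfl))).2.1
          refine ⟨f x, f y, fun q => hxy (by rw [← hpf x hx, ← hpf y hy, q]), ?_⟩
          ext w
          rw [G.mem_neighborFinset, ← hAp, e]
          simp only [Finset.mem_insert, Finset.mem_singleton]
          constructor
          · rintro (q | q)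
            · left; rw [← q, hfp]
            · right; rw [← q, hfp]
          · rintro (q | q)
            · left; rw [q, hpf x hx]
            · right; rw [q, hpf y hy]
      intro i
      simp only [Finset.mem_image, Finset.mem_filter, Finset.mem_univ, true_and]
      constructor
      · rintro ⟨v, hv, rfl⟩
        exact ⟨hlt v, (hdeg v).1 hv⟩
      · rintro ⟨q1, q2⟩
        refine ⟨f i, (hdeg _).2 ?_, hpf i q1⟩
        rwa [hpf i q1])
    (by
      intro b
      simp only [Finset.mem_filter, Finset.mem_range]
      constructor
      · exact fun q => q.2
      · exact fun q => ⟨by omega, q⟩)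
  rw [Finset.card_image_of_injective _ hi] at hcount
  rw [hcount, ← hk]
  congr 1
  generalize hI : ((Finset.range (Fintype.card V)).filter fun b => 0 < b ∧
      b + 1 < Fintype.card V ∧ lo b + 1 ≠ b ∧ b + 1 ≠ hgh b ∧
      ¬ (lo b = 0 ∧ hgh b + 1 = Fintype.card V)) = I
  have hmI : ∀ b, b ∈ I ↔ 0 < b ∧ b + 1 < Fintype.card V ∧ lo b + 1 ≠ b ∧ b + 1 ≠ hgh b ∧
      ¬ (lo b = 0 ∧ hgh b + 1 = Fintype.card V) := by
    intro b
    rw [← hI, Finset.mem_filter, Finset.mem_range]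
    exact ⟨fun q => q.2, fun q => ⟨by omega, q⟩⟩
  have hff : ∀ i j, i < Fintype.card V → j < Fintype.card V → f i = f j → i = j := by
    intro i j q1 q2 e
    rw [← hpf i q1, ← hpf j q2, e]
  have hNH := notHam_iff G pos f hi hnc hlt hpf hfp hn
    (fun i q => ((hA _ _).1 (hM.succ i q)).2.2) ((hA _ _).1 hM.last).2.2
  have hsorted : ∀ a b c : V, pos a < pos b → pos b < pos c → G.Adj a b → G.Adj a c →
      G.Adj b c → (∀ (x : V) (p : G.Walk x x), p.IsHamiltonianCycle → s(a, b) ∉ p.edges) →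
      (∀ (x : V) (p : G.Walk x x), p.IsHamiltonianCycle → s(a, c) ∉ p.edges) →
      (∀ (x : V) (p : G.Walk x x), p.IsHamiltonianCycle → s(b, c) ∉ p.edges) →
      ∃ i ∈ I, ({f (lo i), f i, f (hgh i)} : Finset V) = {a, b, c} := by
    intro a b c q1 q2 hab hac hbc n1 n2 n3
    rw [hNH a b q1 hab] at n1
    rw [hNH a c (by omega) hac] at n2
    rw [hNH b c q2 hbc] at n3
    obtain ⟨t1, t2, t3, t4⟩ := hM.tri H q1 q2 ((hAp _ _).2 hab) ((hAp _ _).2 hbc)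
      ((hAp _ _).2 hac)
    refine ⟨pos b, (hmI _).2 ?_, ?_⟩
    · rw [← t3, ← t4]; omega
    · rw [← t3, ← t4, hfp, hfp, hfp]
  have himg : {T : Finset V | IsInternalTriangle G T} =
      Set.image (fun b => ({f (lo b), f b, f (hgh b)} : Finset V)) (I : Set ℕ) := by
    ext T
    simp only [Set.mem_setOf_eq, Set.mem_image, Finset.mem_coe]
    constructor
    · rintro ⟨a, b, c, rfl, nab, nac, nbc, hab, hac, hbc, hh⟩
      have n1 : ∀ (x : V) (p : G.Walk x x), p.IsHamiltonianCycle → s(a, b) ∉ p.edges :=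
        fun x p hp => (hh p hp).1
      have n2 : ∀ (x : V) (p : G.Walk x x), p.IsHamiltonianCycle → s(a, c) ∉ p.edges :=
        fun x p hp => (hh p hp).2.1
      have n3 : ∀ (x : V) (p : G.Walk x x), p.IsHamiltonianCycle → s(b, c) ∉ p.edges :=
        fun x p hp => (hh p hp).2.2
      have m1 : ∀ (x : V) (p : G.Walk x x), p.IsHamiltonianCycle → s(b, a) ∉ p.edges := by
        rw [Sym2.eq_swap]; exact n1
      have m2 : ∀ (x : V) (p : G.Walk x x), p.IsHamiltonianCycle → s(c, a) ∉ p.edges := by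
        rw [Sym2.eq_swap]; exact n2
      have m3 : ∀ (x : V) (p : G.Walk x x), p.IsHamiltonianCycle → s(c, b) ∉ p.edges := by
        rw [Sym2.eq_swap]; exact n3
      have p1 : pos a ≠ pos b := fun e => nab (hi e)
      have p2 : pos a ≠ pos c := fun e => nac (hi e)
      have p3 : pos b ≠ pos c := fun e => nbc (hi e)
      have e1 : ({a, c, b} : Finset V) = {a, b, c} := by ext; simp; tauto
      have e2 : ({b, a, c} : Finset V) = {a, b, c} := by ext; simp; tauto
      have e3 : ({b, c, a} : Finset V) = {a, b, c} := by ext; simp; tauto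
      have e4 : ({c, a, b} : Finset V) = {a, b, c} := by ext; simp; tauto
      have e5 : ({c, b, a} : Finset V) = {a, b, c} := by ext; simp; tauto
      rcases lt_or_gt_of_ne p1 with o1 | o1 <;> rcases lt_or_gt_of_ne p2 with o2 | o2 <;>
        rcases lt_or_gt_of_ne p3 with o3 | o3
      · exact hsorted a b c o1 o3 hab hac hbc n1 n2 n3
      · rw [← e1]; exact hsorted a c b o2 o3 hac hab hbc.symm n2 n1 m3
      · omega
      · rw [← e4]; exact hsorted c a b o2 o1 hac.symm hbc.symm hab m2 m3 n1
      · rw [← e2]; exact hsorted b a c o1 o2 hab.symm hbc hac m1 n3 n2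
      · omega
      · rw [← e3]; exact hsorted b c a o3 o2 hbc hab.symm hac.symm n3 m1 m2
      · rw [← e5]; exact hsorted c b a o3 o1 hbc.symm hac.symm hab.symm m3 m2 m1
    · rintro ⟨b, hb, rfl⟩
      rw [hmI] at hb
      obtain ⟨b1, b2, b3, b4, b5⟩ := hb
      obtain ⟨c1, c2, c3, c4, c5, c6, -⟩ := H b b1 b2
      have g1 := ((hA _ _).1 c4).2.2.symm
      have g2 := ((hA _ _).1 c5).2.2
      have g3 := ((hA _ _).1 c6).2.2
      have r1 := hpf (lo b) (by omega)
      have r2 := hpf b (by omega)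
      have r3 := hpf (hgh b) (by omega)
      have k1 := (hNH _ _ (by omega) g1).2 (by omega)
      have k2 := (hNH _ _ (by omega) g2).2 (by omega)
      have k3 := (hNH _ _ (by omega) g3).2 (by omega)
      exact ⟨f (lo b), f b, f (hgh b), rfl, g1.ne, g3.ne, g2.ne, g1, g3, g2,
        fun x p hp => ⟨k1 x p hp, k3 x p hp, k2 x p hp⟩⟩
  rw [himg, Set.ncard_image_of_injOn, Set.ncard_coe_finset]
  intro b hb b' hb' e
  simp only [Finset.mem_coe, hmI] at hb hb'
  have s1 := H b hb.1 hb.2.1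
  have s2 := H b' hb'.1 hb'.2.1
  simp only at e
  have mem : ∀ i, i < Fintype.card V → ((i = lo b ∨ i = b ∨ i = hgh b) ↔
      (i = lo b' ∨ i = b' ∨ i = hgh b')) := by
    have conv : ∀ c, lo c < Fintype.card V → c < Fintype.card V → hgh c < Fintype.card V →
        ∀ i, i < Fintype.card V → ((i = lo c ∨ i = c ∨ i = hgh c) ↔
        f i ∈ ({f (lo c), f c, f (hgh c)} : Finset V)) := by
      intro c w1 w2 w3 i w4
      simp only [Finset.mem_insert, Finset.mem_singleton]
      constructor
      · rintro (q | q | q) <;> rw [← q] <;> simp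
      · rintro (q | q | q)
        · exact Or.inl (hff _ _ w4 w1 q)
        · exact Or.inr (Or.inl (hff _ _ w4 w2 q))
        · exact Or.inr (Or.inr (hff _ _ w4 w3 q))
    intro i hin
    rw [conv b (by omega) (by omega) (by omega) i hin, e,
      ← conv b' (by omega) (by omega) (by omega) i hin]
  have u1 := mem (lo b) (by omega)
  have u2 := mem b (by omega)
  have u3 := mem (hgh b) (by omega)
  omega
end

section
/- If G is a maximal outerplanar graph on n ≥ 4 vertices, then the set of vertices of degree 2 in G is an independent set of size at most n/2. -/
open SimpleGraph

/-- Cut formulation of connectedness of a vertex set. -/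
def CutConn {V : Type*} (G : SimpleGraph V) (T : Set V) : Prop :=
  T.Nonempty ∧ ∀ A : Set V, (∃ x ∈ T, x ∈ A) → (∃ y ∈ T, y ∉ A) →
    ∃ a ∈ T, ∃ b ∈ T, a ∈ A ∧ b ∉ A ∧ G.Adj a b

/-- No two edges cross in the cyclic order given by the list. -/
def NonCross {V : Type*} (G : SimpleGraph V) (l : List V) : Prop :=
  ∀ a b c d, List.Sublist [a, b, c, d] l → ¬ (G.Adj a c ∧ G.Adj b d)

theorem cutConn_of_connected {V : Type*} {G : SimpleGraph V} {T : Set V}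
    (h : (G.induce T).Connected) : CutConn G T := by
  obtain ⟨⟨x0, hx0⟩⟩ := h.nonempty
  refine ⟨⟨x0, hx0⟩, ?_⟩
  rintro A ⟨x, hx, hxA⟩ ⟨y, hy, hyA⟩
  obtain ⟨p⟩ := h.preconnected ⟨x, hx⟩ ⟨y, hy⟩
  obtain ⟨d, -, h1, h2⟩ := p.exists_boundary_dart {v | v.1 ∈ A} hxA hyA
  exact ⟨d.fst.1, d.fst.2, d.snd.1, d.snd.2, h1, h2, d.adj⟩

theorem connected_of_cutConn {V : Type*} {G : SimpleGraph V} {T : Set V}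
    (h : CutConn G T) : (G.induce T).Connected := by
  obtain ⟨⟨x, hx⟩, h⟩ := h
  rw [connected_iff_exists_forall_reachable]
  refine ⟨⟨x, hx⟩, ?_⟩
  rintro ⟨w, hw⟩
  by_contra hc
  obtain ⟨a, ha, b, hb, ⟨_, h1⟩, h2, h3⟩ := h {v | ∃ h : v ∈ T, (G.induce T).Reachable ⟨x, hx⟩ ⟨v, h⟩}
    ⟨x, hx, hx, Reachable.refl _⟩ ⟨w, hw, fun ⟨_, h⟩ => hc h⟩
  refine h2 ⟨hb, h1.trans (Adj.reachable ?_)⟩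
  simpa using h3

theorem cutConn_singleton {V : Type*} {G : SimpleGraph V} (a : V) : CutConn G {a} := by
  refine ⟨⟨a, rfl⟩, ?_⟩
  rintro A ⟨x, rfl, hx⟩ ⟨y, rfl, hy⟩
  exact absurd hx hy

theorem cutConn_union {V : Type*} {G : SimpleGraph V} {S T : Set V} (hS : CutConn G S)
    (hT : CutConn G T) {s t : V} (hs : s ∈ S) (ht : t ∈ T) (hst : G.Adj s t) :
    CutConn G (S ∪ T) := by
  refine ⟨⟨s, Or.inl hs⟩, ?_⟩
  rintro A ⟨x, hx, hxA⟩ ⟨y, hy, hyA⟩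
  by_cases h1 : ∃ x ∈ S, x ∈ A
  · by_cases h2 : ∃ x ∈ S, x ∉ A
    · obtain ⟨a, ha, b, hb, h⟩ := hS.2 A h1 h2
      exact ⟨a, Or.inl ha, b, Or.inl hb, h⟩
    · by_cases h3 : ∃ x ∈ T, x ∈ A
      · by_cases h4 : ∃ x ∈ T, x ∉ A
        · obtain ⟨a, ha, b, hb, h⟩ := hT.2 A h3 h4
          exact ⟨a, Or.inr ha, b, Or.inr hb, h⟩
        · push Not at h2 h4
          exact absurd (hy.elim (h2 y) (h4 y)) hyA
      · push Not at h2 h3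
        exact ⟨s, Or.inl hs, t, Or.inr ht, h2 s hs, h3 t ht, hst⟩
  · by_cases h3 : ∃ x ∈ T, x ∈ A
    · by_cases h4 : ∃ x ∈ T, x ∉ A
      · obtain ⟨a, ha, b, hb, h⟩ := hT.2 A h3 h4
        exact ⟨a, Or.inr ha, b, Or.inr hb, h⟩
      · push Not at h1 h4
        exact ⟨t, Or.inr ht, s, Or.inl hs, h4 t ht, h1 s hs, hst.symm⟩
    · push Not at h1 h3
      exact absurd hxA (hx.elim (h1 x) (h3 x))

theorem cutConn_list {V : Type*} {G : SimpleGraph V} (l : List V) (a : V)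
    (h : List.IsChain G.Adj (a :: l)) : CutConn G {x | x ∈ a :: l} := by
  induction l generalizing a with
  | nil => simpa using cutConn_singleton a
  | cons b t ih =>
    rw [List.isChain_cons_cons] at h
    have := cutConn_union (cutConn_singleton (G := G) a) (ih b h.2) (s := a) (t := b) rfl (by simp) h.1
    convert this using 1
    ext x
    simp

/-- Sets in an outerplanar-like drawing cannot cross. -/
theorem no_cross {V : Type*} {G : SimpleGraph V} {pos : V → ℕ} (hinj : Function.Injective pos)
    (hnc : ∀ a b c d, pos a < pos b → pos b < pos c → pos c < pos d → ¬ (G.Adj a c ∧ G.Adj b d))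
    {A B : Set V} (hA : CutConn G A) (hB : CutConn G B) (hd : Disjoint A B)
    {a b c d : V} (ha : a ∈ A) (hb : b ∈ B) (hc : c ∈ A) (hdd : d ∈ B)
    (h1 : pos a < pos b) (h2 : pos b < pos c) (h3 : pos c < pos d) : False := by
  have hne : ∀ x ∈ A, ∀ y ∈ B, pos x ≠ pos y := fun x hx y hy h => by
    have := hinj h
    subst this
    exact Set.disjoint_left.1 hd hx hy
  obtain ⟨e, he, f, hf, h4, h5, hef⟩ := hA.2 {v | pos b < pos v ∧ pos v < pos d}
    ⟨c, hc, h2, h3⟩ ⟨a, ha, fun h => by have := h.1; omega⟩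
  simp only [Set.mem_ofPred_eq] at h4 h5
  have n1 := hne f hf b hb
  have n2 := hne f hf d hdd
  by_cases h6 : pos f < pos b
  · obtain ⟨g, hg, k, hk, h7, h8, hgk⟩ := hB.2 {v | pos f < pos v ∧ pos v < pos e}
      ⟨b, hb, by simp only [Set.mem_ofPred_eq]; omega⟩ ⟨d, hdd, by simp only [Set.mem_ofPred_eq]; omega⟩
    simp only [Set.mem_ofPred_eq] at h7 h8
    have n3 := hne f hf k hk
    have n4 := hne e he k hk
    by_cases h9 : pos k < pos f
    · exact hnc k f g e h9 (by omega) (by omega) ⟨hgk.symm, hef.symm⟩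
    · exact hnc f g e k (by omega) (by omega) (by omega) ⟨hef.symm, hgk⟩
  · obtain ⟨g, hg, k, hk, h7, h8, hgk⟩ := hB.2 {v | pos e < pos v ∧ pos v < pos f}
      ⟨d, hdd, by simp only [Set.mem_ofPred_eq]; omega⟩ ⟨b, hb, by simp only [Set.mem_ofPred_eq]; omega⟩
    simp only [Set.mem_ofPred_eq] at h7 h8
    have n3 := hne f hf k hk
    have n4 := hne e he k hk
    by_cases h9 : pos k < pos e
    · exact hnc k e g f h9 (by omega) (by omega) ⟨hgk.symm, hef⟩
    · exact hnc e g f k (by omega) (by omega) (by omega) ⟨hef, hgk⟩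

theorem perm_four (p : Fin 4 → ℕ) (hp : Function.Injective p) :
    ∃ a b c d : Fin 4, p a < p b ∧ p b < p c ∧ p c < p d := by
  have h := Tuple.monotone_sort p
  have hs : StrictMono (p ∘ Tuple.sort p) :=
    h.strictMono_of_injective (hp.comp (Tuple.sort p).injective)
  exact ⟨_, _, _, _, hs (a := 0) (b := 1) (by decide), hs (a := 1) (b := 2) (by decide),
    hs (a := 2) (b := 3) (by decide)⟩

theorem outerplanar_of_pos {V : Type*} {G : SimpleGraph V} {pos : V → ℕ}
    (hinj : Function.Injective pos)
    (hnc : ∀ a b c d, pos a < pos b → pos b < pos c → pos c < pos d → ¬ (G.Adj a c ∧ G.Adj b d)) :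
    Outerplanar G := by
  constructor
  · rintro ⟨f, hne, hcon, hdis, hadj⟩
    choose r hr using hne
    have hne' : ∀ i j, i ≠ j → r i ≠ r j := fun i j hij h =>
      Set.disjoint_left.1 (hdis hij) (hr i) (h ▸ hr j)
    have hpi : Function.Injective (fun i => pos (r i)) := fun i j h => by
      by_contra hij
      exact hne' i j hij (hinj h)
    obtain ⟨a, b, c, d, h1, h2, h3⟩ := perm_four _ hpi
    have nab : a ≠ b := by rintro rfl; omega
    have nac : a ≠ c := by rintro rfl; omega
    have nad : a ≠ d := by rintro rfl; omega
    have nbc : b ≠ c := by rintro rfl; omega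
    have nbd : b ≠ d := by rintro rfl; omega
    have ncd : c ≠ d := by rintro rfl; omega
    have hu : ∀ i j, i ≠ j → CutConn G (f i ∪ f j) := fun i j hij => by
      obtain ⟨x, hx, y, hy, hxy⟩ := hadj (w₁ := i) (w₂ := j) (by simpa using hij)
      exact cutConn_union (cutConn_of_connected (hcon i)) (cutConn_of_connected (hcon j)) hx hy hxy
    refine no_cross hinj hnc (hu a c nac) (hu b d nbd) ?_ (Or.inl (hr a)) (Or.inl (hr b))
      (Or.inr (hr c)) (Or.inr (hr d)) h1 h2 h3
    simp only [Set.disjoint_union_left, Set.disjoint_union_right]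
    exact ⟨⟨hdis nab, hdis nbc.symm⟩, hdis nad, hdis ncd⟩
  · rintro ⟨f, hne, hcon, hdis, hadj⟩
    choose r hr using hne
    have hne' : ∀ i j, i ≠ j → pos (r i) ≠ pos (r j) := fun i j hij h =>
      Set.disjoint_left.1 (hdis hij) (hr i) (hinj h ▸ hr j)
    have hu : ∀ (i : Fin 2) (j : Fin 3), CutConn G (f (.inl i) ∪ f (.inr j)) := fun i j => by
      obtain ⟨x, hx, y, hy, hxy⟩ := hadj (w₁ := .inl i) (w₂ := .inr j) (by simp)
      exact cutConn_union (cutConn_of_connected (hcon _)) (cutConn_of_connected (hcon _)) hx hy hxy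
    have key : ∀ (i i' : Fin 2) (j j' : Fin 3), i ≠ i' → j ≠ j' → 
        ∀ a b c d, ((a = r (.inl i) ∧ c = r (.inr j)) ∨ (c = r (.inl i) ∧ a = r (.inr j))) →
        ((b = r (.inl i') ∧ d = r (.inr j')) ∨ (d = r (.inl i') ∧ b = r (.inr j'))) →
        pos a < pos b → pos b < pos c → pos c < pos d → False := by
      intro i i' j j' hi hj a b c d h1 h2 h3 h4 h5
      have hD : Disjoint (f (.inl i) ∪ f (.inr j)) (f (.inl i') ∪ f (.inr j')) := by
        simp only [Set.disjoint_union_left, Set.disjoint_union_right]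
        refine ⟨⟨hdis ?_, hdis ?_⟩, hdis ?_, hdis ?_⟩ <;> simp [hi, hj]
      have m1 := hr (.inl i)
      have m2 := hr (.inl i')
      have m3 := hr (.inr j)
      have m4 := hr (.inr j')
      refine no_cross hinj hnc (hu i j) (hu i' j') hD (a := a) (b := b) (c := c) (d := d)
        ?_ ?_ ?_ ?_ h3 h4 h5
      · rcases h1 with ⟨rfl, rfl⟩ | ⟨rfl, rfl⟩ <;> simp [m1, m3]
      · rcases h2 with ⟨rfl, rfl⟩ | ⟨rfl, rfl⟩ <;> simp [m2, m4]
      · rcases h1 with ⟨rfl, rfl⟩ | ⟨rfl, rfl⟩ <;> simp [m1, m3]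
      · rcases h2 with ⟨rfl, rfl⟩ | ⟨rfl, rfl⟩ <;> simp [m2, m4]
    -- wlog the first hub comes first
    obtain ⟨i, i', hii, hlt⟩ : ∃ i i' : Fin 2, i ≠ i' ∧ pos (r (.inl i)) < pos (r (.inl i')) := by
      rcases lt_or_gt_of_ne (hne' (.inl 0) (.inl 1) (by simp)) with h | h
      · exact ⟨0, 1, by decide, h⟩
      · exact ⟨1, 0, by decide, h⟩
    -- two leaves on the same side
    have hpair : ∃ j j' : Fin 3, j ≠ j' ∧
        ((pos (r (.inl i)) < pos (r (.inr j)) ∧ pos (r (.inr j)) < pos (r (.inl i'))) ↔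
        (pos (r (.inl i)) < pos (r (.inr j')) ∧ pos (r (.inr j')) < pos (r (.inl i')))) := by
      by_contra hcon
      push Not at hcon
      have h01 := hcon 0 1 (by decide)
      have h02 := hcon 0 2 (by decide)
      have h12 := hcon 1 2 (by decide)
      omega
    obtain ⟨j, j', hjj, hside⟩ : ∃ j j' : Fin 3, j ≠ j' ∧
        ((pos (r (.inl i)) < pos (r (.inr j)) ∧ pos (r (.inr j)) < pos (r (.inl i'))) ↔
        (pos (r (.inl i)) < pos (r (.inr j')) ∧ pos (r (.inr j')) < pos (r (.inl i')))) ∧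
        pos (r (.inr j)) < pos (r (.inr j')) := by
      obtain ⟨j, j', hjj, hside⟩ := hpair
      rcases lt_or_gt_of_ne (hne' (.inr j) (.inr j') (by simpa using hjj)) with h | h
      · exact ⟨j, j', hjj, hside, h⟩
      · exact ⟨j', j, hjj.symm, hside.symm, h⟩
    have n1 := hne' (.inl i) (.inr j) (by simp)
    have n2 := hne' (.inl i) (.inr j') (by simp)
    have n3 := hne' (.inl i') (.inr j) (by simp)
    have n4 := hne' (.inl i') (.inr j') (by simp)
    obtain ⟨hside, hjlt⟩ := hside
    set x := r (.inl i) with hx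
    set y := r (.inl i') with hy
    set p := r (.inr j) with hp
    set q := r (.inr j') with hq
    by_cases hin : pos x < pos p ∧ pos p < pos y
    · -- x p q y
      have := hside.1 hin
      exact key i i' j' j hii hjj.symm x p q y (.inl ⟨rfl, rfl⟩) (.inr ⟨rfl, rfl⟩)
        hin.1 hjlt this.2
    · have hin' := mt hside.2 hin
      by_cases hq1 : pos q < pos x
      · -- p q x y
        exact key i i' j j' hii hjj p q x y (.inr ⟨rfl, rfl⟩) (.inr ⟨rfl, rfl⟩) hjlt hq1 hlt
      · by_cases hp1 : pos p < pos x
        · -- p x y q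
          exact key i' i j j' hii.symm hjj p x y q (.inr ⟨rfl, rfl⟩) (.inl ⟨rfl, rfl⟩)
            hp1 hlt (by omega)
        · -- x y p q
          exact key i i' j j' hii hjj x y p q (.inl ⟨rfl, rfl⟩) (.inl ⟨rfl, rfl⟩)
            hlt (by omega) hjlt

theorem nonCross_rotate {V : Type*} {G : SimpleGraph V} {l₁ l₂ : List V}
    (h : NonCross G (l₁ ++ l₂)) : NonCross G (l₂ ++ l₁) := by
  intro a b c d hs
  rw [List.sublist_append_iff] at hs
  obtain ⟨m1, m2, he, h1, h2⟩ := hs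
  have h3 : List.Sublist (m2 ++ m1) (l₁ ++ l₂) := h2.append h1
  rintro ⟨hac, hbd⟩
  rcases m1 with _ | ⟨x, _ | ⟨y, _ | ⟨z, _ | ⟨w, m⟩⟩⟩⟩
  · simp only [List.nil_append] at he
    subst he
    exact h _ _ _ _ (by simpa using h3) ⟨hac, hbd⟩
  · simp only [List.cons_append, List.nil_append, List.cons.injEq] at he
    obtain ⟨rfl, rfl⟩ := he
    exact h _ _ _ _ (by simpa using h3) ⟨hbd, hac.symm⟩
  · simp only [List.cons_append, List.nil_append, List.cons.injEq] at he
    obtain ⟨rfl, rfl, rfl⟩ := he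
    exact h _ _ _ _ (by simpa using h3) ⟨hac.symm, hbd.symm⟩
  · simp only [List.cons_append, List.nil_append, List.cons.injEq] at he
    obtain ⟨rfl, rfl, rfl, rfl⟩ := he
    exact h _ _ _ _ (by simpa using h3) ⟨hbd.symm, hac⟩
  · simp only [List.cons_append, List.cons.injEq] at he
    obtain ⟨rfl, rfl, rfl, rfl, he⟩ := he
    have he' := he.symm
    rw [List.append_eq_nil_iff] at he'
    obtain ⟨rfl, rfl⟩ := he'
    exact h _ _ _ _ (by simpa using h3) ⟨hac, hbd⟩

theorem nonCross_glue {V : Type*} {G : SimpleGraph V} {l₁ l₂ : List V} {x : V}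
    (h1 : NonCross G (x :: l₁)) (h2 : NonCross G (x :: l₂))
    (hno : ∀ a ∈ l₁, ∀ b ∈ l₂, ¬ G.Adj a b) : NonCross G (l₁ ++ x :: l₂) := by
  have h1' : NonCross G (l₁ ++ [x]) := nonCross_rotate (l₁ := [x]) h1
  intro a b c d hs
  rw [List.sublist_append_iff] at hs
  obtain ⟨m1, m2, he, k1, k2⟩ := hs
  rintro ⟨hac, hbd⟩
  rcases m1 with _ | ⟨x', _ | ⟨y, _ | ⟨z, _ | ⟨w, m⟩⟩⟩⟩
  · simp only [List.nil_append] at he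
    subst he
    exact h2 _ _ _ _ k2 ⟨hac, hbd⟩
  · simp only [List.cons_append, List.nil_append, List.cons.injEq] at he
    obtain ⟨rfl, rfl⟩ := he
    have k3 := k2.tail
    exact hno a (k1.subset (by simp)) c (k3.subset (by simp)) hac
  · simp only [List.cons_append, List.nil_append, List.cons.injEq] at he
    obtain ⟨rfl, rfl, rfl⟩ := he
    have k3 := k2.tail
    exact hno b (k1.subset (by simp)) d (k3.subset (by simp)) hbd
  · simp only [List.cons_append, List.nil_append, List.cons.injEq] at he
    obtain ⟨rfl, rfl, rfl, rfl⟩ := he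
    have hd : d ∈ x :: l₂ := k2.subset (by simp)
    rcases List.mem_cons.1 hd with rfl | hd
    · exact h1' _ _ _ _ (k1.append (List.Sublist.refl [d])) ⟨hac, hbd⟩
    · exact hno b (k1.subset (by simp)) d hd hbd
  · simp only [List.cons_append, List.cons.injEq] at he
    obtain ⟨rfl, rfl, rfl, rfl, he⟩ := he
    have he' := he.symm
    rw [List.append_eq_nil_iff] at he'
    obtain ⟨rfl, rfl⟩ := he'
    exact h1 _ _ _ _ (k1.trans (List.sublist_cons_self _ _)) ⟨hac, hbd⟩

/-- Cyclic chain of adjacent vertices. -/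
def CycChain {V : Type*} (G : SimpleGraph V) (l : List V) : Prop :=
  List.IsChain G.Adj (l ++ l)

theorem cycChain_cons {V : Type*} {G : SimpleGraph V} {u : V} {m : List V} :
    CycChain G (u :: m) ↔ List.IsChain G.Adj (u :: m ++ [u]) := by
  unfold CycChain
  rw [List.isChain_split]
  exact ⟨fun h => h.1, fun h => ⟨h, (List.isChain_append.1 h).1⟩⟩

theorem cycChain_rotate {V : Type*} {G : SimpleGraph V} {p q : List V}
    (h : CycChain G (p ++ q)) : CycChain G (q ++ p) := by
  unfold CycChain at *
  rcases p with _ | ⟨a, p⟩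
  · simpa using h
  rcases q with _ | ⟨b, q⟩
  · simpa using h
  have h2 : List.IsChain G.Adj (b :: q ++ a :: (p ++ [b])) := by
    have : List.IsChain G.Adj ((a :: p) ++ b :: (q ++ a :: (p ++ b :: q))) := by
      simpa using h
    have := (List.isChain_split.1 this).2
    have : List.IsChain G.Adj ((b :: q ++ a :: p) ++ b :: q) := by simpa using this
    have := (List.isChain_split.1 this).1
    simpa using this
  have := (cycChain_cons (G := G) (u := b) (m := q ++ a :: p)).2 (by simpa using h2)
  simpa [CycChain] using this

theorem k23_minor {V : Type*} {G : SimpleGraph V} {X Y P Q R : Set V}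
    (hX : CutConn G X) (hY : CutConn G Y) (hP : CutConn G P) (hQ : CutConn G Q)
    (hR : CutConn G R) (d1 : Disjoint X Y) (d2 : Disjoint X P) (d3 : Disjoint X Q)
    (d4 : Disjoint X R) (d5 : Disjoint Y P) (d6 : Disjoint Y Q) (d7 : Disjoint Y R)
    (d8 : Disjoint P Q) (d9 : Disjoint P R) (d10 : Disjoint Q R)
    (a1 : ∃ a ∈ X, ∃ b ∈ P, G.Adj a b) (a2 : ∃ a ∈ X, ∃ b ∈ Q, G.Adj a b)
    (a3 : ∃ a ∈ X, ∃ b ∈ R, G.Adj a b) (a4 : ∃ a ∈ Y, ∃ b ∈ P, G.Adj a b)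
    (a5 : ∃ a ∈ Y, ∃ b ∈ Q, G.Adj a b) (a6 : ∃ a ∈ Y, ∃ b ∈ R, G.Adj a b) :
    HasMinor G (completeBipartiteGraph (Fin 2) (Fin 3)) := by
  have hsw : ∀ S T : Set V, (∃ a ∈ S, ∃ b ∈ T, G.Adj a b) → ∃ a ∈ T, ∃ b ∈ S, G.Adj a b :=
    fun S T ⟨a, ha, b, hb, h⟩ => ⟨b, hb, a, ha, h.symm⟩
  have hall : ∀ w, CutConn G ((Sum.elim ![X, Y] ![P, Q, R] : Fin 2 ⊕ Fin 3 → Set V) w) := by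
    rintro (i | i) <;> fin_cases i <;> assumption
  refine ⟨Sum.elim ![X, Y] ![P, Q, R], fun w => (hall w).1,
    fun w => connected_of_cutConn (hall w), ?_, ?_⟩
  · rintro (i | i) (j | j) hij <;> fin_cases i <;> fin_cases j <;>
      first
      | exact absurd rfl hij
      | assumption
      | (apply Disjoint.symm; assumption)
  · rintro (i | i) (j | j) hij
    · simp at hij
    · fin_cases i <;> fin_cases j <;> assumption
    · fin_cases i <;> fin_cases j <;> (apply hsw; assumption)
    · simp at hij

theorem k4_minor {V : Type*} {G : SimpleGraph V} {X Y P Q : Set V}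
    (hX : CutConn G X) (hY : CutConn G Y) (hP : CutConn G P) (hQ : CutConn G Q)
    (d1 : Disjoint X Y) (d2 : Disjoint X P) (d3 : Disjoint X Q)
    (d5 : Disjoint Y P) (d6 : Disjoint Y Q) (d8 : Disjoint P Q)
    (a1 : ∃ a ∈ X, ∃ b ∈ Y, G.Adj a b) (a2 : ∃ a ∈ X, ∃ b ∈ P, G.Adj a b)
    (a3 : ∃ a ∈ X, ∃ b ∈ Q, G.Adj a b) (a4 : ∃ a ∈ Y, ∃ b ∈ P, G.Adj a b)
    (a5 : ∃ a ∈ Y, ∃ b ∈ Q, G.Adj a b) (a6 : ∃ a ∈ P, ∃ b ∈ Q, G.Adj a b) :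
    HasMinor G (⊤ : SimpleGraph (Fin 4)) := by
  have hsw : ∀ S T : Set V, (∃ a ∈ S, ∃ b ∈ T, G.Adj a b) → ∃ a ∈ T, ∃ b ∈ S, G.Adj a b :=
    fun S T ⟨a, ha, b, hb, h⟩ => ⟨b, hb, a, ha, h.symm⟩
  have hall : ∀ w, CutConn G ((![X, Y, P, Q] : Fin 4 → Set V) w) := by
    intro i
    fin_cases i <;> assumption
  refine ⟨![X, Y, P, Q], fun w => (hall w).1,
    fun w => connected_of_cutConn (hall w), ?_, ?_⟩
  · intro i j hij
    fin_cases i <;> fin_cases j <;>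
      first
      | exact absurd rfl hij
      | assumption
      | (apply Disjoint.symm; assumption)
  · intro i j hij
    fin_cases i <;> fin_cases j <;>
      first
      | exact absurd hij (SimpleGraph.irrefl _)
      | assumption
      | (apply hsw; assumption)

theorem chain_link {V : Type*} {G : SimpleGraph V} {a b : V} {l m : List V}
    (h : List.IsChain G.Adj (a :: l ++ b :: m)) :
    ∃ x ∈ {x | x ∈ a :: l}, ∃ y ∈ {x | x ∈ b :: m}, G.Adj x y := by
  have h := (List.isChain_append.1 h).2.2
  refine ⟨(a :: l).getLast (by simp), List.getLast_mem _, b, by simp, h _ ?_ b (by simp)⟩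
  rw [List.getLast?_eq_getLast_of_ne_nil (by simp)]
  rfl

theorem exists_path {V : Type*} {G : SimpleGraph V} {T : Set V} (hT : CutConn G T) {d e : V}
    (hd : d ∈ T) (he : e ∈ T) : ∃ t : List V, (d :: t).Nodup ∧ List.IsChain G.Adj (d :: t) ∧
      (d :: t).getLast? = some e ∧ ∀ x ∈ d :: t, x ∈ T := by
  classical
  obtain ⟨w⟩ := (connected_of_cutConn hT).preconnected ⟨d, hd⟩ ⟨e, he⟩
  have key : ∀ (u v : T) (p : (G.induce T).Walk u v), p.IsPath → ∃ t : List V,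
      (u.1 :: t).Nodup ∧ List.IsChain G.Adj (u.1 :: t) ∧
      (u.1 :: t).getLast? = some v.1 ∧ (∀ x ∈ u.1 :: t, x ∈ T) ∧
      ∀ x ∈ u.1 :: t, ∃ y ∈ p.support, y.1 = x := by
    intro u v p
    induction p with
    | nil =>
      intro _
      refine ⟨[], by simp, by simp, by simp, by simp, by simp⟩
    | @cons _ v' _ hadj p ih =>
      intro hp
      rw [Walk.cons_isPath_iff] at hp
      obtain ⟨t, h1, h2, h3, h4, h5⟩ := ih hp.1
      refine ⟨v'.1 :: t, ?_, ?_, ?_, ?_, ?_⟩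
      · rw [List.nodup_cons]
        refine ⟨fun hm => ?_, h1⟩
        obtain ⟨y, hy, hyx⟩ := h5 _ hm
        rw [Subtype.ext hyx] at hy
        exact hp.2 hy
      · rw [List.isChain_cons_cons]
        exact ⟨by simpa using hadj, h2⟩
      · rw [List.getLast?_cons_cons]
        exact h3
      · intro x hx
        rcases List.mem_cons.1 hx with rfl | hx
        · exact Subtype.property _
        · exact h4 x hx
      · intro x hx
        rcases List.mem_cons.1 hx with rfl | hx
        · exact ⟨_, by simp, rfl⟩
        · obtain ⟨y, hy, h⟩ := h5 x hx
          exact ⟨y, by simp [hy], h⟩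
  obtain ⟨t, h1, h2, h3, h4, -⟩ := key _ _ w.bypass w.bypass_isPath
  exact ⟨t, h1, h2, h3, h4⟩

theorem cyc_insert {V : Type*} {G : SimpleGraph V} {u w d e : V} {m t : List V}
    (hc : CycChain G (u :: w :: m)) (ht : List.IsChain G.Adj (d :: t))
    (hl : (d :: t).getLast? = some e) (hud : G.Adj u d) (hwe : G.Adj w e) :
    CycChain G (u :: (d :: t) ++ w :: m) := by
  have hc := cycChain_cons.1 hc
  rw [List.cons_append, cycChain_cons]
  simp only [List.cons_append, List.isChain_cons_cons] at hc ⊢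
  refine ⟨hud, ?_⟩
  have : List.IsChain G.Adj ((d :: t) ++ (w :: (m ++ [u]))) := by
    rw [List.isChain_append]
    refine ⟨ht, hc.2, ?_⟩
    intro x hx y hy
    rw [hl] at hx
    simp at hx hy
    subst hx hy
    exact hwe.symm
  simpa using this

theorem cyc_extend {V : Type*} [DecidableEq V] {G : SimpleGraph V} (hG : Outerplanar G)
    {s : Finset V} (hconn : ∀ x ∈ s, CutConn G {y | y ∈ s ∧ y ≠ x}) {l : List V}
    (hnd : l.Nodup) (hcyc : CycChain G l) (hsub : ∀ x ∈ l, x ∈ s) (h2 : 2 ≤ l.length)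
    (hv : ∃ v ∈ s, v ∉ l) :
    ∃ l' : List V, l'.Nodup ∧ CycChain G l' ∧ (∀ x ∈ l', x ∈ s) ∧ l.length < l'.length := by
  classical
  set U := s.filter (· ∉ l) with hU
  obtain ⟨v, hvs, hvl⟩ := hv
  have hF : (U.powerset.filter (fun D => D.Nonempty ∧
      ∀ a ∈ D, ∀ b ∈ U, G.Adj a b → b ∈ D)).Nonempty :=
    ⟨U, by simp only [Finset.mem_filter, Finset.mem_powerset]
           exact ⟨Finset.Subset.refl _, ⟨v, by simp [hU, hvs, hvl]⟩, fun _ _ b hb _ => hb⟩⟩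
  obtain ⟨D, hD, hmin⟩ := Finset.exists_min_image _ Finset.card hF
  simp only [Finset.mem_filter, Finset.mem_powerset] at hD hmin
  obtain ⟨hDU, hDne, hDcl⟩ := hD
  have hDl : ∀ x ∈ D, x ∉ l := fun x hx => (Finset.mem_filter.1 (hDU hx)).2
  have hDs : ∀ x ∈ D, x ∈ s := fun x hx => (Finset.mem_filter.1 (hDU hx)).1
  have hDc : CutConn G {x | x ∈ D} := by
    refine ⟨hDne, ?_⟩
    rintro A ⟨x, hx, hxA⟩ ⟨y, hy, hyA⟩
    by_contra hno
    have := hmin (D.filter (· ∈ A)) ⟨(Finset.filter_subset _ _).trans hDU,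
      ⟨x, Finset.mem_filter.2 ⟨hx, hxA⟩⟩, ?_⟩
    · have hlt : (D.filter (· ∈ A)).card < D.card := by
        apply Finset.card_lt_card
        rw [Finset.filter_ssubset]
        exact ⟨y, hy, hyA⟩
      omega
    · intro a ha b hb hab
      rw [Finset.mem_filter] at ha ⊢
      have hbD := hDcl a ha.1 b hb hab
      refine ⟨hbD, ?_⟩
      by_contra hbA
      exact hno ⟨a, ha.1, b, hbD, ha.2, hbA, hab⟩
  have hatt : ∀ x ∈ l, ∃ u ∈ l, u ≠ x ∧ ∃ d ∈ D, G.Adj u d := by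
    intro x hx
    obtain ⟨d, hd⟩ := hDne
    have hz : ∃ z ∈ l, z ≠ x := by
      by_contra hz
      push Not at hz
      rcases l with _ | ⟨p, _ | ⟨q, l⟩⟩
      · simp at h2
      · simp at h2
      · have e1 := hz p (by simp)
        have e2 := hz q (by simp)
        subst e1
        subst e2
        simp at hnd
    obtain ⟨z, hzl, hzx⟩ := hz
    obtain ⟨a, ha, b, hb, haD, hbD, hab⟩ := (hconn x (hsub x hx)).2 {y | y ∈ D}
      ⟨d, ⟨hDs d hd, by rintro rfl; exact hDl _ hd hx⟩, hd⟩
      ⟨z, ⟨hsub z hzl, hzx⟩, fun h => hDl z h hzl⟩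
    refine ⟨b, ?_, hb.2, a, haD, hab.symm⟩
    by_contra hbl
    exact hbD (hDcl a haD b (Finset.mem_filter.2 ⟨hb.1, hbl⟩) hab)
  obtain ⟨x0, hx0⟩ : ∃ x, x ∈ l := by
    rcases l with _ | ⟨p, l⟩
    · simp at h2
    · exact ⟨p, by simp⟩
  obtain ⟨u, hul, -, d, hd, hud⟩ := hatt x0 hx0
  obtain ⟨w, hwl, hwu, e, he, hwe⟩ := hatt u hul
  obtain ⟨p, q, rfl⟩ := List.append_of_mem hul
  have hcyc1 : CycChain G (u :: (q ++ p)) := cycChain_rotate hcyc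
  have hw1 : w ∈ q ++ p := by
    simp at hwl ⊢
    tauto
  obtain ⟨l1, l2, hl⟩ := List.append_of_mem hw1
  have hperm : (p ++ u :: q).Perm (u :: (l1 ++ w :: l2)) := by
    rw [← hl]
    exact List.perm_append_comm (l₁ := p) (l₂ := u :: q)
  rw [hl] at hcyc1
  clear hcyc
  have hnd1 := hperm.nodup_iff.1 hnd
  have hDl1 : ∀ x ∈ D, x ∉ u :: (l1 ++ w :: l2) := fun x hx h => hDl x hx (hperm.mem_iff.2 h)
  have hsub1 : ∀ x ∈ u :: (l1 ++ w :: l2), x ∈ s := fun x h => hsub x (hperm.mem_iff.2 h)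
  rw [hperm.length_eq]
  clear hatt hx0 hul hwl hw1 hl hnd hDl hsub h2 hvl hF hDcl hmin
  rcases l1 with _ | ⟨a, l1⟩
  · obtain ⟨t, t1, t2, t3, t4⟩ := exists_path hDc hd he
    refine ⟨u :: (d :: t) ++ w :: l2, ?_, cyc_insert hcyc1 t2 t3 hud hwe, ?_, ?_⟩
    · have hpm : (u :: (d :: t) ++ w :: l2).Perm ((d :: t) ++ (u :: w :: l2)) :=
        (List.perm_middle (a := u) (l₁ := d :: t) (l₂ := w :: l2)).symm
      rw [hpm.nodup_iff, List.nodup_append']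
      exact ⟨t1, hnd1, fun x hx hx' => hDl1 x (t4 x hx) hx'⟩
    · intro x hx
      by_cases hxt : x ∈ d :: t
      · exact hDs x (t4 x hxt)
      · apply hsub1
        simp at hx hxt ⊢
        tauto
    · simp
  rcases l2 with _ | ⟨b, l2⟩
  · obtain ⟨t, t1, t2, t3, t4⟩ := exists_path hDc he hd
    have hcyc2 : CycChain G (w :: u :: (a :: l1)) :=
      cycChain_rotate (p := u :: a :: l1) (q := [w]) (by simpa using hcyc1)
    have hpm0 : (u :: (a :: l1 ++ [w])).Perm (w :: u :: (a :: l1)) :=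
      List.perm_append_comm (l₁ := u :: a :: l1) (l₂ := [w])
    refine ⟨w :: (e :: t) ++ u :: (a :: l1), ?_, cyc_insert hcyc2 t2 t3 hwe hud, ?_, ?_⟩
    · have hpm : (w :: (e :: t) ++ u :: (a :: l1)).Perm ((e :: t) ++ (w :: u :: (a :: l1))) :=
        (List.perm_middle (a := w) (l₁ := e :: t) (l₂ := u :: (a :: l1))).symm
      rw [hpm.nodup_iff, List.nodup_append']
      exact ⟨t1, hpm0.nodup_iff.1 hnd1, fun x hx hx' => hDl1 x (t4 x hx) (hpm0.mem_iff.2 hx')⟩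
    · intro x hx
      by_cases hxt : x ∈ e :: t
      · exact hDs x (t4 x hxt)
      · apply hsub1
        simp at hx hxt ⊢
        tauto
    · simp
  exfalso
  apply hG.2
  have hch := cycChain_cons.1 hcyc1
  have c1 : List.IsChain G.Adj (u :: [] ++ a :: (l1 ++ w :: b :: l2 ++ [u])) := by
    simpa using hch
  have c2 : List.IsChain G.Adj ((a :: l1) ++ w :: (b :: l2 ++ [u])) := by
    have := c1.tail
    simpa using this
  have c3 : List.IsChain G.Adj (w :: [] ++ b :: (l2 ++ [u])) := by
    have := (List.isChain_append.1 c2).2.1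
    simpa using this
  have c4 : List.IsChain G.Adj (b :: l2 ++ u :: []) := by
    have := c3.tail
    simpa using this
  have c2' : List.IsChain G.Adj (a :: l1 ++ w :: []) := (List.isChain_split.1 c2).1
  have hA : CutConn G {x | x ∈ a :: l1} := cutConn_list _ _ (List.isChain_append.1 c2').1
  have hB : CutConn G {x | x ∈ b :: l2} := cutConn_list _ _ (List.isChain_append.1 c4).1
  have hua : G.Adj u a := by
    simp only [List.cons_append, List.nil_append, List.isChain_cons_cons] at c1
    exact c1.1
  have hwb : G.Adj w b := by
    simp only [List.cons_append, List.nil_append, List.isChain_cons_cons] at c3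
    exact c3.1
  obtain ⟨y1, hy1, z1, hz1, hyz1⟩ := chain_link c2'
  obtain ⟨y2, hy2, z2, hz2, hyz2⟩ := chain_link c4
  simp only [List.mem_singleton, Set.mem_ofPred_eq] at hz1 hz2
  subst hz1 hz2
  have hnd2 : ([z2] ++ ((a :: l1) ++ ([z1] ++ (b :: l2)))).Nodup := by simpa using hnd1
  have hDl2 : ∀ x ∈ D, x ∉ [z2] ++ ((a :: l1) ++ ([z1] ++ (b :: l2))) := by simpa using hDl1
  rw [List.nodup_append', List.nodup_append', List.nodup_append'] at hnd2
  obtain ⟨-, ⟨-, ⟨-, -, n1⟩, n2⟩, n3⟩ := hnd2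
  refine k23_minor (cutConn_singleton z2) (cutConn_singleton z1) hA hB hDc
    ?_ ?_ ?_ ?_ ?_ ?_ ?_ ?_ ?_ ?_
    ⟨z2, rfl, a, by simp, hua⟩ ⟨z2, rfl, y2, hy2, hyz2.symm⟩ ⟨z2, rfl, d, hd, hud⟩
    ⟨z1, rfl, y1, hy1, hyz1.symm⟩ ⟨z1, rfl, b, by simp, hwb⟩ ⟨z1, rfl, e, he, hwe⟩
  all_goals
    rw [Set.disjoint_left]
    intro x hx hx'
    simp only [Set.mem_singleton_iff, Set.mem_ofPred_eq] at hx hx'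
  · exact n3 (List.mem_singleton.2 hx) (by simp [hx'])
  · exact n3 (List.mem_singleton.2 hx) (List.mem_append_left _ hx')
  · exact n3 (List.mem_singleton.2 hx) (List.mem_append_right _ (List.mem_append_right _ hx'))
  · exact hDl2 x hx' (List.mem_append_left _ (List.mem_singleton.2 hx))
  · exact n2 hx' (by simp [hx])
  · exact n1 (List.mem_singleton.2 hx) hx'
  · exact hDl2 x hx' (by simp [hx])
  · exact n2 hx (List.mem_append_right _ hx')
  · exact hDl2 x hx' (List.mem_append_right _ (List.mem_append_left _ hx))
  · exact hDl2 x hx' (List.mem_append_right _ (List.mem_append_right _ (List.mem_append_right _ hx)))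

theorem exists_ham_s5 {V : Type*} [DecidableEq V] {G : SimpleGraph V} (hG : Outerplanar G)
    {s : Finset V} (hconn : ∀ x ∈ s, CutConn G {y | y ∈ s ∧ y ≠ x}) :
    ∀ (k : ℕ) (l : List V), s.card - l.length ≤ k → l.Nodup → CycChain G l → (∀ x ∈ l, x ∈ s) →
      2 ≤ l.length → ∃ l' : List V, l'.Nodup ∧ CycChain G l' ∧ (∀ x, x ∈ l' ↔ x ∈ s) := by
  intro k
  induction k with
  | zero =>
    intro l hk hnd hc hs h2
    refine ⟨l, hnd, hc, fun x => ⟨hs x, fun hx => ?_⟩⟩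
    have h1 : l.toFinset = s := by
      apply Finset.eq_of_subset_of_card_le
      · intro y hy
        exact hs y (List.mem_toFinset.1 hy)
      · rw [List.toFinset_card_of_nodup hnd]
        omega
    rw [← h1] at hx
    exact List.mem_toFinset.1 hx
  | succ k ih =>
    intro l hk hnd hc hs h2
    by_cases hv : ∃ v ∈ s, v ∉ l
    · obtain ⟨l', h1, h3, h4, h5⟩ := cyc_extend hG hconn hnd hc hs h2 hv
      exact ih l' (by omega) h1 h3 h4 (by omega)
    · push Not at hv
      exact ⟨l, hnd, hc, fun x => ⟨hs x, hv x⟩⟩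

theorem nonCross_of_ham {V : Type*} {G : SimpleGraph V} (hG : Outerplanar G) {l : List V}
    (hnd : l.Nodup) (hc : CycChain G l) : NonCross G l := by
  rintro a b c d hs ⟨hac, hbd⟩
  rw [List.cons_sublist_iff] at hs
  obtain ⟨r1, r2, rfl, ha, hs⟩ := hs
  rw [List.cons_sublist_iff] at hs
  obtain ⟨r3, r4, rfl, hb, hs⟩ := hs
  rw [List.cons_sublist_iff] at hs
  obtain ⟨r5, r6, rfl, hc', hs⟩ := hs
  rw [List.singleton_sublist] at hs
  obtain ⟨p1, q1, rfl⟩ := List.append_of_mem ha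
  obtain ⟨p2, q2, rfl⟩ := List.append_of_mem hb
  obtain ⟨p3, q3, rfl⟩ := List.append_of_mem hc'
  obtain ⟨p4, q4, rfl⟩ := List.append_of_mem hs
  have e : p1 ++ a :: q1 ++ (p2 ++ b :: q2 ++ (p3 ++ c :: q3 ++ (p4 ++ d :: q4))) =
      p1 ++ ((a :: (q1 ++ p2)) ++ ((b :: (q2 ++ p3)) ++ ((c :: (q3 ++ p4)) ++ (d :: q4)))) := by
    simp
  rw [e] at hc hnd
  have hc1 := cycChain_rotate hc
  have hnd1 := (List.perm_append_comm (l₁ := p1)).nodup_iff.1 hnd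
  generalize q1 ++ p2 = m1 at *
  generalize q2 ++ p3 = m2 at *
  generalize q3 ++ p4 = m3 at *
  have e2 : (a :: m1) ++ ((b :: m2) ++ ((c :: m3) ++ (d :: q4))) ++ p1 =
     (a :: m1) ++ ((b :: m2) ++ ((c :: m3) ++ (d :: (q4 ++ p1)))) := by simp
  rw [e2] at hc1 hnd1
  generalize q4 ++ p1 = m4 at *
  have c1 : List.IsChain G.Adj ((a :: m1) ++ b :: (m2 ++ c :: (m3 ++ d :: (m4 ++ [a])))) := by
    have := cycChain_cons.1 hc1
    simpa using this
  have c2 : List.IsChain G.Adj ((b :: m2) ++ c :: (m3 ++ d :: (m4 ++ [a]))) :=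
    (List.isChain_append.1 c1).2.1
  have c3 : List.IsChain G.Adj ((c :: m3) ++ d :: (m4 ++ [a])) :=
    (List.isChain_append.1 c2).2.1
  have c4 : List.IsChain G.Adj ((d :: m4) ++ a :: []) :=
    (List.isChain_append.1 c3).2.1
  have c1' := (List.isChain_split.1 c1).1
  have c2' := (List.isChain_split.1 c2).1
  have c3' := (List.isChain_split.1 c3).1
  have k1 := cutConn_list _ _ (List.isChain_append.1 c1).1
  have k2 := cutConn_list _ _ (List.isChain_append.1 c2).1
  have k3 := cutConn_list _ _ (List.isChain_append.1 c3).1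
  have k4 := cutConn_list _ _ (List.isChain_append.1 c4).1
  rw [List.nodup_append', List.nodup_append', List.nodup_append'] at hnd1
  obtain ⟨-, ⟨-, ⟨-, -, n1⟩, n2⟩, n3⟩ := hnd1
  apply hG.1
  have up : ∀ (x y : V) (m : List V), (∃ z ∈ {z | z ∈ x :: m}, ∃ t ∈ {t | t ∈ [y]}, G.Adj z t) →
      ∃ z ∈ {z | z ∈ x :: m}, G.Adj z y := by
    rintro x y m ⟨z, hz, t, ht, h⟩
    have : t = y := by simpa using ht
    subst this
    exact ⟨z, hz, h⟩
  obtain ⟨z1, hz1, g1⟩ := up _ _ _ (chain_link c1')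
  obtain ⟨z2, hz2, g2⟩ := up _ _ _ (chain_link c2')
  obtain ⟨z3, hz3, g3⟩ := up _ _ _ (chain_link c3')
  obtain ⟨z4, hz4, g4⟩ := up _ _ _ (chain_link c4)
  refine k4_minor k1 k2 k3 k4 ?_ ?_ ?_ ?_ ?_ ?_
    ⟨z1, hz1, b, by simp, g1⟩ ⟨a, by simp, c, by simp, hac⟩ ⟨a, by simp, z4, hz4, g4.symm⟩
    ⟨z2, hz2, c, by simp, g2⟩ ⟨b, by simp, d, by simp, hbd⟩ ⟨z3, hz3, d, by simp, g3⟩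
  all_goals
    rw [Set.disjoint_left]
    intro x hx hx'
    simp only [Set.mem_ofPred_eq] at hx hx'
  · exact n3 hx (List.mem_append_left _ hx')
  · exact n3 hx (List.mem_append_right _ (List.mem_append_left _ hx'))
  · exact n3 hx (List.mem_append_right _ (List.mem_append_right _ hx'))
  · exact n2 hx (List.mem_append_left _ hx')
  · exact n2 hx (List.mem_append_right _ hx')
  · exact n1 hx hx'

theorem exists_nonCross {V : Type*} [DecidableEq V] {G : SimpleGraph V} (hG : Outerplanar G) :
    ∀ (n : ℕ) (s : Finset V), s.card = n →
      ∃ l : List V, l.Nodup ∧ (∀ x, x ∈ l ↔ x ∈ s) ∧ NonCross G l := by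
  classical
  intro n
  induction n using Nat.strong_induction_on with
  | _ n ih =>
  intro s hs
  by_cases h3 : s.card ≤ 3
  · refine ⟨s.toList, s.nodup_toList, fun x => Finset.mem_toList, ?_⟩
    intro a b c d hsub
    have := hsub.length_le
    simp at this
    omega
  push Not at h3
  by_cases hconn : ∀ x ∈ s, CutConn G {y | y ∈ s ∧ y ≠ x}
  · obtain ⟨x, hx⟩ : s.Nonempty := Finset.card_pos.1 (by omega)
    obtain ⟨y, hy, z, hz, hyz⟩ := Finset.one_lt_card.1
      (show 1 < (s.erase x).card by rw [Finset.card_erase_of_mem hx]; omega)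
    rw [Finset.mem_erase] at hy hz
    obtain ⟨a, ha, b, hb, -, -, hab⟩ := (hconn x hx).2 {y} ⟨y, ⟨hy.2, hy.1⟩, rfl⟩
      ⟨z, ⟨hz.2, hz.1⟩, hyz.symm⟩
    obtain ⟨l, h1, h2, h4⟩ := exists_ham_s5 hG hconn _ [a, b] le_rfl (by simpa using hab.ne)
      (by simp [CycChain, hab, hab.symm])
      (by
        intro w hw
        simp at hw
        rcases hw with rfl | rfl
        · exact ha.1
        · exact hb.1) (by simp)
    exact ⟨l, h1, h4, nonCross_of_ham hG h1 h2⟩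
  · push Not at hconn
    obtain ⟨x, hx, hnc⟩ := hconn
    have hne : ({y | y ∈ s ∧ y ≠ x} : Set V).Nonempty := by
      obtain ⟨y, hy⟩ : (s.erase x).Nonempty :=
        Finset.card_pos.1 (by rw [Finset.card_erase_of_mem hx]; omega)
      rw [Finset.mem_erase] at hy
      exact ⟨y, hy.2, hy.1⟩
    have hA : ∃ A : Set V, (∃ y ∈ s, y ≠ x ∧ y ∈ A) ∧ (∃ z ∈ s, z ≠ x ∧ z ∉ A) ∧
        ∀ a ∈ s, a ≠ x → a ∈ A → ∀ b ∈ s, b ≠ x → b ∉ A → ¬ G.Adj a b := by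
      by_contra hno
      push Not at hno
      refine hnc ⟨hne, ?_⟩
      rintro A ⟨y, hy, hyA⟩ ⟨z, hz, hzA⟩
      obtain ⟨a, h1, h2, h3, b, h4, h5, h6, h7⟩ := hno A ⟨y, hy.1, hy.2, hyA⟩ ⟨z, hz.1, hz.2, hzA⟩
      exact ⟨a, ⟨h1, h2⟩, b, ⟨h4, h5⟩, h3, h6, h7⟩
    obtain ⟨A, ⟨y, hy, hyx, hyA⟩, ⟨z, hz, hzx, hzA⟩, hno⟩ := hA
    have hpart : ∀ P : V → Prop, (∃ y ∈ s, y ≠ x ∧ ¬ P y) → ∃ l : List V, (x :: l).Nodup ∧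
        (∀ w, w ∈ l ↔ w ∈ s ∧ w ≠ x ∧ P w) ∧ NonCross G (x :: l) := by
      rintro P ⟨y, hy, hyx, hyP⟩
      have hlt : (s.filter (fun w => w = x ∨ P w)).card < n := by
        rw [← hs]
        apply Finset.card_lt_card
        rw [Finset.filter_ssubset]
        exact ⟨y, hy, by tauto⟩
      obtain ⟨l, h1, h2, h4⟩ := ih _ hlt _ rfl
      have hxl : x ∈ l := (h2 x).2 (by simp [hx])
      obtain ⟨p, q, rfl⟩ := List.append_of_mem hxl
      have hperm : (p ++ x :: q).Perm (x :: (q ++ p)) :=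
        List.perm_append_comm (l₁ := p) (l₂ := x :: q)
      have hnd := hperm.nodup_iff.1 h1
      refine ⟨q ++ p, hnd, ?_, nonCross_rotate h4⟩
      intro w
      have h5 := h2 w
      rw [hperm.mem_iff, List.mem_cons, Finset.mem_filter] at h5
      have h6 := (List.nodup_cons.1 hnd).1
      by_cases hwx : w = x
      · subst hwx
        tauto
      · tauto
    obtain ⟨l1, a1, a2, a3⟩ := hpart (· ∈ A) ⟨z, hz, hzx, hzA⟩
    obtain ⟨l2, b1, b2, b3⟩ := hpart (· ∉ A) ⟨y, hy, hyx, by simpa using hyA⟩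
    refine ⟨l1 ++ x :: l2, ?_, ?_, nonCross_glue a3 b3 ?_⟩
    · rw [List.nodup_append']
      refine ⟨(List.nodup_cons.1 a1).2, b1, ?_⟩
      intro w hw hw'
      rcases List.mem_cons.1 hw' with rfl | hw'
      · exact (List.nodup_cons.1 a1).1 hw
      · exact ((b2 w).1 hw').2.2 ((a2 w).1 hw).2.2
    · intro w
      rw [List.mem_append, List.mem_cons, a2, b2]
      by_cases hwx : w = x
      · subst hwx
        tauto
      · tauto
    · intro a ha b hb
      have ha := (a2 a).1 ha
      have hb := (b2 b).1 hb
      exact hno a ha.1 ha.2.1 ha.2.2 b hb.1 hb.2.1 hb.2.2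

theorem final_step {V : Type*} [Fintype V] [DecidableEq V] (G : SimpleGraph V)
    [DecidableRel G.Adj] (h : MaximalOuterplanar G) (hn : 4 ≤ Fintype.card V) (pos : V → ℕ)
    (hinj : Function.Injective pos) (hlt : ∀ v, pos v < Fintype.card V)
    (hsurj : ∀ i < Fintype.card V, ∃ v, pos v = i)
    (hnc : ∀ a b c d, pos a < pos b → pos b < pos c → pos c < pos d →
      ¬ (G.Adj a c ∧ G.Adj b d)) :
    (∀ u v : V, G.degree u = 2 → G.degree v = 2 → ¬ G.Adj u v) ∧
    2 * (Finset.univ.filter fun v => G.degree v = 2).card ≤ Fintype.card V := by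
  classical
  have hadd : ∀ u v, pos u < pos v → (∀ a b, G.Adj a b → pos u < pos a → pos a < pos v →
      pos u ≤ pos b ∧ pos b ≤ pos v) → G.Adj u v := by
    intro u v huv hab
    by_contra hno
    have hne : u ≠ v := by rintro rfl; omega
    refine h.2 u v hne hno (outerplanar_of_pos hinj ?_)
    rintro a b c d h1 h2 h3 ⟨hac, hbd⟩
    simp only [sup_adj, fromEdgeSet_adj, Set.mem_singleton_iff, Sym2.eq_iff] at hac hbd
    rcases hac with hac | ⟨⟨rfl, rfl⟩ | ⟨rfl, rfl⟩, -⟩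
    · rcases hbd with hbd | ⟨⟨rfl, rfl⟩ | ⟨rfl, rfl⟩, -⟩
      · exact hnc a b c d h1 h2 h3 ⟨hac, hbd⟩
      · have := hab c a hac.symm h2 h3
        omega
      · omega
    · rcases hbd with hbd | ⟨⟨rfl, rfl⟩ | ⟨rfl, rfl⟩, -⟩
      · have := hab b d hbd h1 h2
        omega
      · omega
      · omega
    · omega
  have hnext : ∀ x, ∃ y, pos y = pos x + 1 ∨ (pos x + 1 = Fintype.card V ∧ pos y = 0) := by
    intro x
    have := hlt x
    by_cases hx : pos x + 1 = Fintype.card V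
    · obtain ⟨y, hy⟩ := hsurj 0 (by omega)
      exact ⟨y, .inr ⟨hx, hy⟩⟩
    · obtain ⟨y, hy⟩ := hsurj (pos x + 1) (by omega)
      exact ⟨y, .inl hy⟩
  choose nxt hnxt using hnext
  have hprev : ∀ x, ∃ y, nxt y = x := by
    intro x
    have := hlt x
    by_cases hx : pos x = 0
    · obtain ⟨y, hy⟩ := hsurj (Fintype.card V - 1) (by omega)
      refine ⟨y, hinj ?_⟩
      have := hnxt y
      have := hlt (nxt y)
      omega
    · obtain ⟨y, hy⟩ := hsurj (pos x - 1) (by omega)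
      refine ⟨y, hinj ?_⟩
      have := hnxt y
      omega
  have hadjn : ∀ x, G.Adj x (nxt x) := by
    intro x
    rcases hnxt x with hx | hx
    · exact hadd _ _ (by omega) (by intro a b _ _ _; omega)
    · refine (hadd _ _ (by omega) ?_).symm
      intro a b _ _ _
      have := hlt b
      omega
  have hnb : ∀ y, G.degree (nxt y) = 2 → ∀ w, G.Adj (nxt y) w → w = y ∨ w = nxt (nxt y) := by
    intro y hdeg w hw
    have hne : y ≠ nxt (nxt y) := by
      intro he
      have := congrArg pos he
      have := hnxt y
      have := hnxt (nxt y)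
      omega
    have hsub : ({y, nxt (nxt y)} : Finset V) ⊆ G.neighborFinset (nxt y) := by
      intro z hz
      simp only [Finset.mem_insert, Finset.mem_singleton] at hz
      rw [mem_neighborFinset]
      rcases hz with rfl | rfl
      · exact (hadjn _).symm
      · exact hadjn _
    have heq := Finset.eq_of_subset_of_card_le hsub (by
      rw [card_neighborFinset_eq_degree, hdeg, Finset.card_pair hne])
    have hw' : w ∈ G.neighborFinset (nxt y) := by simpa using hw
    rw [← heq] at hw'
    simpa using hw'
  have hskip : ∀ y, G.degree (nxt y) = 2 → G.Adj y (nxt (nxt y)) := by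
    intro y hdeg
    have e1 := hnxt y
    have e2 := hnxt (nxt y)
    have hcl := hnb y hdeg
    generalize nxt (nxt y) = z at *
    generalize nxt y = x at *
    have l1 := hlt y
    have l2 := hlt z
    by_cases hyz : pos y < pos z
    · apply hadd _ _ hyz
      intro a b hab h1 h2
      have : a = x := hinj (by omega)
      subst this
      rcases hcl b hab with rfl | rfl <;> omega
    · refine (hadd z y (by omega) ?_).symm
      intro a b hab h1 h2
      have l3 := hlt b
      by_contra hb
      have : b = x := hinj (by omega)
      subst this
      rcases hcl a hab.symm with rfl | rfl <;> omega
  have hmain : ∀ x, G.degree x = 2 → G.degree (nxt x) = 2 → False := by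
    intro x hx hz
    obtain ⟨y, rfl⟩ := hprev x
    have hyz := hskip y hx
    have e1 := hnxt y
    have e2 := hnxt (nxt y)
    rcases hnb (nxt y) hz y hyz.symm with he | he
    · have := congrArg pos he
      omega
    · have := congrArg pos he
      have e3 := hnxt (nxt (nxt y))
      omega
  have hind : ∀ u v : V, G.degree u = 2 → G.degree v = 2 → ¬ G.Adj u v := by
    intro u v hu hv huv
    obtain ⟨y, rfl⟩ := hprev u
    rcases hnb y hu v huv with rfl | rfl
    · exact hmain _ hv hu
    · exact hmain _ hu hv
  refine ⟨hind, ?_⟩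
  have hni : Function.Injective nxt := by
    intro a b hab
    have e1 := hnxt a
    have e2 := hnxt b
    rw [hab] at e1
    exact hinj (by omega)
  have hc : (Finset.univ.filter fun v => G.degree v = 2).card ≤
      ((Finset.univ.filter fun v => G.degree v = 2)ᶜ).card := by
    apply Finset.card_le_card_of_injOn nxt
    · intro x hx
      simp at hx ⊢
      exact fun hz => hmain x hx hz
    · exact hni.injOn
  rw [Finset.card_compl] at hc
  have := Finset.card_le_univ (Finset.univ.filter fun v => G.degree v = 2)
  omega

/-- In a maximal outerplanar graph on `n ≥ 4` vertices the
vertices of degree 2 form an independent set of size at most `n/2`. -/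
theorem degree_two_independent_of_maximalOuterplanar {V : Type*} [Fintype V]
    [DecidableEq V] (G : SimpleGraph V) [DecidableRel G.Adj]
    (h : MaximalOuterplanar G) (hn : 4 ≤ Fintype.card V) :
    (∀ u v : V, G.degree u = 2 → G.degree v = 2 → ¬ G.Adj u v) ∧
    2 * (Finset.univ.filter fun v => G.degree v = 2).card ≤ Fintype.card V := by
  obtain ⟨l, hnd, hmem, hl⟩ := exists_nonCross h.1 _ Finset.univ rfl
  have hmem' : ∀ x, x ∈ l := fun x => (hmem x).2 (Finset.mem_univ x)
  let e := hnd.getEquivOfForallMemList l hmem'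
  have hlen : l.length = Fintype.card V := by
    have := Fintype.card_congr e
    simpa using this
  have hget : ∀ v, l[e.symm v] = v := fun v => e.apply_symm_apply v
  refine final_step G h hn (fun v => (e.symm v).val) ?_ ?_ ?_ ?_
  · intro a b hab
    exact e.symm.injective (Fin.ext hab)
  · intro v
    rw [← hlen]
    exact (e.symm v).isLt
  · intro i hi
    exact ⟨e ⟨i, by omega⟩, by simp⟩
  · intro a b c d h1 h2 h3
    apply hl
    have h4 : List.Pairwise (· < ·) [e.symm a, e.symm b, e.symm c, e.symm d] := by
      simp only [List.pairwise_cons, List.mem_cons, List.not_mem_nil, Fin.lt_def]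
      refine ⟨?_, ?_, ?_, ?_, ?_⟩ <;> first | exact List.Pairwise.nil | skip
      all_goals
        intro x hx
        rcases hx with rfl | rfl | rfl | hx <;> first | omega | simp_all <;> omega
    have := List.map_getElem_sublist h4
    simp only [List.map_cons, List.map_nil, hget] at this
    exact this
end
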